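/- arXiv:2510.00364 — 4 statements merged into one kernel-verified Lean document; each statement's English description precedes it below -/
import Mathlib

section
/- Let P = (h_1 h_2 h_3 h_4 … h_k) be a partition where h_1 = h_2 = h_3 ≥ 2, h_4 ≥ h_5 ≥ … ≥ h_k > 0, h_1(h_1 − 1) ≥ 2(h_k − 1), r = h_4 + h_5 + … + h_k is even, h_4 ≤ (r−2)/4, and 2h_4 + 2 ≤ 3h_1 + 1 ≤ r + 1 − 2h_4. Then there exists an outline square O associated to P such that O(i,i) consists of h_i^2 copies of symbol i for each i ∈ {1,…,k}; O(1,2), O(2,3) and O(3,1) consist of h_1^2 copies of symbols 3, 1, and 2 respectively; and O(1,3), O(2,1) and O(3,2) contain at least h_1(h_1−1) − 2(h_k−1) copies of symbols 2, 3, and 1 respectively. -/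
/-- An outline rectangle associated to partitions `(p, q, r)` (of a common `n`):
a `u × v` array `O` of multisets with elements from `{1,…,t}` (encoded as
`Fin t`) such that the cell `O i j` contains exactly `p i * q j` elements
(with multiplicity), each symbol `l` occurs exactly `p i * r l` times in row
`i`, and each symbol `l` occurs exactly `q j * r l` times in column `j`.
When `p = q = r` it is an outline square associated to `p`. -/
def IsOutlineRectangle {u v t : ℕ} (p : Fin u → ℕ) (q : Fin v → ℕ) (r : Fin t → ℕ)
    (O : Fin u → Fin v → Multiset (Fin t)) : Prop :=
  (∀ i j, Multiset.card (O i j) = p i * q j) ∧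
  (∀ i l, ∑ j, (O i j).count l = p i * r l) ∧
  (∀ j l, ∑ i, (O i j).count l = q j * r l)

/-- An outline square associated to the partition `p`. -/
def IsOutlineSquare {k : ℕ} (p : Fin k → ℕ) (O : Fin k → Fin k → Multiset (Fin k)) : Prop :=
  IsOutlineRectangle p p p O

section OutlineConstruction

open Finset

lemma exists_perm_pos_of_regular {X : Type*} [Fintype X] [DecidableEq X] (W : X → X → ℕ) (s : ℕ)
    (hs : 0 < s) (hr : ∀ x, ∑ y, W x y = s) (hc : ∀ y, ∑ x, W x y = s) :
    ∃ σ : Equiv.Perm X, ∀ x, 0 < W x (σ x) := by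
  let N : X → Finset X := fun x => univ.filter fun y => 0 < W x y
  obtain ⟨f, hf, hfN⟩ := (Finset.all_card_le_biUnion_card_iff_exists_injective N).1 (by
    intro A
    have h1 : ∑ x ∈ A, ∑ y, W x y = #A * s := by simp [hr]
    have h2 : ∑ x ∈ A, ∑ y, W x y = ∑ x ∈ A, ∑ y ∈ A.biUnion N, W x y := by
      refine sum_congr rfl fun x hx => (sum_subset (subset_univ _) fun y _ hy => ?_).symm
      by_contra h0
      exact hy (mem_biUnion.2 ⟨x, hx, by simp [N]; omega⟩)
    have h3 : ∑ y ∈ A.biUnion N, ∑ x ∈ A, W x y ≤ #(A.biUnion N) * s := by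
      refine (sum_le_card_nsmul _ _ s fun y _ => ?_).trans_eq (by simp)
      rw [← hc y]
      exact sum_le_sum_of_subset (subset_univ _)
    rw [sum_comm] at h3
    exact Nat.le_of_mul_le_mul_right (by omega) hs)
  refine ⟨Equiv.ofBijective f (Finite.injective_iff_bijective.1 hf), fun x => ?_⟩
  have := hfN x
  simpa [N] using this

lemma exists_regular_le {X : Type*} [Fintype X] [DecidableEq X] (U : X → X → ℕ) (p q : ℕ)
    (hr : ∀ x, ∑ y, U x y = p + q) (hc : ∀ y, ∑ x, U x y = p + q) :
    ∃ V : X → X → ℕ, (∀ x y, V x y ≤ U x y) ∧ (∀ x, ∑ y, V x y = p) ∧ ∀ y, ∑ x, V x y = p := by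
  induction p generalizing q with
  | zero => exact ⟨fun _ _ => 0, by simp⟩
  | succ p ih =>
    obtain ⟨V, hVU, hVr, hVc⟩ := ih (q + 1) (fun x => by rw [hr]; ring) fun y => by rw [hc]; ring
    obtain ⟨σ, hσ⟩ := exists_perm_pos_of_regular (fun x y => U x y - V x y) (q + 1) (by omega)
      (fun x => by rw [sum_tsub_distrib _ fun y _ => hVU x y, hr, hVr]; omega)
      (fun y => by rw [sum_tsub_distrib _ fun x _ => hVU x y, hc, hVc]; omega)
    refine ⟨fun x y => V x y + if σ x = y then 1 else 0, fun x y => ?_, fun x => ?_, fun y => ?_⟩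
    · have h1 := hVU x y
      have h2 := hσ x
      dsimp only at h2 ⊢
      split_ifs with h
      · subst h; omega
      · omega
    · rw [sum_add_distrib, hVr]; simp
    · rw [sum_add_distrib, hVc]
      simp [← Equiv.eq_symm_apply]

lemma exists_split_three {X : Type*} [Fintype X] [DecidableEq X] (U : X → X → ℕ) (a : ℕ)
    (hr : ∀ x, ∑ y, U x y = 3 * a) (hc : ∀ y, ∑ x, U x y = 3 * a) :
    ∃ V : Fin 3 → X → X → ℕ, (∀ x y, ∑ μ, V μ x y = U x y) ∧ (∀ μ x, ∑ y, V μ x y = a) ∧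
      ∀ μ y, ∑ x, V μ x y = a := by
  obtain ⟨V₁, hU₁, hr₁, hc₁⟩ := exists_regular_le U a (2 * a) (fun x => by rw [hr]; ring)
    fun y => by rw [hc]; ring
  have hr' : ∀ x, ∑ y, (U x y - V₁ x y) = 2 * a := fun x => by
    rw [sum_tsub_distrib _ fun y _ => hU₁ x y, hr, hr₁]; omega
  have hc' : ∀ y, ∑ x, (U x y - V₁ x y) = 2 * a := fun y => by
    rw [sum_tsub_distrib _ fun x _ => hU₁ x y, hc, hc₁]; omega
  obtain ⟨V₂, hU₂, hr₂, hc₂⟩ := exists_regular_le (fun x y => U x y - V₁ x y) a a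
    (fun x => by rw [hr']; ring) fun y => by rw [hc']; ring
  refine ⟨![V₁, V₂, fun x y => U x y - V₁ x y - V₂ x y], fun x y => ?_, fun μ x => ?_,
    fun μ y => ?_⟩
  · have h1 := hU₁ x y
    have h2 := hU₂ x y
    simp [Fin.sum_univ_three]
    omega
  · fin_cases μ
    · exact hr₁ x
    · exact hr₂ x
    · change ∑ y, (U x y - V₁ x y - V₂ x y) = a
      rw [sum_tsub_distrib _ fun y _ => hU₂ x y, hr', hr₂]; omega
  · fin_cases μ
    · exact hc₁ y
    · exact hc₂ y
    · change ∑ x, (U x y - V₁ x y - V₂ x y) = a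
      rw [sum_tsub_distrib _ fun x _ => hU₂ x y, hc', hc₂]; omega

/-- `UnusedPair γ Ω s t x y`: the points `x`, `y` lie in different groups, and no item of `Ω`
covers the pair `(x, y)`. -/
def UnusedPair {X ι Ω₀ : Type*} (γ : X → ι) (Ω : Finset Ω₀) (s t : Ω₀ → X) (x y : X) : Prop :=
  γ x ≠ γ y ∧ ∀ ω ∈ Ω, ¬(s ω = x ∧ t ω = y)

open scoped Classical in
lemma exists_group_split {X ι Ω₀ : Type*} [Fintype X] [Fintype ι]
    (γ : X → ι) (Ω : Finset Ω₀) (s t : Ω₀ → X) (a : ℕ)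
    (hinj : ∀ ω ∈ Ω, ∀ ω' ∈ Ω, s ω = s ω' → t ω = t ω' → ω = ω')
    (hr : ∀ x, #{y | UnusedPair γ Ω s t x y} = 3 * a)
    (hc : ∀ y, #{x | UnusedPair γ Ω s t x y} = 3 * a) :
    ∃ V : Fin 3 → ι → ι → ℕ, (∀ μ i, V μ i i = 0) ∧
      (∀ i j, i ≠ j → #{ω ∈ Ω | γ (s ω) = i ∧ γ (t ω) = j} + ∑ μ, V μ i j
        = #{x | γ x = i} * #{x | γ x = j}) ∧
      (∀ μ i, ∑ j, V μ i j = a * #{x | γ x = i}) ∧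
      ∀ μ j, ∑ i, V μ i j = a * #{x | γ x = j} := by
  obtain ⟨V, hV, hVr, hVc⟩ := exists_split_three
    (fun x y => if UnusedPair γ Ω s t x y then 1 else 0) a (by simpa using hr) (by simpa using hc)
  refine ⟨fun μ i j => ∑ x with γ x = i, ∑ y with γ y = j, V μ x y, fun μ i => ?_,
    fun i j hij => ?_, fun μ i => ?_, fun μ j => ?_⟩
  · refine sum_eq_zero fun x hx => sum_eq_zero fun y hy => ?_
    have h0 := hV x y
    rw [if_neg (by simp only [mem_filter, mem_univ, true_and] at hx hy
                   exact fun h => h.1 (hx.trans hy.symm))] at h0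
    exact sum_eq_zero_iff.1 h0 μ (mem_univ _)
  · have h1 : ∑ μ, ∑ x with γ x = i, ∑ y with γ y = j, V μ x y
        = #{p ∈ ({x | γ x = i} : Finset X) ×ˢ ({y | γ y = j} : Finset X) |
            UnusedPair γ Ω s t p.1 p.2} := by
      rw [sum_comm, card_filter, sum_product]
      refine sum_congr rfl fun x _ => ?_
      rw [sum_comm]
      exact sum_congr rfl fun y _ => hV x y
    have h2 : #{ω ∈ Ω | γ (s ω) = i ∧ γ (t ω) = j}
        = #{p ∈ ({x | γ x = i} : Finset X) ×ˢ ({y | γ y = j} : Finset X) |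
            ¬ UnusedPair γ Ω s t p.1 p.2} := by
      refine card_bij (fun ω _ => (s ω, t ω)) ?_ ?_ ?_
      · intro ω hω
        simp only [mem_filter, mem_product, mem_univ, true_and] at hω ⊢
        exact ⟨hω.2, fun h => h.2 ω hω.1 ⟨rfl, rfl⟩⟩
      · intro ω hω ω' hω' h
        simp only [mem_filter] at hω hω'
        exact hinj ω hω.1 ω' hω'.1 (congrArg Prod.fst h) (congrArg Prod.snd h)
      · rintro ⟨x, y⟩ hp
        simp only [mem_filter, mem_product, mem_univ, true_and, UnusedPair, not_and, not_forall,
          not_not] at hp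
        obtain ⟨⟨hx, hy⟩, hp⟩ := hp
        obtain ⟨ω, hω, h1, h2⟩ := hp (by rw [hx, hy]; exact hij)
        exact ⟨ω, by simp [hω, h1, h2, hx, hy], by simp [h1, h2]⟩
    rw [h1, h2, add_comm, card_filter_add_card_filter_not, card_product]
  · rw [sum_comm]
    have : ∀ x, ∑ j, ∑ y with γ y = j, V μ x y = a := fun x => by
      exact (sum_fiberwise univ γ _).trans (hVr μ x)
    simp [this, mul_comm]
  · have h1 : ∑ i, ∑ x with γ x = i, ∑ y with γ y = j, V μ x y
        = ∑ x, ∑ y with γ y = j, V μ x y := sum_fiberwise _ _ _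
    rw [h1, sum_comm]
    simp [hVc, mul_comm]

lemma unusedPair_swap {X ι Ω₀ : Type*} (γ : X → ι) (Ω : Finset Ω₀) (s t : Ω₀ → X) (x y : X) :
    UnusedPair γ Ω s t x y ↔ UnusedPair γ Ω t s y x := by
  simp only [UnusedPair, ne_comm, and_comm]

open scoped Classical in
lemma card_unusedPair {X ι Ω₀ : Type*} [Fintype X] (γ : X → ι) (Ω : Finset Ω₀) (s t : Ω₀ → X)
    (hinj : ∀ ω ∈ Ω, ∀ ω' ∈ Ω, s ω = s ω' → t ω = t ω' → ω = ω')
    (hne : ∀ ω ∈ Ω, γ (s ω) ≠ γ (t ω)) (x : X) :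
    #{y | UnusedPair γ Ω s t x y} + (#{y | γ x = γ y} + #{ω ∈ Ω | s ω = x}) = Fintype.card X := by
  have h1 : #{ω ∈ Ω | s ω = x} = #(({ω ∈ Ω | s ω = x} : Finset Ω₀).image t) := by
    refine (card_image_of_injOn fun ω hω ω' hω' h => ?_).symm
    simp only [coe_filter, Set.mem_ofPred_eq] at hω hω'
    exact hinj ω hω.1 ω' hω'.1 (hω.2.trans hω'.2.symm) h
  have h2 : Disjoint ({y | γ x = γ y} : Finset X) (({ω ∈ Ω | s ω = x} : Finset Ω₀).image t) := by
    rw [disjoint_left]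
    intro y hy hy'
    simp only [mem_filter, mem_univ, true_and, mem_image] at hy hy'
    obtain ⟨ω, ⟨hω, rfl⟩, rfl⟩ := hy'
    exact hne ω hω hy
  have h3 : ({y | UnusedPair γ Ω s t x y} : Finset X)
      = (({y | γ x = γ y} : Finset X) ∪ ({ω ∈ Ω | s ω = x} : Finset Ω₀).image t)ᶜ := by
    ext y
    simp only [mem_filter, mem_univ, true_and, UnusedPair, mem_compl, mem_union, mem_image, not_or,
      not_exists, ne_eq, not_and]
    exact and_congr_right fun _ => ⟨fun h ω hω => h ω hω.1 hω.2, fun h ω hω hs => h ω ⟨hω, hs⟩⟩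
  rw [h1, ← card_union_of_disjoint h2, h3, add_comm, card_add_card_compl]

/-- A three-dimensional array of multiplicities whose line sums are products of part sizes:
`c i j l` is the number of copies of `l` in the cell `(i, j)` of an outline square. -/
def IsOutlineCube {α : Type*} [Fintype α] (p : α → ℕ) (c : α → α → α → ℕ) : Prop :=
  (∀ i j, ∑ l, c i j l = p i * p j) ∧ (∀ i l, ∑ j, c i j l = p i * p l) ∧
    ∀ j l, ∑ i, c i j l = p j * p l

open scoped Classical in
lemma exists_isOutlineCube_of_items {X ι Ω₀ : Type*} [Fintype X] [Fintype ι]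
    (γ : X → ι) (Ω : Finset Ω₀) (x y z w : Ω₀ → X) (a : ℕ)
    (hzw : ∀ ω ∈ Ω, γ (z ω) = γ (w ω))
    (hxy : ∀ ω ∈ Ω, ∀ ω' ∈ Ω, x ω = x ω' → y ω = y ω' → ω = ω')
    (hxz : ∀ ω ∈ Ω, ∀ ω' ∈ Ω, x ω = x ω' → z ω = z ω' → ω = ω')
    (hyw : ∀ ω ∈ Ω, ∀ ω' ∈ Ω, y ω = y ω' → w ω = w ω' → ω = ω')
    (nxy : ∀ ω ∈ Ω, γ (x ω) ≠ γ (y ω))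
    (nxz : ∀ ω ∈ Ω, γ (x ω) ≠ γ (z ω))
    (nyw : ∀ ω ∈ Ω, γ (y ω) ≠ γ (w ω))
    (rxz : ∀ i, #{j | UnusedPair γ Ω x z i j} = 3 * a)
    (cxz : ∀ j, #{i | UnusedPair γ Ω x z i j} = 3 * a)
    (ryw : ∀ i, #{j | UnusedPair γ Ω y w i j} = 3 * a)
    (cyw : ∀ j, #{i | UnusedPair γ Ω y w i j} = 3 * a) :
    ∃ c : Fin 3 ⊕ ι → Fin 3 ⊕ ι → Fin 3 ⊕ ι → ℕ,
      IsOutlineCube (Sum.elim (fun _ => a) fun i => #{x | γ x = i}) c ∧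
      (∀ i l, c (.inr i) (.inr i) l = if l = .inr i then #{x | γ x = i} ^ 2 else 0) ∧
      ∀ μ ν l, c (.inl μ) (.inl ν) l = if l = .inl (-(μ + ν)) then a ^ 2 else 0 := by
  have rxy : ∀ i, #{j | UnusedPair γ Ω x y i j} = 3 * a := fun i => by
    have h1 := card_unusedPair γ Ω x y hxy nxy i
    have h2 := card_unusedPair γ Ω x z hxz nxz i
    have h3 := rxz i
    omega
  have cxy : ∀ j, #{i | UnusedPair γ Ω x y i j} = 3 * a := fun j => by
    have h1 := card_unusedPair γ Ω y x (fun ω hω ω' hω' h h' => hxy ω hω ω' hω' h' h)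
      (fun ω hω => (nxy ω hω).symm) j
    have h2 := card_unusedPair γ Ω y w hyw nyw j
    have h3 := ryw j
    simp only [unusedPair_swap γ Ω x y]
    omega
  obtain ⟨A, hA0, hA, hAr, hAc⟩ := exists_group_split γ Ω x y a hxy rxy cxy
  obtain ⟨B, hB0, hB, hBr, hBc⟩ := exists_group_split γ Ω x z a hxz rxz cxz
  obtain ⟨C, hC0, hC, hCr, hCc⟩ := exists_group_split γ Ω y w a hyw ryw cyw
  let T : ι → ι → ι → ℕ := fun i j l => #{ω ∈ Ω | γ (x ω) = i ∧ γ (y ω) = j ∧ γ (z ω) = l}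
  have hTxy : ∀ i j, ∑ l, T i j l = #{ω ∈ Ω | γ (x ω) = i ∧ γ (y ω) = j} := fun i j => by
    rw [card_eq_sum_card_fiberwise (f := fun ω => γ (z ω)) (t := univ) (by simp)]
    simp only [T, filter_filter, and_assoc]
  have hTxz : ∀ i l, ∑ j, T i j l = #{ω ∈ Ω | γ (x ω) = i ∧ γ (z ω) = l} := fun i l => by
    rw [card_eq_sum_card_fiberwise (f := fun ω => γ (y ω)) (t := univ) (by simp)]
    simp only [T, filter_filter, and_assoc, and_comm (a := γ (z _) = l)]
  have hTyw : ∀ j l, ∑ i, T i j l = #{ω ∈ Ω | γ (y ω) = j ∧ γ (w ω) = l} := fun j l => by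
    have h1 : #{ω ∈ Ω | γ (y ω) = j ∧ γ (w ω) = l} = #{ω ∈ Ω | γ (y ω) = j ∧ γ (z ω) = l} := by
      congr 1
      exact filter_congr fun ω hω => by rw [hzw ω hω]
    rw [h1, card_eq_sum_card_fiberwise (f := fun ω => γ (x ω)) (t := univ) (by simp)]
    simp only [T, filter_filter]
    refine sum_congr rfl fun i _ => ?_
    congr 1
    exact filter_congr fun ω _ => by tauto
  have hexy : ∀ i, #{ω ∈ Ω | γ (x ω) = i ∧ γ (y ω) = i} = 0 := fun i => by
    rw [card_eq_zero, filter_eq_empty_iff]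
    exact fun ω hω h => nxy ω hω (h.1.trans h.2.symm)
  have hexz : ∀ i, #{ω ∈ Ω | γ (x ω) = i ∧ γ (z ω) = i} = 0 := fun i => by
    rw [card_eq_zero, filter_eq_empty_iff]
    exact fun ω hω h => nxz ω hω (h.1.trans h.2.symm)
  have heyw : ∀ i, #{ω ∈ Ω | γ (y ω) = i ∧ γ (w ω) = i} = 0 := fun i => by
    rw [card_eq_zero, filter_eq_empty_iff]
    exact fun ω hω h => nyw ω hω (h.1.trans h.2.symm)
  have hT0 : ∀ i l, T i i l = 0 := fun i l => by
    have := hTxy i i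
    rw [hexy] at this
    exact sum_eq_zero_iff.1 this l (mem_univ _)
  let c : Fin 3 ⊕ ι → Fin 3 ⊕ ι → Fin 3 ⊕ ι → ℕ := fun
    | .inl μ, .inl ν, .inl κ => if κ = -(μ + ν) then a ^ 2 else 0
    | .inl _, .inl _, .inr _ => 0
    | .inl _, .inr _, .inl _ => 0
    | .inr _, .inl _, .inl _ => 0
    | .inl μ, .inr j, .inr l => C μ j l
    | .inr i, .inl μ, .inr l => B μ i l
    | .inr i, .inr j, .inl μ => A μ i j
    | .inr i, .inr j, .inr l => T i j l + if i = j ∧ j = l then #{x | γ x = i} ^ 2 else 0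
  refine ⟨c, ⟨?_, ?_, ?_⟩, ?_, ?_⟩
  · rintro (μ | i) (ν | j) <;> simp only [Fintype.sum_sum_type, c, Sum.elim_inl, Sum.elim_inr]
    · simp [pow_two]
    · simp [hCr]
    · simp [hBr, mul_comm]
    · rw [sum_add_distrib, hTxy]
      by_cases hij : i = j
      · subst hij
        simp [hA0, hexy, pow_two]
      · simp [hij, ← hA i j hij, add_comm]
  · rintro (μ | i) (κ | l) <;> simp only [Fintype.sum_sum_type, c, Sum.elim_inl, Sum.elim_inr]
    · have : ∀ ν : Fin 3, (κ = -(μ + ν)) = (ν = -(μ + κ)) := by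
        intro ν; ext; constructor <;> rintro rfl <;> abel
      simp only [this]
      simp [pow_two]
    · simp [hCc]
    · simp [hAr, mul_comm]
    · rw [sum_add_distrib, hTxz]
      by_cases hij : i = l
      · subst hij
        have : ∀ j, (i = j ∧ j = i) = (j = i) := by intro j; ext; constructor <;> grind
        simp [hB0, hexz, this, pow_two]
      · have : ∀ j, ¬(i = j ∧ j = l) := by grind
        simp [this, ← hB i l hij, add_comm]
  · rintro (ν | j) (κ | l) <;> simp only [Fintype.sum_sum_type, c, Sum.elim_inl, Sum.elim_inr]
    · have : ∀ μ : Fin 3, (κ = -(μ + ν)) = (μ = -(ν + κ)) := by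
        intro ν; ext; constructor <;> rintro rfl <;> abel
      simp only [this]
      simp [pow_two]
    · simp [hBc]
    · simp [hAc, mul_comm]
    · rw [sum_add_distrib, hTyw]
      by_cases hij : j = l
      · subst hij
        simp [hC0, heyw, pow_two]
      · simp [hij, ← hC j l hij, add_comm]
  · rintro i (κ | l)
    · simp [c, hA0]
    · simp [c, hT0, eq_comm]
  · rintro μ ν (κ | l)
    · simp [c]
    · simp [c]

/-- `γ` splits `ZMod r` into intervals of at most `g` consecutive points; `u z` and `v z` are the
numbers of points of the interval of `z` that precede and follow `z`. -/
structure IsIntervalPartition {ι : Type*} {r : ℕ} (g : ℤ) (γ : ZMod r → ι) (u v : ZMod r → ℤ) :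
    Prop where
  u_nonneg : ∀ z, 0 ≤ u z
  v_nonneg : ∀ z, 0 ≤ v z
  lt : ∀ z, u z + v z < g
  shift : ∀ (z : ZMod r) (t : ℤ), -u z ≤ t → t ≤ v z →
    γ (z + t) = γ z ∧ u (z + t) = u z + t ∧ v (z + t) = v z - t
  conv : ∀ x y, γ x = γ y → ∃ t : ℤ, -u x ≤ t ∧ t ≤ v x ∧ y = x + t

lemma zmod_intCast_inj {r : ℕ} {a b : ℤ} (h : (a : ZMod r) = b) (h1 : a - b < r)
    (h2 : b - a < r) : a = b := by
  rw [ZMod.intCast_eq_intCast_iff_dvd_sub] at h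
  obtain ⟨q, hq⟩ := h
  have : q = 0 := by
    by_contra hq0
    rcases lt_or_gt_of_ne hq0 with h | h <;> nlinarith
  subst this
  linarith

lemma IsIntervalPartition.same_iff {ι : Type*} {r : ℕ} {g : ℤ} {γ : ZMod r → ι}
    {u v : ZMod r → ℤ} (H : IsIntervalPartition g γ u v) (z : ZMod r) {t : ℤ}
    (h1 : -(r - g) ≤ t) (h2 : t ≤ r - g) : γ (z + t) = γ z ↔ -u z ≤ t ∧ t ≤ v z := by
  refine ⟨fun h => ?_, fun h => (H.shift z t h.1 h.2).1⟩
  obtain ⟨t', ht1, ht2, ht⟩ := H.conv _ _ h.symm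
  have := H.lt z
  have := H.u_nonneg z
  have := H.v_nonneg z
  have := zmod_intCast_inj (add_left_cancel ht) (by omega) (by omega)
  omega

open scoped Classical in
lemma card_unusedPair_of_steps {ι Ω₀ : Type*} {r : ℕ} [NeZero r] (γ : ZMod r → ι) (Ω : Finset Ω₀)
    (s t : Ω₀ → ZMod r) (S : Finset ℤ)
    (hinj : ∀ e ∈ S, ∀ e' ∈ S, (e : ZMod r) = e' → e = e')
    (h : ∀ x z, (γ x = γ z ∨ ∃ ω ∈ Ω, s ω = x ∧ t ω = z) ↔ ∃ e ∈ S, z = x + (e : ℤ)) :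
    (∀ x, #{z | UnusedPair γ Ω s t x z} + #S = r) ∧
      ∀ z, #{x | UnusedPair γ Ω s t x z} + #S = r := by
  have hU : ∀ x z, UnusedPair γ Ω s t x z ↔ ¬ ∃ e ∈ S, z = x + (e : ℤ) := fun x z => by
    rw [← h, UnusedPair]
    push Not
    rfl
  constructor
  · intro x
    have h1 : #S = #(S.image fun e : ℤ => x + (e : ZMod r)) :=
      (card_image_of_injOn fun e he e' he' hee => hinj e he e' he' (add_left_cancel hee)).symm
    have h2 : ({z | UnusedPair γ Ω s t x z} : Finset (ZMod r))
        = (S.image fun e : ℤ => x + (e : ZMod r))ᶜ := by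
      ext z
      simp [hU, eq_comm]
    rw [h1, h2, card_compl_add_card, ZMod.card]
  · intro z
    have h1 : #S = #(S.image fun e : ℤ => z - (e : ZMod r)) :=
      (card_image_of_injOn fun e he e' he' hee => hinj e he e' he' (sub_right_injective hee)).symm
    have h2 : ({x | UnusedPair γ Ω s t x z} : Finset (ZMod r))
        = (S.image fun e : ℤ => z - (e : ZMod r))ᶜ := by
      ext x
      simp [hU, sub_eq_iff_eq_add]
    rw [h1, h2, card_compl_add_card, ZMod.card]

/-- The displacement from `z` to `w` in the item with step `e` at a point `z` that has `u`
predecessors and `v` successors in its interval. -/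
def wShift (u v e : ℤ) : ℤ := if (u < e ∧ e ≤ v) ∨ (v < -e ∧ -e ≤ u) then v - u else 0

/-- The step `e`, reduced by one in the second half of the cycle of length `2 * s`. -/
def halfStep (s e : ℤ) : ℤ := if e ≤ s then e else e - 1

/-- The displacement from `z` to `y` in the item with step `e` at a point `z` that has `u`
predecessors and `v` successors in its interval. -/
def yShift (s u v e : ℤ) : ℤ :=
  if u < e ∧ e ≤ v then 2 * v + 1 - e
  else if v < -e ∧ -e ≤ u then -(2 * u + 1 + e) else halfStep s e

/-- The steps `e` admitted in the cyclic construction on `2 * s` points: short ones, and long ones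
in either half of the cycle. -/
def IsStep (g s e : ℤ) : Prop :=
  (-g < e ∧ e < g) ∨ (g ≤ e ∧ e ≤ s - g) ∨ (s + g + 1 ≤ e ∧ e ≤ 2 * s - g)

section Items

variable {ι : Type*} {r : ℕ} {g s : ℤ} {γ : ZMod r → ι} {u v : ZMod r → ℤ}

lemma IsIntervalPartition.item_iff (H : IsIntervalPartition g γ u v) (hr : (r : ℤ) = 2 * s)
    (hg : 2 * g + 1 ≤ s) {e : ℤ} (he : IsStep g s e) (z : ZMod r) :
    γ (z - e) ≠ γ z ↔ u z < e ∨ v z < -e := by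
  have h := H.same_iff z (t := -e) (by unfold IsStep at he; omega) (by unfold IsStep at he; omega)
  rw [Int.cast_neg, ← sub_eq_add_neg] at h
  rw [Ne, h]
  omega

lemma IsIntervalPartition.w_spec (H : IsIntervalPartition g γ u v) (z : ZMod r) (e : ℤ) :
    γ (z + wShift (u z) (v z) e) = γ z ∧
      u (z + wShift (u z) (v z) e) = u z + wShift (u z) (v z) e ∧
      v (z + wShift (u z) (v z) e) = v z - wShift (u z) (v z) e := by
  have := H.u_nonneg z
  have := H.v_nonneg z
  apply H.shift <;> unfold wShift <;> split_ifs <;> omega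

lemma IsIntervalPartition.xy_ne (H : IsIntervalPartition g γ u v) (hr : (r : ℤ) = 2 * s)
    (hg : 2 * g + 1 ≤ s) {e : ℤ} (he : IsStep g s e) (z : ZMod r) (hz : γ (z - e) ≠ γ z) :
    γ (z - e) ≠ γ (z + yShift s (u z) (v z) e) := by
  have hz' := (H.item_iff hr hg he z).1 hz
  have hu := H.u_nonneg z
  have hv := H.v_nonneg z
  have hl := H.lt z
  intro h
  obtain ⟨t, ht1, ht2, ht⟩ := H.conv _ _ h
  have hs := (H.shift (z - e) e)
  rw [sub_add_cancel] at hs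
  have hu' := H.u_nonneg (z - e)
  have hv' := H.v_nonneg (z - e)
  have hl' := H.lt (z - e)
  have hs' : ¬ (-u (z - e) ≤ e ∧ e ≤ v (z - e)) := fun h => hz (hs h.1 h.2).1.symm
  have key : ((yShift s (u z) (v z) e + e : ℤ) : ZMod r) = t := by
    push_cast
    linear_combination ht
  have key' : ((yShift s (u z) (v z) e + e - r : ℤ) : ZMod r) = t := by
    rw [← key]
    simp
  unfold IsStep at he
  by_cases hes : e ≤ s
  · have := zmod_intCast_inj key (by grind [yShift, halfStep]) (by grind [yShift, halfStep])
    grind [yShift, halfStep]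
  · have := zmod_intCast_inj key' (by grind [yShift, halfStep]) (by grind [yShift, halfStep])
    grind [yShift, halfStep]

lemma IsIntervalPartition.xy_inj (H : IsIntervalPartition g γ u v) (hr : (r : ℤ) = 2 * s)
    (hg : 2 * g + 1 ≤ s) {e e' : ℤ} (he : IsStep g s e) (he' : IsStep g s e') (z z' : ZMod r)
    (hz : γ (z - e) ≠ γ z) (hz' : γ (z' - e') ≠ γ z') (hx : z - e = z' - e')
    (hy : z + yShift s (u z) (v z) e = z' + yShift s (u z') (v z') e') : z = z' ∧ e = e' := by
  suffices e = e' by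
    subst this
    exact ⟨by linear_combination hx, rfl⟩
  rw [H.item_iff hr hg he] at hz
  rw [H.item_iff hr hg he'] at hz'
  have hu := H.u_nonneg z
  have hv := H.v_nonneg z
  have hl := H.lt z
  have hu' := H.u_nonneg z'
  have hv' := H.v_nonneg z'
  have hl' := H.lt z'
  have h1 := H.shift z (e' - e)
  have h2 := H.shift z' (e - e')
  have e1 : z + ((e' - e : ℤ) : ZMod r) = z' := by push_cast; linear_combination hx
  have e2 : z' + ((e - e' : ℤ) : ZMod r) = z := by push_cast; linear_combination -hx
  rw [e1] at h1
  rw [e2] at h2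
  obtain ⟨D, hD⟩ : ∃ D, D = if e ≤ s then yShift s (u z) (v z) e + e
    else yShift s (u z) (v z) e + e - r := ⟨_, rfl⟩
  obtain ⟨D', hD'⟩ : ∃ D, D = if e' ≤ s then yShift s (u z') (v z') e' + e'
    else yShift s (u z') (v z') e' + e' - r := ⟨_, rfl⟩
  have key : (D : ZMod r) = D' := by
    have hD1 : (D : ZMod r) = yShift s (u z) (v z) e + e := by
      rw [hD]; split_ifs <;> simp
    have hD2 : (D' : ZMod r) = yShift s (u z') (v z') e' + e' := by
      rw [hD']; split_ifs <;> simp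
    rw [hD1, hD2]
    linear_combination hy - hx
  unfold IsStep at he he'
  unfold yShift halfStep at hD hD'
  have b1 : -(2 * g - 1) ≤ D ∧ D ≤ r - 2 * g := by
    clear h1 h2 hD'
    split_ifs at hD <;> omega
  have b2 : -(2 * g - 1) ≤ D' ∧ D' ≤ r - 2 * g := by
    clear h1 h2 hD
    split_ifs at hD' <;> omega
  have := zmod_intCast_inj key (by omega) (by omega)
  split_ifs at hD hD' <;> grind

lemma IsIntervalPartition.step_isHalfStep (H : IsIntervalPartition g γ u v) (s e : ℤ)
    (z : ZMod r) :
    (-g < yShift s (u z) (v z) e - wShift (u z) (v z) e ∧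
      yShift s (u z) (v z) e - wShift (u z) (v z) e < g) ∨
    yShift s (u z) (v z) e - wShift (u z) (v z) e = halfStep s e := by
  have hu := H.u_nonneg z
  have hv := H.v_nonneg z
  have hl := H.lt z
  unfold yShift wShift
  split_ifs <;> grind

lemma IsIntervalPartition.yw_inj (H : IsIntervalPartition g γ u v) (hr : (r : ℤ) = 2 * s)
    (hg : 2 * g + 1 ≤ s) {e e' : ℤ} (he : IsStep g s e) (he' : IsStep g s e') (z z' : ZMod r)
    (hz : γ (z - e) ≠ γ z) (hz' : γ (z' - e') ≠ γ z')
    (hy : z + yShift s (u z) (v z) e = z' + yShift s (u z') (v z') e')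
    (hw : z + wShift (u z) (v z) e = z' + wShift (u z') (v z') e') : z = z' ∧ e = e' := by
  rw [H.item_iff hr hg he] at hz
  rw [H.item_iff hr hg he'] at hz'
  have hu := H.u_nonneg z
  have hv := H.v_nonneg z
  have hl := H.lt z
  have hu' := H.u_nonneg z'
  have hv' := H.v_nonneg z'
  have hl' := H.lt z'
  have h1 := H.w_spec z e
  have h2 := H.w_spec z' e'
  rw [hw] at h1
  obtain ⟨-, h1u, h1v⟩ := h1
  obtain ⟨-, h2u, h2v⟩ := h2
  have f1 := H.step_isHalfStep s e z
  have f2 := H.step_isHalfStep s e' z'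
  have key : ((yShift s (u z) (v z) e - wShift (u z) (v z) e : ℤ) : ZMod r)
      = ((yShift s (u z') (v z') e' - wShift (u z') (v z') e' : ℤ) : ZMod r) := by
    push_cast
    linear_combination hy - hw
  unfold IsStep at he he'
  have := zmod_intCast_inj key (by grind [halfStep]) (by grind [halfStep])
  have hww : wShift (u z) (v z) e = wShift (u z') (v z') e' ∧ e = e' := by
    clear f1 f2 key hw hy
    rw [h1u] at h2u
    rw [h1v] at h2v
    unfold yShift wShift halfStep at *
    split_ifs at * <;> omega
  refine ⟨?_, hww.2⟩
  rw [hww.1] at hw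
  exact add_right_cancel hw

lemma IsStep.eq_of_cast_eq {r : ℕ} {g s e e' : ℤ} (hr : (r : ℤ) = 2 * s) (hg0 : 0 < g)
    (hg : 2 * g + 1 ≤ s) (he : IsStep g s e) (he' : IsStep g s e')
    (h : (e : ZMod r) = e') : e = e' := by
  unfold IsStep at he he'
  exact zmod_intCast_inj h (by omega) (by omega)

lemma IsStep.eq_of_halfStep_eq {g s e e' : ℤ} (hg0 : 0 < g) (hg : 2 * g + 1 ≤ s)
    (he' : IsStep g s e') (h : halfStep s e = halfStep s e') : e = e' := by
  unfold IsStep at he'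
  unfold halfStep at h
  split_ifs at h <;> omega

lemma IsStep.halfStep_eq_of_cast_eq {r : ℕ} {g s e e' : ℤ} (hr : (r : ℤ) = 2 * s) (hg0 : 0 < g)
    (hg : 2 * g + 1 ≤ s) (he : IsStep g s e) (he' : IsStep g s e')
    (h : (halfStep s e : ZMod r) = halfStep s e') : halfStep s e = halfStep s e' := by
  have b : ∀ e, IsStep g s e → -g < halfStep s e ∧ halfStep s e ≤ r - g := fun e he => by
    unfold IsStep at he
    unfold halfStep
    split_ifs <;> omega
  have := b e he
  have := b e' he'
  exact zmod_intCast_inj h (by omega) (by omega)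

lemma IsIntervalPartition.exists_item_of_halfStep (H : IsIntervalPartition g γ u v)
    (hr : (r : ℤ) = 2 * s) (hg : 2 * g + 1 ≤ s) (w : ZMod r) {e : ℤ} (he : IsStep g s e)
    (hne : γ w ≠ γ (w + halfStep s e)) :
    ∃ (z : ZMod r) (e' : ℤ), (e' = e ∨ -g < e' ∧ e' < g) ∧ γ (z - e') ≠ γ z ∧
      z + wShift (u z) (v z) e' = w ∧ z + yShift s (u z) (v z) e' = w + halfStep s e := by
  have hu := H.u_nonneg w
  have hv := H.v_nonneg w
  have hl := H.lt w
  have hout : ¬ (-u w ≤ halfStep s e ∧ halfStep s e ≤ v w) := fun h =>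
    hne (H.shift w _ h.1 h.2).1.symm
  by_cases hnat : (u w < halfStep s e ∧ v w < halfStep s e) ∨
      (u w < -halfStep s e ∧ v w < -halfStep s e)
  · refine ⟨w, e, Or.inl rfl, ?_, ?_, ?_⟩
    · rw [H.item_iff hr hg he]
      grind [halfStep]
    · have : wShift (u w) (v w) e = 0 := by grind [wShift, halfStep, IsStep]
      simp [this]
    · have : yShift s (u w) (v w) e = halfStep s e := by grind [yShift, halfStep, IsStep]
      rw [this]
  · have hhe : halfStep s e = e := by grind [halfStep, IsStep]
    have heg : -g < e ∧ e < g := by grind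
    rw [hhe] at hout hnat ⊢
    obtain ⟨hγ, hzu, hzv⟩ := H.shift w (v w - u w) (by omega) (by omega)
    rcases lt_or_ge 0 e with hpos | hneg
    · have hst : IsStep g s (u w + v w + 1 - e) := Or.inl (by omega)
      refine ⟨w + (v w - u w : ℤ), u w + v w + 1 - e, Or.inr (by omega), ?_, ?_, ?_⟩
      · rw [H.item_iff hr hg hst, hzu, hzv]
        omega
      · have : wShift (u w + (v w - u w)) (v w - (v w - u w)) (u w + v w + 1 - e) = u w - v w := by
          unfold wShift
          split_ifs <;> omega
        rw [hzu, hzv, this]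
        push_cast
        ring
      · have : yShift s (u w + (v w - u w)) (v w - (v w - u w)) (u w + v w + 1 - e)
            = u w - v w + e := by
          unfold yShift
          split_ifs <;> omega
        rw [hzu, hzv, this]
        push_cast
        ring
    · have hst : IsStep g s (-(u w + v w + 1) - e) := Or.inl (by omega)
      refine ⟨w + (v w - u w : ℤ), -(u w + v w + 1) - e, Or.inr (by omega), ?_, ?_, ?_⟩
      · rw [H.item_iff hr hg hst, hzu, hzv]
        omega
      · have : wShift (u w + (v w - u w)) (v w - (v w - u w)) (-(u w + v w + 1) - e)
            = u w - v w := by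
          unfold wShift
          split_ifs <;> omega
        rw [hzu, hzv, this]
        push_cast
        ring
      · have : yShift s (u w + (v w - u w)) (v w - (v w - u w)) (-(u w + v w + 1) - e)
            = u w - v w + e := by
          unfold yShift
          split_ifs <;> omega
        rw [hzu, hzv, this]
        push_cast
        ring

lemma IsIntervalPartition.yw_ne (H : IsIntervalPartition g γ u v) (hr : (r : ℤ) = 2 * s)
    (hg : 2 * g + 1 ≤ s) {e : ℤ} (he : IsStep g s e) (z : ZMod r) (hz : γ (z - e) ≠ γ z) :
    γ (z + yShift s (u z) (v z) e) ≠ γ (z + wShift (u z) (v z) e) := by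
  rw [H.item_iff hr hg he] at hz
  have hu := H.u_nonneg z
  have hv := H.v_nonneg z
  have hl := H.lt z
  obtain ⟨hγ, -, -⟩ := H.w_spec z e
  unfold IsStep at he
  rw [hγ, Ne, H.same_iff z] <;> unfold yShift halfStep <;> split_ifs <;> omega

lemma exists_isStep_finset {g s m : ℕ} (hg0 : 0 < g) (hm1 : 2 * g + 1 ≤ m)
    (hm2 : m + 2 * g ≤ 2 * s) :
    ∃ S : Finset ℤ, #S + m = 2 * s ∧ (∀ e ∈ S, IsStep g s e) ∧
      ∀ e : ℤ, -g < e → e < g → e ∈ S := by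
  obtain ⟨E, hE, hEc⟩ := exists_subset_card_eq (n := 2 * s + 1 - m - 2 * g)
    (s := Icc (g : ℤ) (s - g) ∪ Icc ((s : ℤ) + g + 1) (2 * s - g)) (by
      rw [card_union_of_disjoint (by
        rw [disjoint_left]; intro e; simp only [mem_Icc]; omega), Int.card_Icc, Int.card_Icc]
      omega)
  have hE' : ∀ e ∈ E, ((g : ℤ) ≤ e ∧ e ≤ s - g) ∨ ((s : ℤ) + g + 1 ≤ e ∧ e ≤ 2 * s - g) :=
    fun e he => by simpa only [mem_union, mem_Icc] using hE he
  refine ⟨Ioo (-g : ℤ) g ∪ E, ?_, fun e he => ?_, fun e h1 h2 => ?_⟩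
  · rw [card_union_of_disjoint, Int.card_Ioo, hEc]
    · omega
    · rw [disjoint_left]
      intro e he he'
      have := hE' e he'
      rw [mem_Ioo] at he
      omega
  · rw [mem_union, mem_Ioo] at he
    exact he.imp_right (hE' e)
  · exact mem_union_left _ (mem_Ioo.2 ⟨h1, h2⟩)

open scoped Classical in
lemma IsIntervalPartition.exists_isOutlineCube [Fintype ι] [NeZero r] {g s a : ℕ}
    (H : IsIntervalPartition (g : ℤ) γ u v) (hr : r = 2 * s) (hg0 : 0 < g) (hg : 2 * g + 1 ≤ s)
    (hm1 : 2 * g + 1 ≤ 3 * a) (hm2 : 3 * a + 2 * g ≤ r) :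
    ∃ c : Fin 3 ⊕ ι → Fin 3 ⊕ ι → Fin 3 ⊕ ι → ℕ,
      IsOutlineCube (Sum.elim (fun _ => a) fun i => #{x | γ x = i}) c ∧
      (∀ i l, c (.inr i) (.inr i) l = if l = .inr i then #{x | γ x = i} ^ 2 else 0) ∧
      ∀ μ ν l, c (.inl μ) (.inl ν) l = if l = .inl (-(μ + ν)) then a ^ 2 else 0 := by
  obtain ⟨S, hSc, hS, hcore⟩ := exists_isStep_finset hg0 hm1 (hr ▸ hm2)
  have hr' : (r : ℤ) = 2 * (s : ℤ) := by omega
  have hg0' : 0 < (g : ℤ) := by omega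
  have hg' : 2 * (g : ℤ) + 1 ≤ s := by omega
  let Ω : Finset (ZMod r × ℤ) := {ω ∈ univ ×ˢ S | γ (ω.1 - ω.2) ≠ γ ω.1}
  have hΩ : ∀ ω, ω ∈ Ω ↔ ω.2 ∈ S ∧ γ (ω.1 - ω.2) ≠ γ ω.1 := fun ω => by simp [Ω]
  let x : ZMod r × ℤ → ZMod r := fun ω => ω.1 - ω.2
  let y : ZMod r × ℤ → ZMod r := fun ω => ω.1 + yShift s (u ω.1) (v ω.1) ω.2
  let w : ZMod r × ℤ → ZMod r := fun ω => ω.1 + wShift (u ω.1) (v ω.1) ω.2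
  have hxz := card_unusedPair_of_steps γ Ω x Prod.fst S
    (fun e he e' he' => (hS e he).eq_of_cast_eq hr' hg0' hg' (hS e' he')) (fun p q => by
      constructor
      · rintro (h | ⟨ω, hω, rfl, rfl⟩)
        · obtain ⟨t, h1, h2, h3⟩ := H.conv _ _ h
          have := H.lt p
          have := H.u_nonneg p
          have := H.v_nonneg p
          exact ⟨t, hcore t (by omega) (by omega), h3⟩
        · exact ⟨ω.2, ((hΩ ω).1 hω).1, by simp [x]⟩
      · rintro ⟨e, he, rfl⟩
        by_cases h : γ p = γ (p + e)
        · exact Or.inl h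
        · exact Or.inr ⟨(p + e, e), (hΩ _).2 ⟨he, by simpa using h⟩, by simp [x], rfl⟩)
  have hS' : #(S.image (halfStep s)) = #S := card_image_of_injOn fun _ _ e' he' =>
    (hS e' he').eq_of_halfStep_eq hg0' hg'
  have hcore' : ∀ e : ℤ, -g < e → e < g → e ∈ S.image (halfStep s) := fun e h1 h2 =>
    mem_image.2 ⟨e, hcore e h1 h2, if_pos (by omega)⟩
  have hyw := card_unusedPair_of_steps γ Ω w y (S.image (halfStep s))
    (fun f hf f' hf' => by
      obtain ⟨e, he, rfl⟩ := mem_image.1 hf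
      obtain ⟨e', he', rfl⟩ := mem_image.1 hf'
      exact (hS e he).halfStep_eq_of_cast_eq hr' hg0' hg' (hS e' he')) (fun p q => by
      constructor
      · rintro (h | ⟨ω, hω, rfl, rfl⟩)
        · obtain ⟨t, h1, h2, h3⟩ := H.conv _ _ h
          have := H.lt p
          have := H.u_nonneg p
          have := H.v_nonneg p
          exact ⟨t, hcore' t (by omega) (by omega), h3⟩
        · refine ⟨yShift s (u ω.1) (v ω.1) ω.2 - wShift (u ω.1) (v ω.1) ω.2, ?_, by
            simp only [y, w]
            push_cast
            ring⟩
          rcases H.step_isHalfStep s ω.2 ω.1 with h | h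
          · exact hcore' _ h.1 h.2
          · rw [h]
            exact mem_image_of_mem _ ((hΩ ω).1 hω).1
      · rintro ⟨f, hf, rfl⟩
        obtain ⟨e, he, rfl⟩ := mem_image.1 hf
        by_cases h : γ p = γ (p + halfStep s e)
        · exact Or.inl h
        · obtain ⟨z, e', he', hz, hw, hy⟩ := H.exists_item_of_halfStep hr' hg' p (hS e he) h
          refine Or.inr ⟨(z, e'), (hΩ _).2 ⟨?_, hz⟩, hw, hy⟩
          rcases he' with rfl | he'
          · exact he
          · exact hcore _ he'.1 he'.2)
  refine exists_isOutlineCube_of_items γ Ω x y Prod.fst w a ?_ ?_ ?_ ?_ ?_ ?_ ?_ ?_ ?_ ?_ ?_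
  · exact fun ω _ => (H.w_spec ω.1 ω.2).1.symm
  · intro ω hω ω' hω' h1 h2
    rw [hΩ] at hω hω'
    exact Prod.ext_iff.2
      (H.xy_inj hr' hg' (hS _ hω.1) (hS _ hω'.1) ω.1 ω'.1 hω.2 hω'.2 h1 h2)
  · intro ω hω ω' hω' h1 h2
    rw [hΩ] at hω hω'
    simp only [x, h2, sub_right_inj] at h1
    exact Prod.ext h2 ((hS _ hω.1).eq_of_cast_eq hr' hg0' hg' (hS _ hω'.1) h1)
  · intro ω hω ω' hω' h1 h2
    rw [hΩ] at hω hω'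
    exact Prod.ext_iff.2
      (H.yw_inj hr' hg' (hS _ hω.1) (hS _ hω'.1) ω.1 ω'.1 hω.2 hω'.2 h1 h2)
  · exact fun ω hω => H.xy_ne hr' hg' (hS _ ((hΩ ω).1 hω).1) ω.1 ((hΩ ω).1 hω).2
  · exact fun ω hω => ((hΩ ω).1 hω).2
  · exact fun ω hω => H.yw_ne hr' hg' (hS _ ((hΩ ω).1 hω).1) ω.1 ((hΩ ω).1 hω).2
  · intro i
    have := hxz.1 i
    omega
  · intro i
    have := hxz.2 i
    omega
  · intro i
    have := hyw.2 i
    simp only [unusedPair_swap γ Ω y w]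
    omega
  · intro i
    have := hyw.1 i
    simp only [unusedPair_swap γ Ω y w]
    omega

end Items

lemma isIntervalPartition_finSigma {n : ℕ} (f : Fin n → ℕ) (g : ℕ) (hf : ∀ i, f i ≤ g)
    [NeZero (∑ i, f i)] :
    ∃ (γ : ZMod (∑ i, f i) → Fin n) (u v : ZMod (∑ i, f i) → ℤ),
      IsIntervalPartition (g : ℤ) γ u v ∧ ∀ i, #{x | γ x = i} = f i := by
  let r := ∑ i, f i
  let φ : ZMod r → (i : Fin n) × Fin (f i) := fun z => finSigmaFinEquiv.symm ⟨z.val, z.val_lt⟩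
  have hval : ∀ z, (finSigmaFinEquiv (φ z) : ℕ) = z.val := fun z => by simp [φ]
  have hφ : ∀ (p : (i : Fin n) × Fin (f i)) (z : ZMod r), z = (finSigmaFinEquiv p : ℕ) →
      φ z = p := by
    rintro p z rfl
    simp only [φ]
    rw [Equiv.symm_apply_eq]
    exact Fin.ext (ZMod.val_natCast_of_lt (finSigmaFinEquiv p).isLt)
  have hz : ∀ z, z = ((finSigmaFinEquiv (φ z) : ℕ) : ZMod r) := fun z => by
    rw [hval, ZMod.natCast_zmod_val]
  have hsig : ∀ (i : Fin n) (a b : Fin (f i)),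
      ((finSigmaFinEquiv ⟨i, a⟩ : ℕ) : ZMod r) = (finSigmaFinEquiv ⟨i, b⟩ : ℕ)
        + ((a - b : ℤ) : ZMod r) := fun i a b => by
    simp only [finSigmaFinEquiv_apply]
    push_cast
    ring
  refine ⟨fun z => (φ z).1, fun z => (φ z).2, fun z => f (φ z).1 - 1 - (φ z).2,
    ⟨fun z => by omega, fun z => by omega, fun z => ?_, fun z t h1 h2 => ?_, fun x y h => ?_⟩,
    fun i => ?_⟩
  · have := hf (φ z).1
    omega
  · have h3 : φ (z + t) = ⟨(φ z).1, ⟨((φ z).2 + t : ℤ).toNat, by omega⟩⟩ := by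
      apply hφ
      rw [hsig _ _ (φ z).2, ← hz z]
      congr 2
      simp only
      omega
    rw [h3]
    simp only [true_and]
    omega
  · obtain ⟨p, hp⟩ : ∃ p, p = φ x := ⟨_, rfl⟩
    obtain ⟨q, hq⟩ : ∃ q, q = φ y := ⟨_, rfl⟩
    have hx := hz x
    have hy := hz y
    beta_reduce at h ⊢
    rw [← hp] at h hx ⊢
    rw [← hq] at h hy
    obtain ⟨i, a⟩ := p
    obtain ⟨j, b⟩ := q
    obtain rfl : i = j := h
    refine ⟨b - a, by dsimp only; omega, by dsimp only; omega, ?_⟩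
    rw [hx, hy, hsig i b a]
  · rw [← Fintype.card_fin (f i), ← Finset.card_univ]
    symm
    refine card_bij
      (fun a _ => ((finSigmaFinEquiv (⟨i, a⟩ : (i : Fin n) × Fin (f i)) : ℕ) : ZMod r))
      (fun a _ => ?_) (fun a _ b _ hab => ?_) (fun z hzi => ?_)
    · rw [mem_filter]
      exact ⟨mem_univ _, congrArg Sigma.fst (hφ _ _ rfl)⟩
    · have := (hφ _ _ rfl).symm.trans (hφ _ _ hab)
      simpa using this
    · rw [mem_filter] at hzi
      obtain ⟨-, rfl⟩ := hzi
      exact ⟨(φ z).2, mem_univ _, (hz z).symm⟩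

/-- The array of multisets on `Fin k` with multiplicities `c`, transported along `e`. -/
def outlineOfCube {α : Type*} {k : ℕ} (e : α ≃ Fin k) (c : α → α → α → ℕ) (i j : Fin k) :
    Multiset (Fin k) :=
  ∑ l, Multiset.replicate (c (e.symm i) (e.symm j) (e.symm l)) l

lemma count_outlineOfCube {α : Type*} {k : ℕ} (e : α ≃ Fin k) (c : α → α → α → ℕ)
    (i j l : Fin k) :
    (outlineOfCube e c i j).count l = c (e.symm i) (e.symm j) (e.symm l) := by
  simp [outlineOfCube, Multiset.count_sum', Multiset.count_replicate]

lemma IsOutlineCube.isOutlineSquare {α : Type*} [Fintype α] {k : ℕ} (e : α ≃ Fin k) {p : α → ℕ}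
    {c : α → α → α → ℕ} (hc : IsOutlineCube p c) :
    IsOutlineSquare (fun i => p (e.symm i)) (outlineOfCube e c) := by
  refine ⟨fun i j => ?_, fun i l => ?_, fun j l => ?_⟩
  · rw [← hc.1, ← Equiv.sum_comp e.symm]
    simp [outlineOfCube]
  · simp only [count_outlineOfCube]
    rw [Equiv.sum_comp e.symm fun j => c (e.symm i) j (e.symm l), hc.2.1]
  · simp only [count_outlineOfCube]
    rw [Equiv.sum_comp e.symm fun i => c i (e.symm j) (e.symm l), hc.2.2]

lemma outlineOfCube_eq_replicate {α : Type*} [DecidableEq α] {k : ℕ} (e : α ≃ Fin k)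
    {c : α → α → α → ℕ} {i j b : α} {m : ℕ} (h : ∀ l, c i j l = if l = b then m else 0) :
    outlineOfCube e c (e i) (e j) = Multiset.replicate m (e b) := by
  ext l
  simp only [count_outlineOfCube, Equiv.symm_apply_apply, h, Multiset.count_replicate,
    Equiv.symm_apply_eq, eq_comm (a := e b)]

lemma exists_isOutlineCube_of_even_sum {n : ℕ} (f : Fin n → ℕ) (a g : ℕ) (hg0 : 0 < g)
    (hf : ∀ i, f i ≤ g) (heven : Even (∑ i, f i)) (hg : 4 * g + 2 ≤ ∑ i, f i)
    (hm1 : 2 * g + 1 ≤ 3 * a) (hm2 : 3 * a + 2 * g ≤ ∑ i, f i) :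
    ∃ c : Fin 3 ⊕ Fin n → Fin 3 ⊕ Fin n → Fin 3 ⊕ Fin n → ℕ,
      IsOutlineCube (Sum.elim (fun _ => a) f) c ∧
      (∀ i l, c (.inr i) (.inr i) l = if l = .inr i then f i ^ 2 else 0) ∧
      ∀ μ ν l, c (.inl μ) (.inl ν) l = if l = .inl (-(μ + ν)) then a ^ 2 else 0 := by
  have : NeZero (∑ i, f i) := ⟨by omega⟩
  obtain ⟨s, hs⟩ := heven
  obtain ⟨γ, u, v, H, hγ⟩ := isIntervalPartition_finSigma f g hf
  obtain ⟨c, hc, hc1, hc2⟩ := H.exists_isOutlineCube (s := s) (a := a) (by omega) hg0 (by omega)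
    hm1 hm2
  refine ⟨c, ?_, fun i l => ?_, fun μ ν l => ?_⟩
  · convert hc using 2
    funext i
    rw [← hγ i]
    congr!
  · rw [hc1, ← hγ i]
    congr!
  · rw [hc2]
    congr!

end OutlineConstruction

/-- even case: for `P = (h_1 h_2 h_3 h_4 … h_k)` with
`h_1 = h_2 = h_3 ≥ 2`, `h_4 ≥ … ≥ h_k > 0`, `h_1(h_1−1) ≥ 2(h_k−1)`,
`r = h_4 + … + h_k` even, `h_4 ≤ (r−2)/4` and
`2 h_4 + 2 ≤ 3 h_1 + 1 ≤ r + 1 − 2 h_4`, there is an outline square `O`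
associated to `P` with `O(i,i)` consisting of `h_i ^ 2` copies of symbol `i`
for every `i`; `O(1,2)`, `O(2,3)`, `O(3,1)` consisting of `h_1 ^ 2` copies of
symbols `3`, `1`, `2` respectively; and `O(1,3)`, `O(2,1)`, `O(3,2)`
containing at least `h_1(h_1−1) − 2(h_k−1)` copies of symbols `2`, `3`, `1`
respectively.  (Symbols are 1-based in the paper, 0-based in `Fin k` here.) -/
theorem statement6 (k : ℕ) (h : ℕ → ℕ) (hk : 4 ≤ k)
    (h1two : 2 ≤ h 1) (h12 : h 1 = h 2) (h23 : h 2 = h 3)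
    (hmono : ∀ i, 4 ≤ i → i < k → h (i + 1) ≤ h i)
    (hpos : ∀ i, 1 ≤ i → i ≤ k → 0 < h i)
    (hk1 : 2 * (h k - 1) ≤ h 1 * (h 1 - 1))
    (heven : Even (∑ i ∈ Finset.Icc 4 k, h i))
    (h4b : 4 * h 4 + 2 ≤ ∑ i ∈ Finset.Icc 4 k, h i)
    (hlb : 2 * h 4 + 2 ≤ 3 * h 1 + 1)
    (hub : 3 * h 1 + 2 * h 4 ≤ ∑ i ∈ Finset.Icc 4 k, h i) :
    ∃ O : Fin k → Fin k → Multiset (Fin k),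
      IsOutlineSquare (fun i : Fin k => h ((i : ℕ) + 1)) O ∧
      (∀ i : Fin k, O i i = Multiset.replicate (h ((i : ℕ) + 1) ^ 2) i) ∧
      O ⟨0, by omega⟩ ⟨1, by omega⟩ = Multiset.replicate (h 1 ^ 2) ⟨2, by omega⟩ ∧
      O ⟨1, by omega⟩ ⟨2, by omega⟩ = Multiset.replicate (h 1 ^ 2) ⟨0, by omega⟩ ∧
      O ⟨2, by omega⟩ ⟨0, by omega⟩ = Multiset.replicate (h 1 ^ 2) ⟨1, by omega⟩ ∧
      h 1 * (h 1 - 1) - 2 * (h k - 1) ≤ (O ⟨0, by omega⟩ ⟨2, by omega⟩).count ⟨1, by omega⟩ ∧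
      h 1 * (h 1 - 1) - 2 * (h k - 1) ≤ (O ⟨1, by omega⟩ ⟨0, by omega⟩).count ⟨2, by omega⟩ ∧
      h 1 * (h 1 - 1) - 2 * (h k - 1) ≤ (O ⟨2, by omega⟩ ⟨1, by omega⟩).count ⟨0, by omega⟩ := by
  obtain ⟨n, rfl⟩ : ∃ n, k = 3 + n := ⟨k - 3, by omega⟩
  have hsum : ∑ i ∈ Finset.Icc 4 (3 + n), h i = ∑ i : Fin n, h (i + 4) := by
    rw [Fin.sum_univ_eq_sum_range fun i => h (i + 4), ← Finset.Ico_add_one_right_eq_Icc,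
      Finset.sum_Ico_eq_sum_range]
    refine Finset.sum_congr (by congr 1; omega) fun i _ => by rw [add_comm]
  rw [hsum] at heven h4b hub
  have hle : ∀ i, 4 + i ≤ 3 + n → h (4 + i) ≤ h 4 := by
    intro i
    induction i with
    | zero => exact fun _ => le_rfl
    | succ i ih => exact fun hi => (hmono (4 + i) (by omega) (by omega)).trans (ih (by omega))
  obtain ⟨c, hc, hc1, hc2⟩ := exists_isOutlineCube_of_even_sum (fun i : Fin n => h (i + 4)) (h 1)
    (h 4) (hpos 4 (by omega) hk) (fun i => by rw [add_comm]; exact hle i (by omega)) heven h4b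
    (by omega) (by omega)
  let e : Fin 3 ⊕ Fin n ≃ Fin (3 + n) := finSumFinEquiv
  have hsize : ∀ b, h ((e b : ℕ) + 1) = Sum.elim (fun _ => h 1) (fun i : Fin n => h (i + 4)) b := by
    rintro (μ | i)
    · fin_cases μ
      · rfl
      · exact h12.symm
      · exact (h12.trans h23).symm
    · simp only [e, finSumFinEquiv_apply_right, Fin.val_natAdd, Sum.elim_inr]
      congr 1
      omega
  have hblock : ∀ μ ν : Fin 3, outlineOfCube e c (e (.inl μ)) (e (.inl ν))
      = Multiset.replicate (h 1 ^ 2) (e (.inl (-(μ + ν)))) := fun μ ν =>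
    outlineOfCube_eq_replicate e (hc2 μ ν)
  have hbound : h 1 * (h 1 - 1) - 2 * (h (3 + n) - 1) ≤ h 1 ^ 2 := by
    rw [pow_two]
    exact (Nat.sub_le _ _).trans (Nat.mul_le_mul_left _ (Nat.sub_le _ _))
  refine ⟨outlineOfCube e c, ?_, ?_, hblock 0 1, hblock 1 2, hblock 2 0, ?_, ?_, ?_⟩
  · convert hc.isOutlineSquare e using 2 with i
    rw [← hsize, e.apply_symm_apply]
  · intro i
    obtain ⟨b, rfl⟩ := e.surjective i
    rw [hsize]
    rcases b with μ | i
    · rw [hblock]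
      congr 3
      fin_cases μ <;> rfl
    · exact outlineOfCube_eq_replicate e (hc1 i)
  · exact hbound.trans_eq
      ((congrArg _ (hblock 0 2)).trans (Multiset.count_replicate_self _ _)).symm
  · exact hbound.trans_eq
      ((congrArg _ (hblock 1 0)).trans (Multiset.count_replicate_self _ _)).symm
  · exact hbound.trans_eq
      ((congrArg _ (hblock 2 1)).trans (Multiset.count_replicate_self _ _)).symm
end

section
/- Let P = (h_1 h_2 h_3 h_4 … h_k) be a partition with h_1 = h_2 = h_3, h_4 ≥ … ≥ h_k > 0, and r = h_4 + … + h_k. Suppose there is an outline square O associated to P such that O(i,i) consists of h_i^2 copies of symbol i for each i ∈ {1,…,k}, and there are integers β_1, β_2 ≥ 0 such that O(2,3), O(3,1), and O(1,2) contain at least β_1 copies of symbols 1, 2, and 3 respectively, and O(3,2), O(1,3), and O(2,1) contain at least β_2 copies of symbols 1, 2, and 3 respectively. Let g be an integer with g ≥ h_1 and r(g − h_1) ≤ 2(g^2 − h_1^2) + β_1 + β_2, and let P' = (g g g h_4 … h_k). Then there exists an outline square O' associated to P' such that O'(i,i) consists of h_i^2 copies of symbol i for each i ∈ {4,…,k}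 and of g^2 copies of symbol i for each i ∈ {1,2,3}. -/
/-- A natural number bounded by a finite sum of naturals splits into pieces bounded by the
summands. -/
theorem exists_le_sum_eq {ι : Type*} [DecidableEq ι] (t : Finset ι) (w : ι → ℕ) (A : ℕ)
    (hA : A ≤ ∑ s ∈ t, w s) : ∃ α : ι → ℕ, (∀ s, α s ≤ w s) ∧ ∑ s ∈ t, α s = A := by
  induction t using Finset.induction_on generalizing A with
  | empty => exact ⟨fun _ => 0, fun _ => Nat.zero_le _, by simp_all⟩
  | insert a t ha ih =>
    rw [Finset.sum_insert ha] at hA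
    obtain ⟨α, hα, hsum⟩ := ih (A - min A (w a)) (by omega)
    refine ⟨Function.update α a (min A (w a)), fun s => ?_, ?_⟩
    · by_cases hs : s = a
      · subst hs
        simp
      · simpa [hs] using hα s
    · rw [Finset.sum_insert ha, Finset.sum_update_of_notMem ha, hsum]
      simp

/-- The multiset on a finite type with prescribed multiplicities. -/
def multisetOfCount {κ : Type*} [Fintype κ] (f : κ → ℕ) : Multiset κ :=
  ∑ l, Multiset.replicate (f l) l

theorem count_multisetOfCount {κ : Type*} [Fintype κ] [DecidableEq κ] (f : κ → ℕ) (l : κ) :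
    (multisetOfCount f).count l = f l := by
  simp [multisetOfCount, Multiset.count_sum', Multiset.count_replicate]

theorem card_multisetOfCount {κ : Type*} [Fintype κ] (f : κ → ℕ) :
    Multiset.card (multisetOfCount f) = ∑ l, f l := by
  simp [multisetOfCount]

/-- All lines of the three-dimensional array `c` in the three coordinate directions sum to the
products of the weights of the two fixed coordinates. -/
def HasProductLineSums {κ R : Type*} [Fintype κ] [CommSemiring R] (q : κ → R)
    (c : κ → κ → κ → R) : Prop :=
  (∀ i j, ∑ l, c i j l = q i * q j) ∧
  (∀ i l, ∑ j, c i j l = q i * q l) ∧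
  (∀ j l, ∑ i, c i j l = q j * q l)

theorem hasProductLineSums_natCast {κ : Type*} [Fintype κ] {q : κ → ℕ} {c : κ → κ → κ → ℕ} :
    HasProductLineSums (fun i => (q i : ℤ)) (fun i j l => (c i j l : ℤ)) ↔
      HasProductLineSums q c := by
  simp only [HasProductLineSums]
  norm_cast

/-- The correction added to the counts when three equal parts are enlarged. Cyclic triples and
pairs of large indices are weighted by `E` and `α`, anticyclic ones by `F` and `γ`. -/
def blowUpCorrection {m : ℕ} (D E F : ℤ) (α γ : Fin m → ℤ) :
    Fin 3 ⊕ Fin m → Fin 3 ⊕ Fin m → Fin 3 ⊕ Fin m → ℤ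
  | .inl a, .inl b, .inl c =>
    if b = a ∧ c = a then D else if b = a + 1 ∧ c = a + 2 then E
    else if b = a + 2 ∧ c = a + 1 then F else 0
  | .inl a, .inl b, .inr s => if b = a + 1 then α s else if b = a + 2 then γ s else 0
  | .inl a, .inr s, .inl c => if a = c + 1 then α s else if a = c + 2 then γ s else 0
  | .inr s, .inl b, .inl c => if c = b + 1 then α s else if c = b + 2 then γ s else 0
  | _, _, _ => 0

theorem hasProductLineSums_add_blowUpCorrection {m : ℕ} {h g D E F : ℤ} {w α γ : Fin m → ℤ}
    {c : Fin 3 ⊕ Fin m → Fin 3 ⊕ Fin m → Fin 3 ⊕ Fin m → ℤ}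
    (hc : HasProductLineSums (Sum.elim (fun _ => h) w) c)
    (hD : h * h + D = g * g) (hE : E + ∑ s, α s = D) (hF : F + ∑ s, γ s = D)
    (hαγ : ∀ s, h * w s + (α s + γ s) = g * w s) :
    HasProductLineSums (Sum.elim (fun _ => g) w)
      (fun i j l => c i j l + blowUpCorrection D E F α γ i j l) := by
  obtain ⟨h1, h2, h3⟩ := hc
  refine ⟨fun i j => ?_, fun i l => ?_, fun j l => ?_⟩
  · rw [Finset.sum_add_distrib, h1]
    rcases i with a | s <;> rcases j with b | t
    · fin_cases a <;> fin_cases b <;>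
        simp [blowUpCorrection] <;> linarith
    · have := hαγ t
      fin_cases a <;> simp [blowUpCorrection, Fin.sum_univ_three] <;> linarith
    · have := hαγ s
      fin_cases b <;> simp [blowUpCorrection, Fin.sum_univ_three] <;> linarith
    · simp [blowUpCorrection]
  · rw [Finset.sum_add_distrib, h2]
    rcases i with a | s <;> rcases l with b | t
    · fin_cases a <;> fin_cases b <;>
        simp [blowUpCorrection] <;> linarith
    · have := hαγ t
      fin_cases a <;> simp [blowUpCorrection, Fin.sum_univ_three] <;> linarith
    · have := hαγ s
      fin_cases b <;> simp [blowUpCorrection, Fin.sum_univ_three] <;> linarith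
    · simp [blowUpCorrection]
  · rw [Finset.sum_add_distrib, h3]
    rcases j with a | s <;> rcases l with b | t
    · fin_cases a <;> fin_cases b <;>
        simp [blowUpCorrection, Fin.sum_univ_three] <;> linarith
    · have := hαγ t
      fin_cases a <;> simp [blowUpCorrection, Fin.sum_univ_three] <;> linarith
    · have := hαγ s
      fin_cases b <;> simp [blowUpCorrection, Fin.sum_univ_three] <;> linarith
    · simp [blowUpCorrection]

/-- The blow-up construction on the level of counts. -/
theorem exists_blowUp_counts {m : ℕ} {h g β₁ β₂ : ℕ} {w : Fin m → ℕ}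
    {c : Fin 3 ⊕ Fin m → Fin 3 ⊕ Fin m → Fin 3 ⊕ Fin m → ℕ}
    (hc : HasProductLineSums (Sum.elim (fun _ => h) w) c)
    (hβ₁ : ∀ a : Fin 3, β₁ ≤ c (.inl a) (.inl (a + 1)) (.inl (a + 2)))
    (hβ₂ : ∀ a : Fin 3, β₂ ≤ c (.inl a) (.inl (a + 2)) (.inl (a + 1)))
    (hg : h ≤ g) (hgr : (∑ s, w s) * (g - h) ≤ 2 * (g ^ 2 - h ^ 2) + β₁ + β₂) :
    ∃ c' : Fin 3 ⊕ Fin m → Fin 3 ⊕ Fin m → Fin 3 ⊕ Fin m → ℕ,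
      HasProductLineSums (Sum.elim (fun _ => g) w) c' ∧
      (∀ s l, c' (.inr s) (.inr s) l = c (.inr s) (.inr s) l) ∧
      (∀ a, c' (.inl a) (.inl a) (.inl a) = c (.inl a) (.inl a) (.inl a) + (g ^ 2 - h ^ 2)) ∧
      (∀ a l, l ≠ .inl a → c' (.inl a) (.inl a) l = c (.inl a) (.inl a) l) := by
  obtain ⟨d, rfl⟩ := Nat.exists_eq_add_of_le hg
  have hD : (h + d) ^ 2 - h ^ 2 = 2 * h * d + d ^ 2 := by
    rw [Nat.sub_eq_iff_eq_add (Nat.pow_le_pow_left hg 2)]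
    ring
  rw [hD] at hgr ⊢
  rw [Nat.add_sub_cancel_left] at hgr
  generalize hD' : 2 * h * d + d ^ 2 = D at hgr ⊢
  obtain ⟨α, hα, hsum⟩ := exists_le_sum_eq Finset.univ (fun s => w s * d)
    (min ((∑ s, w s) * d) (D + β₁)) (by rw [Finset.sum_mul]; exact min_le_left _ _)
  have hγ : ∑ s, ((w s : ℤ) * d - α s) = ((∑ s, w s : ℕ) : ℤ) * d - ∑ s, (α s : ℤ) := by
    push_cast
    rw [Finset.sum_sub_distrib, Finset.sum_mul]
  have hsum' : ∑ s, (α s : ℤ) = ((min ((∑ s, w s) * d) (D + β₁) : ℕ) : ℤ) := by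
    rw [← hsum]
    push_cast
    rfl
  have hcast : ((∑ s, w s : ℕ) : ℤ) * d = (((∑ s, w s) * d : ℕ) : ℤ) := by push_cast; rfl
  set x := blowUpCorrection (D : ℤ) (D - ∑ s, (α s : ℤ)) (D - ∑ s, ((w s : ℤ) * d - α s))
    (fun s => (α s : ℤ)) (fun s => (w s : ℤ) * d - α s) with hx
  have hnonneg : ∀ i j l, 0 ≤ (c i j l : ℤ) + x i j l := by
    have hE : -(β₁ : ℤ) ≤ D - ∑ s, (α s : ℤ) := by omega
    have hF : -(β₂ : ℤ) ≤ D - ∑ s, ((w s : ℤ) * d - α s) := by omega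
    have hα' : ∀ s, (0 : ℤ) ≤ (w s : ℤ) * d - α s := fun s => by
      have := hα s
      zify at this
      linarith
    rintro (a | s) (b | t) (e | u) <;> simp only [hx, blowUpCorrection]
    · split_ifs with h1 h2 h3
      · positivity
      · have := hβ₁ a
        rw [← h2.1, ← h2.2] at this
        linarith [(Nat.cast_le (α := ℤ)).2 this]
      · have := hβ₂ a
        rw [← h3.1, ← h3.2] at this
        linarith [(Nat.cast_le (α := ℤ)).2 this]
      · positivity
    · have := hα' u
      split_ifs <;> positivity
    · have := hα' t
      split_ifs <;> positivity
    · positivity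
    · have := hα' s
      split_ifs <;> positivity
    all_goals positivity
  have hq : ∀ v : ℕ, (fun i => ((Sum.elim (fun _ : Fin 3 => v) w i : ℕ) : ℤ)) =
      Sum.elim (fun _ => (v : ℤ)) (fun s => (w s : ℤ)) := fun v => by
    ext (a | s) <;> rfl
  have key : HasProductLineSums (Sum.elim (fun _ => ((h + d : ℕ) : ℤ)) (fun s => (w s : ℤ)))
      (fun i j l => (c i j l : ℤ) + x i j l) := by
    refine hasProductLineSums_add_blowUpCorrection (h := h) ?_ ?_ (by ring) (by ring) ?_
    · rw [← hq]
      exact hasProductLineSums_natCast.2 hc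
    · rw [← hD']
      push_cast
      ring
    · intro s
      push_cast
      ring
  rw [← hq] at key
  choose c' hc' using fun i j l => Int.eq_ofNat_of_zero_le (hnonneg i j l)
  simp only [hc'] at key
  refine ⟨c', hasProductLineSums_natCast.1 key, fun s l => ?_, fun a => ?_, fun a l hl => ?_⟩
  · have := hc' (.inr s) (.inr s) l
    rcases l with b | t <;> simp only [hx, blowUpCorrection] at this <;> omega
  · have := hc' (.inl a) (.inl a) (.inl a)
    simp only [hx, blowUpCorrection, and_self, if_true] at this
    omega
  · have := hc' (.inl a) (.inl a) l
    rcases l with b | t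
    · have hb : b ≠ a := fun hb => hl (by rw [hb])
      simp [hx, blowUpCorrection, hb] at this
      omega
    · simp [hx, blowUpCorrection] at this
      omega

/-- blow-up: let `P = (h_1 … h_k)` with `h_1 = h_2 = h_3`,
`h_4 ≥ … ≥ h_k > 0` and `r = h_4 + … + h_k`.  Suppose `O` is an outline square
associated to `P` with `O(i,i)` consisting of `h_i ^ 2` copies of symbol `i`
for every `i`, and `β_1, β_2 ≥ 0` are such that `O(2,3)`, `O(3,1)`, `O(1,2)`
contain at least `β_1` copies of symbols `1`, `2`, `3` respectively, and
`O(3,2)`, `O(1,3)`, `O(2,1)` contain at least `β_2` copies of symbols `1`,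
`2`, `3` respectively.  If `g ≥ h_1` and
`r (g − h_1) ≤ 2 (g² − h_1²) + β_1 + β_2`, then there is an outline square
`O'` associated to `P' = (g g g h_4 … h_k)` with `O'(i,i)` consisting of
`h_i ^ 2` copies of symbol `i` for `i ∈ {4,…,k}` and of `g ^ 2` copies of
symbol `i` for `i ∈ {1,2,3}`.  (Symbols are 0-based in `Fin k` here.) -/
theorem statement7 (k : ℕ) (h : ℕ → ℕ) (hk : 3 ≤ k)
    (h12 : h 1 = h 2) (h23 : h 2 = h 3)
    (hmono : ∀ i, 4 ≤ i → i < k → h (i + 1) ≤ h i)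
    (hpos : ∀ i, 1 ≤ i → i ≤ k → 0 < h i)
    (O : Fin k → Fin k → Multiset (Fin k))
    (hO : IsOutlineSquare (fun i : Fin k => h ((i : ℕ) + 1)) O)
    (hdiag : ∀ i : Fin k, O i i = Multiset.replicate (h ((i : ℕ) + 1) ^ 2) i)
    (β₁ β₂ : ℕ)
    (hb1a : β₁ ≤ (O ⟨1, by omega⟩ ⟨2, by omega⟩).count ⟨0, by omega⟩)
    (hb1b : β₁ ≤ (O ⟨2, by omega⟩ ⟨0, by omega⟩).count ⟨1, by omega⟩)
    (hb1c : β₁ ≤ (O ⟨0, by omega⟩ ⟨1, by omega⟩).count ⟨2, by omega⟩)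
    (hb2a : β₂ ≤ (O ⟨2, by omega⟩ ⟨1, by omega⟩).count ⟨0, by omega⟩)
    (hb2b : β₂ ≤ (O ⟨0, by omega⟩ ⟨2, by omega⟩).count ⟨1, by omega⟩)
    (hb2c : β₂ ≤ (O ⟨1, by omega⟩ ⟨0, by omega⟩).count ⟨2, by omega⟩)
    (g : ℕ) (hg : h 1 ≤ g)
    (hgr : (∑ i ∈ Finset.Icc 4 k, h i) * (g - h 1) ≤ 2 * (g ^ 2 - h 1 ^ 2) + β₁ + β₂) :
    ∃ O' : Fin k → Fin k → Multiset (Fin k),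
      IsOutlineSquare (fun i : Fin k => if (i : ℕ) < 3 then g else h ((i : ℕ) + 1)) O' ∧
      (∀ i : Fin k, 3 ≤ (i : ℕ) → O' i i = Multiset.replicate (h ((i : ℕ) + 1) ^ 2) i) ∧
      (∀ i : Fin k, (i : ℕ) < 3 → O' i i = Multiset.replicate (g ^ 2) i) := by
  obtain ⟨m, rfl⟩ := Nat.exists_eq_add_of_le hk
  let e : Fin 3 ⊕ Fin m ≃ Fin (3 + m) := finSumFinEquiv
  let w : Fin m → ℕ := fun s => h (s + 4)
  have hp : ∀ i, h ((e i : ℕ) + 1) = Sum.elim (fun _ => h 1) w i := by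
    rintro (a | s)
    · fin_cases a
      · rfl
      · exact h12.symm
      · exact (h12.trans h23).symm
    · simp only [e, finSumFinEquiv_apply_right, Fin.val_natAdd, Sum.elim_inr, w]
      congr 1
      omega
  have hp' : ∀ i, (if (e i : ℕ) < 3 then g else h ((e i : ℕ) + 1)) =
      Sum.elim (fun _ => g) w i := by
    rintro (a | s)
    · simp [e]
    · rw [hp, if_neg (by simp [e])]
      rfl
  have hw : ∑ i ∈ Finset.Icc 4 (3 + m), h i = ∑ s, w s := by
    rw [Fin.sum_univ_eq_sum_range (fun s => h (s + 4)) m, Finset.range_eq_Ico,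
      Finset.sum_Ico_add' (fun s => h s) 0 m 4]
    refine Finset.sum_congr ?_ fun _ _ => rfl
    ext i
    simp only [Finset.mem_Icc, Finset.mem_Ico]
    omega
  obtain ⟨hcard, hrow, hcol⟩ := hO
  have hc : HasProductLineSums (Sum.elim (fun _ => h 1) w)
      (fun i j l => (O (e i) (e j)).count (e l)) := by
    refine ⟨fun i j => ?_, fun i l => ?_, fun j l => ?_⟩
    · rw [e.sum_comp (fun l => (O (e i) (e j)).count l), ← hp, ← hp, ← hcard]
      exact Multiset.sum_count_eq_card fun _ _ => Finset.mem_univ _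
    · rw [e.sum_comp (fun j => (O (e i) j).count (e l)), ← hp, ← hp, ← hrow]
    · rw [e.sum_comp (fun i => (O i (e j)).count (e l)), ← hp, ← hp, ← hcol]
  rw [hw] at hgr
  obtain ⟨c', ⟨h1, h2, h3⟩, hsmall, hlarge, hoff⟩ := exists_blowUp_counts (β₁ := β₁) (β₂ := β₂) hc
    (fun a => by
      fin_cases a
      · exact hb1c
      · exact hb1a
      · exact hb1b)
    (fun a => by
      fin_cases a
      · exact hb2b
      · exact hb2c
      · exact hb2a) hg hgr
  refine ⟨fun i j => multisetOfCount fun l => c' (e.symm i) (e.symm j) (e.symm l),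
    ⟨fun i j => ?_, fun i l => ?_, fun j l => ?_⟩, fun i hi => ?_, fun i hi => ?_⟩
  · obtain ⟨i, rfl⟩ := e.surjective i
    obtain ⟨j, rfl⟩ := e.surjective j
    simp only [card_multisetOfCount, Equiv.symm_apply_apply, hp']
    rw [e.symm.sum_comp (fun l => c' i j l), h1]
  · obtain ⟨i, rfl⟩ := e.surjective i
    obtain ⟨l, rfl⟩ := e.surjective l
    simp only [count_multisetOfCount, Equiv.symm_apply_apply, hp']
    rw [e.symm.sum_comp (fun j => c' i j l), h2]
  · obtain ⟨j, rfl⟩ := e.surjective j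
    obtain ⟨l, rfl⟩ := e.surjective l
    simp only [count_multisetOfCount, Equiv.symm_apply_apply, hp']
    rw [e.symm.sum_comp (fun i => c' i j l), h3]
  · rw [← hdiag]
    obtain ⟨i | s, rfl⟩ := e.surjective i
    · simp only [e, finSumFinEquiv_apply_left, Fin.val_castAdd] at hi
      omega
    · ext l
      obtain ⟨l, rfl⟩ := e.surjective l
      simp only [count_multisetOfCount, Equiv.symm_apply_apply, hsmall]
  · obtain ⟨a | s, rfl⟩ := e.surjective i
    · ext l
      obtain ⟨l, rfl⟩ := e.surjective l
      simp only [count_multisetOfCount, Equiv.symm_apply_apply]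
      by_cases hl : l = .inl a
      · subst hl
        rw [hlarge, hdiag, Multiset.count_replicate_self, Multiset.count_replicate_self, hp,
          Sum.elim_inl, Nat.add_sub_cancel' (Nat.pow_le_pow_left hg 2)]
      · have hne : e (.inl a) ≠ e l := fun hh => hl (e.injective hh).symm
        rw [hoff a l hl, hdiag, Multiset.count_replicate, Multiset.count_replicate, if_neg hne,
          if_neg hne]
    · simp only [e, finSumFinEquiv_apply_right, Fin.val_natAdd] at hi
      omega
end

section
/- Let 3 ≤ m ≤ k be integers and let h_m ≥ h_{m+1} ≥ … ≥ h_k > 0 be integers satisfying h_{m+2} + h_{m+3} + … + h_k ≤ (m−1)h_m + (m−2)h_{m+1}. Then there exists an outline array corresponding to the frequency array F of order k defined by: F(i,j) = 0 if i = j; F(i,j) = h_m + h_{m+1} if i ≠ j and i,j ≤ m; F(i,j) = h_j if i ≤ m and j > m; F(i,j) = h_i if i > m and j ≤ m; and F(i,j) = 0 otherwise. -/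
/-- An outline array corresponding to a frequency array `F` of order `k` (a
`k × k` array of non-negative integers): a `k × k` array `O` of multisets of
symbols from `{1,…,k}` (encoded as `Fin k`) such that `O i j` has exactly
`F i j` elements (with multiplicity), symbol `l` occurs exactly `F i l` times
in row `i`, and symbol `l` occurs exactly `F l j` times in column `j`. -/
def IsOutlineArray {k : ℕ} (F : Fin k → Fin k → ℕ)
    (O : Fin k → Fin k → Multiset (Fin k)) : Prop :=
  (∀ i j, Multiset.card (O i j) = F i j) ∧
  (∀ i l, ∑ j, (O i j).count l = F i l) ∧
  (∀ j l, ∑ i, (O i j).count l = F l j)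

open Finset

/-- A three-dimensional array on pairwise distinct indices whose line sums are at most `a` and
whose plane sums are all equal to `N`. -/
structure IsPartialCube {V : Type*} [Fintype V] (a N : ℕ) (x : V → V → V → ℕ) : Prop where
  off_row_col : ∀ i l, x i i l = 0
  off_row_sym : ∀ i j, x i j i = 0
  off_col_sym : ∀ i j, x i j j = 0
  line_sym : ∀ i j, ∑ l, x i j l ≤ a
  line_col : ∀ i l, ∑ j, x i j l ≤ a
  line_row : ∀ j l, ∑ i, x i j l ≤ a
  plane_row : ∀ i, ∑ j, ∑ l, x i j l = N
  plane_col : ∀ j, ∑ i, ∑ l, x i j l = N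
  plane_sym : ∀ l, ∑ i, ∑ j, x i j l = N

namespace IsPartialCube

variable {V W : Type*} [Fintype V] [Fintype W]

theorem zero (a : ℕ) : IsPartialCube a 0 (fun _ _ _ : V => 0) := by
  constructor <;> simp

theorem add {a b N M : ℕ} {x y : V → V → V → ℕ} (hx : IsPartialCube a N x)
    (hy : IsPartialCube b M y) :
    IsPartialCube (a + b) (N + M) (fun i j l => x i j l + y i j l) := by
  constructor <;> intros <;> try simp only [sum_add_distrib]
  · rw [hx.off_row_col, hy.off_row_col]
  · rw [hx.off_row_sym, hy.off_row_sym]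
  · rw [hx.off_col_sym, hy.off_col_sym]
  · exact add_le_add (hx.line_sym _ _) (hy.line_sym _ _)
  · exact add_le_add (hx.line_col _ _) (hy.line_col _ _)
  · exact add_le_add (hx.line_row _ _) (hy.line_row _ _)
  · rw [hx.plane_row, hy.plane_row]
  · rw [hx.plane_col, hy.plane_col]
  · rw [hx.plane_sym, hy.plane_sym]

theorem comp_equiv {a N : ℕ} {x : V → V → V → ℕ} (hx : IsPartialCube a N x) (e : W ≃ V) :
    IsPartialCube a N (fun i j l => x (e i) (e j) (e l)) := by
  constructor
  · exact fun _ _ => hx.off_row_col _ _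
  · exact fun _ _ => hx.off_row_sym _ _
  · exact fun _ _ => hx.off_col_sym _ _
  · exact fun i j => (e.sum_comp (x (e i) (e j))).trans_le (hx.line_sym _ _)
  · exact fun i l => (e.sum_comp fun j => x (e i) j (e l)).trans_le (hx.line_col _ _)
  · exact fun j l => (e.sum_comp fun i => x i (e j) (e l)).trans_le (hx.line_row _ _)
  · intro i
    rw [← hx.plane_row (e i), ← e.sum_comp]
    exact sum_congr rfl fun j _ => e.sum_comp (x (e i) (e j))
  · intro j
    rw [← hx.plane_col (e j), ← e.sum_comp]
    exact sum_congr rfl fun i _ => e.sum_comp (x (e i) (e j))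
  · intro l
    rw [← hx.plane_sym (e l), ← e.sum_comp]
    exact sum_congr rfl fun i _ => e.sum_comp fun j => x (e i) j (e l)

/-- Translates of the triples `(0, c s, d s)` in an abelian group. -/
theorem of_translates {G : Type*} [AddCommGroup G] [Fintype G] [DecidableEq G] {ι : Type*}
    (S : Finset ι) (c d : ι → G)
    (hc : Set.InjOn c S) (hd : Set.InjOn d S) (he : Set.InjOn (fun s => d s - c s) S)
    (hc0 : ∀ s ∈ S, c s ≠ 0) (hd0 : ∀ s ∈ S, d s ≠ 0) (he0 : ∀ s ∈ S, c s ≠ d s) :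
    IsPartialCube 1 S.card
      (fun i j l : G => ∑ s ∈ S, if j = i + c s ∧ l = i + d s then 1 else 0) := by
  have key : ∀ (f : ι → G), Set.InjOn f S → ∀ g, ∑ s ∈ S, (if f s = g then 1 else 0) ≤ 1 := by
    intro f hf g
    rw [← card_filter, card_le_one]
    intro s hs t ht
    rw [mem_filter] at hs ht
    exact hf hs.1 ht.1 (hs.2.trans ht.2.symm)
  constructor
  · intro i l
    refine sum_eq_zero fun s hs => if_neg fun h => hc0 s hs ?_
    simpa using h.1
  · intro i l
    refine sum_eq_zero fun s hs => if_neg fun h => hd0 s hs ?_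
    simpa using h.2
  · intro i j
    refine sum_eq_zero fun s hs => if_neg fun h => he0 s hs ?_
    simpa using h.1.symm.trans h.2
  · intro i j
    rw [sum_comm]
    refine le_trans (sum_le_sum fun s _ => ?_) (key c hc (j - i))
    simp only [ite_and, sum_ite_irrel, sum_const_zero, sum_ite_eq', mem_univ, if_true]
    refine le_of_eq (if_congr ?_ rfl rfl)
    rw [eq_sub_iff_add_eq', eq_comm]
  · intro i l
    rw [sum_comm]
    refine le_trans (sum_le_sum fun s _ => ?_) (key d hd (l - i))
    simp only [ite_and, sum_ite_eq', mem_univ, if_true]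
    refine le_of_eq (if_congr ?_ rfl rfl)
    rw [eq_sub_iff_add_eq', eq_comm]
  · intro j l
    rw [sum_comm]
    refine le_trans (sum_le_sum fun s _ => ?_) (key _ he (l - j))
    simp only [← sub_eq_iff_eq_add (a := j), ite_and, sum_ite_eq, mem_univ, if_true]
    refine le_of_eq (if_congr ?_ rfl rfl)
    rw [eq_sub_iff_add_eq, show d s - c s + j = j - c s + d s by abel, eq_comm]
  · intro i
    simp only [sum_comm (t := S), ite_and, sum_ite_irrel, sum_const_zero, sum_ite_eq', mem_univ,
      if_true, sum_const, smul_eq_mul, mul_one]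
  · intro j
    simp only [sum_comm (t := S), ite_and, ← sub_eq_iff_eq_add (a := j), sum_ite_irrel,
      sum_const_zero, sum_ite_eq', sum_ite_eq, mem_univ, if_true, sum_const, smul_eq_mul, mul_one]
  · intro l
    simp only [sum_comm (t := S), ite_and, ← sub_eq_iff_eq_add (a := l), sum_ite_eq', sum_ite_eq, mem_univ, if_true, sum_const, smul_eq_mul, mul_one]

theorem of_idempotent [DecidableEq V] (f : V → V → V) (hf : ∀ i, f i i = i)
    (hr : ∀ i, Function.Injective (f i)) (hl : ∀ j, Function.Injective (fun i => f i j)) :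
    IsPartialCube 1 (Fintype.card V - 1) (fun i j l => if i ≠ j ∧ f i j = l then 1 else 0) := by
  have hcard : ∀ v : V, ∑ w, (if v ≠ w then 1 else 0) = Fintype.card V - 1 := by
    intro v
    rw [← card_filter, filter_ne, card_erase_of_mem (mem_univ v), card_univ]
  constructor
  · simp
  · intro i j
    refine if_neg fun h => h.1 (hr i ?_)
    rw [hf, h.2]
  · intro i j
    refine if_neg fun h => h.1 (hl j ?_)
    simp only [hf, h.2]
  · intro i j
    rw [← card_filter, card_le_one]
    grind
  · intro i l
    rw [← card_filter, card_le_one]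
    intro s hs t ht
    simp only [mem_filter] at hs ht
    exact hr i (hs.2.2.trans ht.2.2.symm)
  · intro j l
    rw [← card_filter, card_le_one]
    intro s hs t ht
    simp only [mem_filter] at hs ht
    exact hl j (hs.2.2.trans ht.2.2.symm)
  · intro i
    simp only [ite_and, sum_ite_irrel, sum_const_zero, sum_ite_eq, mem_univ, if_true, hcard]
  · intro j
    simp only [ite_and, sum_ite_irrel, sum_const_zero, sum_ite_eq, mem_univ, if_true]
    simp only [ne_comm (b := j), hcard]
  · intro l
    rw [← hcard l]
    refine sum_congr rfl fun i _ => ?_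
    obtain ⟨j, hj⟩ := (Finite.injective_iff_surjective.1 (hr i)) l
    have : ∀ j', f i j' = l ↔ j' = j := fun j' => by rw [← hj, (hr i).eq_iff]
    have h2 : i ≠ j ↔ l ≠ i := by
      rw [← (hr i).ne_iff, hf, hj, ne_comm]
    simp only [this, and_comm (a := i ≠ _), ite_and, sum_ite_eq', mem_univ, if_true, h2]

end IsPartialCube

/-- An idempotent Latin square on `R ∪ {∞}`, prolonging `(x + y) / 2` along `y = x + 1`. -/
def prolongedMean {R : Type*} [CommRing R] [DecidableEq R] (t : R) :
    Option R → Option R → Option R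
  | none, none => none
  | some x, none => some (x + t)
  | none, some y => some (y - t)
  | some x, some y => if y = x + 1 then none else some ((x + y) * t)

section prolongedMean

variable {R : Type*} [CommRing R] [DecidableEq R] {t : R}

theorem prolongedMean_self [Nontrivial R] (ht : 2 * t = 1) (i : Option R) :
    prolongedMean t i i = i := by
  rcases i with _ | x
  · rfl
  · simp only [prolongedMean, left_eq_add, one_ne_zero, if_false, Option.some.injEq]
    linear_combination x * ht

theorem prolongedMean_injective_right (ht : 2 * t = 1) (i : Option R) :
    Function.Injective (prolongedMean t i) := by
  intro y z h
  rcases i with _ | x <;> rcases y with _ | y <;> rcases z with _ | z <;>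
    simp only [prolongedMean] at h ⊢ <;> (try split_ifs at h) <;>
    simp_all only [Option.some.injEq, reduceCtorEq]
  · linear_combination h
  · rename_i hz
    exact hz (by linear_combination -2 * h + (1 - x - z) * ht)
  · rename_i hz
    exact hz (by linear_combination 2 * h + (1 - x - y) * ht)
  · linear_combination 2 * h - (y - z) * ht

theorem prolongedMean_injective_left (ht : 2 * t = 1) (j : Option R) :
    Function.Injective (fun i => prolongedMean t i j) := by
  intro y z h
  rcases j with _ | x <;> rcases y with _ | y <;> rcases z with _ | z <;>
    simp only [prolongedMean] at h ⊢ <;> (try split_ifs at h) <;>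
    simp_all only [Option.some.injEq, reduceCtorEq]
  · linear_combination h
  · rename_i hz
    exact hz (by linear_combination 2 * h + (z + x + 1) * ht)
  · rename_i hz
    exact hz (by linear_combination -2 * h + (y + x + 1) * ht)
  · rename_i hz _
    exact (add_right_cancel hz).symm
  · linear_combination 2 * h - (y - z) * ht

end prolongedMean

theorem exists_isPartialCube_of_nat {m n : ℕ} [NeZero m] (d e : ℕ → ℕ)
    (hn : n < m)
    (hd : ∀ s ∈ Icc 1 n, 0 < d s ∧ d s < m) (he : ∀ s ∈ Icc 1 n, 0 < e s ∧ e s < m)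
    (hd' : Set.InjOn d (Icc 1 n)) (he' : Set.InjOn e (Icc 1 n))
    (hde : ∀ s ∈ Icc 1 n, s + e s = d s ∨ s + e s = d s + m) :
    ∃ x : Fin m → Fin m → Fin m → ℕ, IsPartialCube 1 n x := by
  have inj : ∀ {a b : ℕ}, a < m → b < m → (a : ZMod m) = b → a = b := by
    intro a b ha hb h
    rwa [ZMod.natCast_eq_natCast_iff', Nat.mod_eq_of_lt ha, Nat.mod_eq_of_lt hb] at h
  have ne0 : ∀ {a : ℕ}, 0 < a → a < m → (a : ZMod m) ≠ 0 := by
    intro a h0 ha h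
    exact h0.ne' (inj ha (NeZero.pos m) (by simpa using h))
  have sub : ∀ s ∈ Icc 1 n, (d s : ZMod m) - s = e s := by
    intro s hs
    rcases hde s hs with h | h <;>
    · have := congrArg (Nat.cast : ℕ → ZMod m) h
      simp only [Nat.cast_add, CharP.cast_eq_zero, add_zero] at this
      rw [← this]; ring
  have := IsPartialCube.of_translates (Icc 1 n) (fun s => (s : ZMod m)) (fun s => (d s : ZMod m))
    (fun s hs t ht h => inj (by simp at hs; omega) (by simp at ht; omega) h)
    (fun s hs t ht h => hd' hs ht (inj (hd s hs).2 (hd t ht).2 h))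
    (fun s hs t ht h => he' hs ht (inj (he s hs).2 (he t ht).2 (by
      simpa only [sub s hs, sub t ht] using h)))
    (fun s hs => by rw [mem_Icc] at hs; exact ne0 (by omega) (by omega))
    (fun s hs => ne0 (hd s hs).1 (hd s hs).2)
    (fun s hs h => ne0 (he s hs).1 (he s hs).2 (by rw [← sub s hs, h, sub_self]))
  rw [Nat.card_Icc, Nat.add_sub_cancel] at this
  exact ⟨_, this.comp_equiv (ZMod.finEquiv m).toEquiv⟩

theorem exists_isPartialCube_one {m n : ℕ} (hm : 3 ≤ m) (hn : n ≤ m - 1) :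
    ∃ x : Fin m → Fin m → Fin m → ℕ, IsPartialCube 1 n x := by
  have : NeZero m := ⟨by omega⟩
  rcases Nat.even_or_odd' m with ⟨q, hq | hq⟩
  · rcases hn.lt_or_eq with hn | hn
    · refine exists_isPartialCube_of_nat (fun s => if s < q then 2 * s else 2 * s + 1 - m)
        (fun s => if s < q then s else s + 1) (by omega) ?_ ?_ ?_ ?_ ?_
      · intro s hs; rw [mem_Icc] at hs; split_ifs <;> omega
      · intro s hs; rw [mem_Icc] at hs; split_ifs <;> omega
      · intro s hs t ht h; rw [mem_coe, mem_Icc] at hs ht; dsimp only at h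
        split_ifs at h <;> omega
      · intro s hs t ht h; rw [mem_coe, mem_Icc] at hs ht; dsimp only at h
        split_ifs at h <;> omega
      · intro s hs; rw [mem_Icc] at hs; split_ifs <;> omega
    · subst hn
      have : NeZero (m - 1) := ⟨by omega⟩
      have : Fact (1 < m - 1) := ⟨by omega⟩
      have ht : 2 * (q : ZMod (m - 1)) = 1 := by
        have h : 2 * q = (m - 1) + 1 := by omega
        have := congrArg (Nat.cast : ℕ → ZMod (m - 1)) h
        push_cast at this
        simpa using this
      have key := IsPartialCube.of_idempotent (prolongedMean (q : ZMod (m - 1)))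
        (prolongedMean_self ht) (prolongedMean_injective_right ht)
        (prolongedMean_injective_left ht)
      have hc : Fintype.card (Option (ZMod (m - 1))) = m := by
        rw [Fintype.card_option, ZMod.card]; omega
      rw [hc] at key
      exact ⟨_, key.comp_equiv (Fintype.equivFinOfCardEq hc).symm⟩
  · refine exists_isPartialCube_of_nat (fun s => if s ≤ q then 2 * s else 2 * s - m)
      (fun s => s) (by omega) ?_ ?_ ?_ ?_ ?_
    · intro s hs; rw [mem_Icc] at hs; split_ifs <;> omega
    · intro s hs; rw [mem_Icc] at hs; omega
    · intro s hs t ht h; rw [mem_coe, mem_Icc] at hs ht; dsimp only at h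
      split_ifs at h <;> omega
    · exact fun s _ t _ h => h
    · intro s hs; rw [mem_Icc] at hs; split_ifs <;> omega

theorem exists_isPartialCube {m : ℕ} (hm : 3 ≤ m) (a : ℕ) :
    ∀ N ≤ (m - 1) * a, ∃ x : Fin m → Fin m → Fin m → ℕ, IsPartialCube a N x := by
  induction a with
  | zero =>
    intro N hN
    obtain rfl : N = 0 := by simpa using hN
    exact ⟨_, IsPartialCube.zero 0⟩
  | succ a ih =>
    intro N hN
    rw [mul_add_one] at hN
    obtain ⟨x, hx⟩ := ih (N - min N (m - 1)) (by omega)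
    obtain ⟨y, hy⟩ := exists_isPartialCube_one hm (min_le_right N (m - 1))
    have := hx.add hy
    rw [Nat.sub_add_cancel (min_le_left _ _)] at this
    exact ⟨_, this⟩

section Decomposition

variable {V : Type*} [Fintype V]

/-- The square array `M` has all row and column sums equal to `H`. -/
def HasLineSums (H : ℕ) (M : V → V → ℕ) : Prop :=
  (∀ i, ∑ j, M i j = H) ∧ ∀ j, ∑ i, M i j = H

theorem HasLineSums.exists_perm {H : ℕ} {M : V → V → ℕ} (hM : HasLineSums H M) (hH : 0 < H) :
    ∃ σ : Equiv.Perm V, ∀ i, 0 < M i (σ i) := by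
  classical
  have hH' : (H : ℚ) ≠ 0 := by positivity
  have hds : (Matrix.of fun i j => (M i j : ℚ) / H) ∈ doublyStochastic ℚ V := by
    rw [mem_doublyStochastic_iff_sum]
    refine ⟨fun i j => by simp only [Matrix.of_apply]; positivity, fun i => ?_, fun j => ?_⟩
    · simp only [Matrix.of_apply]
      rw [← sum_div, ← Nat.cast_sum, hM.1, div_self hH']
    · simp only [Matrix.of_apply]
      rw [← sum_div, ← Nat.cast_sum, hM.2, div_self hH']
  obtain ⟨w, hw0, hw1, hw⟩ := exists_eq_sum_perm_of_mem_doublyStochastic hds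
  obtain ⟨σ, -, hσ⟩ : ∃ σ ∈ univ, w σ ≠ 0 := by
    by_contra! hcon
    rw [sum_eq_zero hcon] at hw1
    exact zero_ne_one hw1
  refine ⟨σ, fun i => Nat.pos_of_ne_zero fun h0 => hσ ?_⟩
  have h1 := congrFun (congrFun hw i) (σ i)
  rw [Matrix.sum_apply] at h1
  simp only [Matrix.of_apply, h0, Nat.cast_zero, zero_div, Matrix.smul_apply, smul_eq_mul] at h1
  rw [sum_eq_zero_iff_of_nonneg] at h1
  · have := h1 σ (mem_univ _)
    simpa [Equiv.Perm.permMatrix, PEquiv.toMatrix_apply] using this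
  · intro τ _
    refine mul_nonneg (hw0 τ) ?_
    simp only [Equiv.Perm.permMatrix, PEquiv.toMatrix_apply]
    split_ifs <;> norm_num

theorem HasLineSums.exists_add {H₁ : ℕ} : ∀ {H₂ : ℕ} {M : V → V → ℕ},
    HasLineSums (H₁ + H₂) M → ∃ A B : V → V → ℕ, HasLineSums H₁ A ∧ HasLineSums H₂ B ∧
      ∀ i j, M i j = A i j + B i j := by
  classical
  induction H₁ with
  | zero =>
    intro H₂ M hM
    rw [zero_add] at hM
    exact ⟨fun _ _ => 0, M, by simp [HasLineSums], hM, by simp⟩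
  | succ H₁ ih =>
    intro H₂ M hM
    obtain ⟨σ, hσ⟩ := hM.exists_perm (by omega)
    let P : V → V → ℕ := fun i j => if σ i = j then 1 else 0
    have hP : HasLineSums 1 P := by
      refine ⟨fun i => by simp [P], fun j => ?_⟩
      simp [P, ← Equiv.eq_symm_apply]
    have hle : ∀ i j, P i j ≤ M i j := by
      intro i j
      simp only [P]
      split_ifs with h
      · exact h ▸ hσ i
      · exact Nat.zero_le _
    have hM' : HasLineSums (H₁ + H₂) (fun i j => M i j - P i j) := by
      refine ⟨fun i => ?_, fun j => ?_⟩
      · rw [sum_tsub_distrib _ fun j _ => hle i j, hM.1, hP.1]; omega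
      · rw [sum_tsub_distrib _ fun i _ => hle i j, hM.2, hP.2]; omega
    obtain ⟨A, B, hA, hB, hAB⟩ := ih hM'
    refine ⟨fun i j => A i j + P i j, B, ?_, hB, fun i j => ?_⟩
    · refine ⟨fun i => ?_, fun j => ?_⟩
      · rw [sum_add_distrib, hA.1, hP.1]
      · rw [sum_add_distrib, hA.2, hP.2]
    · have := hAB i j
      have := hle i j
      dsimp only at *
      omega

theorem HasLineSums.exists_sum : ∀ {n : ℕ} {g : Fin n → ℕ} {M : V → V → ℕ},
    HasLineSums (∑ r, g r) M → ∃ A : Fin n → V → V → ℕ, (∀ r, HasLineSums (g r) (A r)) ∧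
      ∀ i j, ∑ r, A r i j = M i j := by
  intro n
  induction n with
  | zero =>
    intro g M hM
    refine ⟨fun _ _ _ => 0, fun r => r.elim0, fun i j => ?_⟩
    have := hM.1 i
    simp only [univ_eq_empty, sum_empty, sum_eq_zero_iff, mem_univ, true_imp_iff] at this
    simp [this j]
  | succ n ih =>
    intro g M hM
    rw [Fin.sum_univ_succ] at hM
    obtain ⟨A, B, hA, hB, hAB⟩ := hM.exists_add
    obtain ⟨C, hC, hCB⟩ := ih hB
    refine ⟨Fin.cons A C, fun r => ?_, fun i j => ?_⟩
    · refine Fin.cases ?_ (fun r => ?_) r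
      · exact hA
      · exact hC r
    · rw [Fin.sum_univ_succ]
      simp only [Fin.cons_zero, Fin.cons_succ, hCB, hAB]

end Decomposition

/-- An outline array given by the numbers `w i j l` of occurrences of the symbol `l` in the cell
`(i, j)`, indexed by any type equivalent to `Fin k`. -/
theorem exists_isOutlineArray_of_counts {k : ℕ} {ι : Type*} [Fintype ι] (e : ι ≃ Fin k)
    (F : Fin k → Fin k → ℕ) (w : ι → ι → ι → ℕ)
    (hcell : ∀ i j, ∑ l, w i j l = F (e i) (e j))
    (hrow : ∀ i l, ∑ j, w i j l = F (e i) (e l))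
    (hcol : ∀ j l, ∑ i, w i j l = F (e l) (e j)) :
    ∃ O : Fin k → Fin k → Multiset (Fin k), IsOutlineArray F O := by
  have hcount : ∀ i j l, Multiset.count l
      (∑ l', Multiset.replicate (w (e.symm i) (e.symm j) (e.symm l')) l') =
      w (e.symm i) (e.symm j) (e.symm l) := by
    intro i j l
    simp [Multiset.count_sum', Multiset.count_replicate]
  refine ⟨fun i j => ∑ l, Multiset.replicate (w (e.symm i) (e.symm j) (e.symm l)) l, ?_, ?_, ?_⟩
  · intro i j
    simp only [Multiset.card_sum, Multiset.card_replicate]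
    rw [e.symm.sum_comp (fun l => w _ _ l), hcell, e.apply_symm_apply, e.apply_symm_apply]
  · intro i l
    simp only [hcount]
    rw [e.symm.sum_comp (fun j => w _ j _), hrow, e.apply_symm_apply, e.apply_symm_apply]
  · intro j l
    simp only [hcount]
    rw [e.symm.sum_comp (fun i => w i _ _), hcol, e.apply_symm_apply, e.apply_symm_apply]

theorem le_ite_of_diag_eq_zero {V : Type*} [DecidableEq V] {a : ℕ} {Y : V → V → ℕ}
    (hdiag : ∀ i, Y i i = 0) (hle : ∀ i j, Y i j ≤ a) (i j : V) :
    Y i j ≤ if i = j then 0 else a := by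
  split_ifs with h
  · rw [h, hdiag]
  · exact hle i j

theorem hasLineSums_complement {V : Type*} [Fintype V] [DecidableEq V] {a H N : ℕ}
    {Y : V → V → ℕ} (hY : HasLineSums N Y) (hdiag : ∀ i, Y i i = 0) (hle : ∀ i j, Y i j ≤ a)
    (hN : N = (Fintype.card V - 1) * a - H) (hH : H ≤ (Fintype.card V - 1) * a) :
    HasLineSums H (fun i j => (if i = j then 0 else a) - Y i j) := by
  have hle' := le_ite_of_diag_eq_zero hdiag hle
  have hs : ∀ i : V, ∑ j, (if i = j then 0 else a) = (Fintype.card V - 1) * a := by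
    intro i
    rw [sum_ite, sum_const_zero, zero_add, sum_const, filter_ne, card_erase_of_mem (mem_univ i),
      card_univ, smul_eq_mul]
  refine ⟨fun i => ?_, fun j => ?_⟩
  · rw [sum_tsub_distrib _ fun j _ => hle' i j, hY.1, hs]; omega
  · rw [sum_tsub_distrib _ fun i _ => hle' i j, hY.2]
    simp only [eq_comm (b := j), hs]; omega

/-- Distributing a partial cube on `Fin m` and three decomposed complements over the triples with
at most one index outside `Fin m`. -/
def extendedCube {m n : ℕ} (x : Fin m → Fin m → Fin m → ℕ) (A B C : Fin n → Fin m → Fin m → ℕ) :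
    Fin m ⊕ Fin n → Fin m ⊕ Fin n → Fin m ⊕ Fin n → ℕ
  | .inl i, .inl j, .inl l => x i j l
  | .inl i, .inl j, .inr r => A r i j
  | .inl i, .inr r, .inl l => B r i l
  | .inr r, .inl j, .inl l => C r j l
  | _, _, _ => 0

/-- for `3 ≤ m ≤ k`, `h_m ≥ h_{m+1} ≥ … ≥ h_k > 0` with
`h_{m+2} + … + h_k ≤ (m−1) h_m + (m−2) h_{m+1}`, there exists an outline
array corresponding to the frequency array `F` of order `k` given by
`F(i,j) = 0` if `i = j`; `F(i,j) = h_m + h_{m+1}` if `i ≠ j` and `i, j ≤ m`;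
`F(i,j) = h_j` if `i ≤ m < j`; `F(i,j) = h_i` if `j ≤ m < i`; and
`F(i,j) = 0` otherwise.  (Row/column/symbol indices are 1-based in the paper,
0-based as elements of `Fin k` here, so index `i : Fin k` corresponds to
`(i : ℕ) + 1`.) -/
theorem statement8 (m k : ℕ) (h : ℕ → ℕ)
    (hm : 3 ≤ m) (hmk : m ≤ k)
    (hmono : ∀ i, m ≤ i → i < k → h (i + 1) ≤ h i)
    (hpos : ∀ i, m ≤ i → i ≤ k → 0 < h i)
    (hsum : ∑ i ∈ Finset.Icc (m + 2) k, h i ≤ (m - 1) * h m + (m - 2) * h (m + 1)) :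
    ∃ O : Fin k → Fin k → Multiset (Fin k),
      IsOutlineArray
        (fun i j : Fin k =>
          if i = j then 0
          else if (i : ℕ) + 1 ≤ m ∧ (j : ℕ) + 1 ≤ m then h m + h (m + 1)
          else if (i : ℕ) + 1 ≤ m then h ((j : ℕ) + 1)
          else if (j : ℕ) + 1 ≤ m then h ((i : ℕ) + 1)
          else 0) O := by
  obtain ⟨n, rfl⟩ := Nat.exists_eq_add_of_le hmk
  have hH : ∑ r : Fin n, h (m + r + 1) ≤ (m - 1) * (h m + h (m + 1)) := by
    rw [Fin.sum_univ_eq_sum_range (fun r => h (m + r + 1))]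
    rcases n with _ | n
    · simp
    · rw [Finset.sum_range_succ']
      have hI : ∑ i ∈ Finset.Icc (m + 2) (m + (n + 1)), h i
          = ∑ r ∈ Finset.range n, h (m + (r + 1) + 1) := by
        rw [← Finset.Ico_add_one_right_eq_Icc, Finset.sum_Ico_eq_sum_range]
        refine Finset.sum_congr (congrArg _ (by omega)) fun r _ => congrArg h (by omega)
      rw [hI] at hsum
      obtain ⟨p, rfl⟩ : ∃ p, m = p + 2 := ⟨m - 2, by omega⟩
      simp only [Nat.add_sub_cancel, show p + 2 - 1 = p + 1 by omega, add_zero] at hsum ⊢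
      linarith
  obtain ⟨x, hx⟩ := exists_isPartialCube hm (h m + h (m + 1))
    ((m - 1) * (h m + h (m + 1)) - ∑ r : Fin n, h (m + r + 1)) (Nat.sub_le _ _)
  have hcard : Fintype.card (Fin m) = m := Fintype.card_fin m
  have hxA : ∀ i, ∑ l, x i i l = 0 := fun i => by simp [hx.off_row_col]
  have hxB : ∀ i, ∑ j, x i j i = 0 := fun i => by simp [hx.off_row_sym]
  have hxC : ∀ j, ∑ i, x i j j = 0 := fun j => by simp [hx.off_col_sym]
  obtain ⟨A, hA, hA'⟩ := (hasLineSums_complement (H := ∑ r : Fin n, h (m + r + 1))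
    ⟨hx.plane_row, hx.plane_col⟩ hxA hx.line_sym (by rw [hcard]) (by rwa [hcard])).exists_sum
  obtain ⟨B, hB, hB'⟩ := (hasLineSums_complement (H := ∑ r : Fin n, h (m + r + 1))
    (Y := fun i l => ∑ j, x i j l)
    ⟨fun i => by rw [Finset.sum_comm]; exact hx.plane_row i, hx.plane_sym⟩
    hxB hx.line_col (by rw [hcard]) (by rwa [hcard])).exists_sum
  obtain ⟨C, hC, hC'⟩ := (hasLineSums_complement (H := ∑ r : Fin n, h (m + r + 1))
    (Y := fun j l => ∑ i, x i j l)
    ⟨fun j => by rw [Finset.sum_comm]; exact hx.plane_col j,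
      fun l => by rw [Finset.sum_comm]; exact hx.plane_sym l⟩
    hxC hx.line_row (by rw [hcard]) (by rwa [hcard])).exists_sum
  have hne : ∀ (i : Fin m) (r : Fin n), Fin.castAdd n i ≠ Fin.natAdd m r := by
    intro i r hir
    have := congrArg Fin.val hir
    simp only [Fin.val_castAdd, Fin.val_natAdd] at this
    omega
  refine exists_isOutlineArray_of_counts finSumFinEquiv _ (extendedCube x A B C) ?_ ?_ ?_
  · rintro (i | i) (j | j) <;>
      simp [extendedCube, Fintype.sum_sum_type, (hB _).1, (hC _).1, hA', hne, (hne _ _).symm]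
    exact add_tsub_cancel_of_le (le_ite_of_diag_eq_zero hxA hx.line_sym i j)
  · rintro (i | i) (l | l) <;>
      simp [extendedCube, Fintype.sum_sum_type, (hA _).1, (hC _).2, hB', hne, (hne _ _).symm]
    exact add_tsub_cancel_of_le
      (le_ite_of_diag_eq_zero (Y := fun i l => ∑ j, x i j l) hxB hx.line_col i l)
  · rintro (j | j) (l | l) <;>
      simp [extendedCube, Fintype.sum_sum_type, (hA _).2, (hB _).2, hC', hne, (hne _ _).symm]
    simp only [eq_comm (a := l)]
    exact add_tsub_cancel_of_le
      (le_ite_of_diag_eq_zero (Y := fun j l => ∑ i, x i j l) hxC hx.line_row j l)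
end

section
/- Let a > b > 0 and k > 4 be integers, and let u be an integer with 1 ≤ u ≤ k. Then a realization LS(a^u b^{k−u}) (of the partition with u parts equal to a and k−u parts equal to b) exists if and only if u ≥ 3, or 0 < u < 3 and a ≤ (k−2)b. -/
/-- A latin square of order `n`: an `n × n` array with symbols from a set of
size `n` (encoded as `Fin n`) such that every symbol occurs exactly once in
every row and every column. -/
def IsLatinSquare {n : ℕ} (L : Fin n → Fin n → Fin n) : Prop :=
  (∀ i, Function.Bijective fun j => L i j) ∧ (∀ j, Function.Bijective fun i => L i j)

/-- `L` has pairwise disjoint subsquares of orders `h 0, …, h (k-1)`: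
for each `i` there are sets `R i` of rows, `C i` of columns and `S i` of
symbols, each of size `h i`, pairwise disjoint (no shared rows, columns or
symbols), such that the subarray on rows `R i` and columns `C i` only uses
the symbols `S i` (given that `L` is a latin square, this subarray is then
itself a latin square of order `h i` on the symbol set `S i`). -/
def HasDisjointSubsquares {n k : ℕ} (L : Fin n → Fin n → Fin n) (h : Fin k → ℕ) : Prop :=
  ∃ R C S : Fin k → Finset (Fin n),
    (∀ i, (R i).card = h i) ∧ (∀ i, (C i).card = h i) ∧ (∀ i, (S i).card = h i) ∧
    (∀ i j, i ≠ j → Disjoint (R i) (R j)) ∧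
    (∀ i j, i ≠ j → Disjoint (C i) (C j)) ∧
    (∀ i j, i ≠ j → Disjoint (S i) (S j)) ∧
    (∀ i, ∀ x ∈ R i, ∀ y ∈ C i, L x y ∈ S i)

/-- An incomplete latin square `ILS(n; h_1 … h_k)`: a latin square of order `n`
with pairwise disjoint subsquares of orders `h_1, …, h_k`. -/
def HasILS (n : ℕ) {k : ℕ} (h : Fin k → ℕ) : Prop :=
  ∃ L : Fin n → Fin n → Fin n, IsLatinSquare L ∧ HasDisjointSubsquares L h

/-- A realization of the partition `(h_1 … h_k)` of `n = h_1 + … + h_k`: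
a latin square of order `n` with pairwise disjoint subsquares of orders
`h_1, …, h_k`. -/
def HasRealization {k : ℕ} (h : Fin k → ℕ) : Prop :=
  HasILS (∑ i, h i) h

namespace OutlineArray

open Finset

/-- Two labellings of a finite set of edges whose fibres all have the same positive size admit a
common transversal: this is Hall's theorem for regular bipartite multigraphs. -/
theorem exists_common_transversal {E L R : Type*} [Fintype E] [Fintype L] [Fintype R]
    [DecidableEq L] [DecidableEq R] (f : E → L) (g : E → R) {u : ℕ} (hu : 0 < u)
    (hf : ∀ l, #{e | f e = l} = u) (hg : ∀ r, #{e | g e = r} = u) :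
    ∃ s : L → E, (∀ l, f (s l) = l) ∧ Function.Bijective fun l => g (s l) := by
  classical
  have hcount : ∀ S : Finset L, #{e | f e ∈ S} = u * #S := fun S => by
    rw [card_eq_sum_card_fiberwise (f := f) (t := S) (fun e he => by simpa using he)]
    rw [sum_congr rfl (g := fun _ => u), sum_const, smul_eq_mul, mul_comm]
    intro l hl
    rw [← hf l]
    congr 1
    ext e
    simp only [mem_filter, mem_univ, true_and]
    exact ⟨fun h => h.2, fun h => ⟨h ▸ hl, h⟩⟩
  have hcount' : ∀ S : Finset R, #{e | g e ∈ S} = u * #S := fun S => by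
    rw [card_eq_sum_card_fiberwise (f := g) (t := S) (fun e he => by simpa using he)]
    rw [sum_congr rfl (g := fun _ => u), sum_const, smul_eq_mul, mul_comm]
    intro l hl
    rw [← hg l]
    congr 1
    ext e
    simp only [mem_filter, mem_univ, true_and]
    exact ⟨fun h => h.2, fun h => ⟨h ▸ hl, h⟩⟩
  obtain ⟨φ, hφ, hmem⟩ := (Finset.all_card_le_biUnion_card_iff_exists_injective
    (fun l : L => (univ.filter (f · = l)).image g)).1 (fun S => by
      refine Nat.le_of_mul_le_mul_left (c := u) ?_ hu
      rw [← hcount, ← hcount']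
      refine card_le_card fun e he => ?_
      simp only [mem_filter, mem_univ, true_and, mem_biUnion, mem_image] at he ⊢
      exact ⟨f e, he, e, rfl, rfl⟩)
  simp only [mem_image, mem_filter, mem_univ, true_and] at hmem
  choose s hs using hmem
  refine ⟨s, fun l => (hs l).1, ?_⟩
  have hφ' : (fun l => g (s l)) = φ := funext fun l => (hs l).2
  rw [hφ']
  refine (Fintype.bijective_iff_injective_and_card φ).2 ⟨hφ, ?_⟩
  have h1 := hcount univ
  have h2 := hcount' univ
  simp only [mem_univ, filter_true, card_univ] at h1 h2
  exact Nat.eq_of_mul_eq_mul_left hu (h1.symm.trans h2)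

/-- A labelling with fibres of sizes `u * q j` refines to one with all fibres of size `u`. -/
theorem exists_refined_labelling {E J : Type*} [Fintype E] [DecidableEq J]
    (ρ : E → J) (u : ℕ) (q : J → ℕ) (h : ∀ j, #{e | ρ e = j} = u * q j) :
    ∃ F : E → Σ j, Fin (q j), (∀ e, (F e).1 = ρ e) ∧ ∀ l, #{e | F e = l} = u := by
  classical
  have hcard : ∀ j, Fintype.card {e // ρ e = j} = Fintype.card (Fin (q j) × Fin u) := fun j => by
    rw [Fintype.card_subtype, h j]
    simp [mul_comm]
  have φ : ∀ j, {e // ρ e = j} ≃ Fin (q j) × Fin u := fun j => Fintype.equivOfCardEq (hcard j)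
  refine ⟨fun e => ⟨ρ e, (φ (ρ e) ⟨e, rfl⟩).1⟩, fun e => rfl, ?_⟩
  rintro ⟨j, a⟩
  have key : ∀ e, ((⟨ρ e, (φ (ρ e) ⟨e, rfl⟩).1⟩ : Σ j, Fin (q j)) = ⟨j, a⟩) ↔
      ∃ b : Fin u, ((φ j).symm (a, b)).1 = e := fun e => by
    constructor
    · rintro h
      obtain ⟨h1, h2⟩ := Sigma.mk.inj_iff.1 h
      subst h1
      obtain rfl := eq_of_heq h2
      exact ⟨(φ (ρ e) ⟨e, rfl⟩).2, by simp⟩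
    · rintro ⟨b, rfl⟩
      obtain ⟨e, rfl⟩ : ∃ e, (φ j).symm (a, b) = e := ⟨_, rfl⟩
      generalize hx : (φ j).symm (a, b) = x
      obtain ⟨e, rfl⟩ := x
      rw [Equiv.symm_apply_eq] at hx
      simp [← hx]
  simp_rw [key]
  have : (univ.filter fun e => ∃ b : Fin u, ((φ j).symm (a, b)).1 = e) =
      univ.image fun b : Fin u => ((φ j).symm (a, b)).1 := by
    ext e
    simp
  rw [this, card_image_of_injective, card_univ, Fintype.card_fin]
  intro b b' hb
  simpa using Subtype.ext hb

/-- A matrix whose line sums are divisible by `u` dominates one with line sums divided by `u`. -/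
theorem exists_le_of_line_sums {J K : Type*} [Fintype J] [Fintype K] [DecidableEq J]
    [DecidableEq K] (M : J → K → ℕ) {u : ℕ} (hu : 0 < u) (q : J → ℕ) (r : K → ℕ)
    (hq : ∀ j, ∑ k, M j k = u * q j) (hr : ∀ k, ∑ j, M j k = u * r k) :
    ∃ N : J → K → ℕ, (∀ j k, N j k ≤ M j k) ∧ (∀ j, ∑ k, N j k = q j) ∧
      ∀ k, ∑ j, N j k = r k := by
  classical
  let E := Σ x : J × K, Fin (M x.1 x.2)
  have hE : ∀ p : J × K → Prop, [DecidablePred p] →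
      #{e : E | p e.1} = ∑ x with p x, M x.1 x.2 := fun p _ => by
    have : (univ.filter fun e : E => p e.1) = (univ.filter p).sigma fun _ => univ := by
      ext e; rw [Finset.mem_sigma]; simp
    rw [this, card_sigma]
    simp
  have hrow : ∀ j, #{e : E | e.1.1 = j} = u * q j := fun j => by
    rw [hE fun x => x.1 = j, ← hq j, sum_filter, Fintype.sum_prod_type, sum_eq_single j]
    · simp
    · intro b _ hb; simp [hb]
    · simp
  have hcol : ∀ k, #{e : E | e.1.2 = k} = u * r k := fun k => by
    rw [hE fun x => x.2 = k, ← hr k, sum_filter, Fintype.sum_prod_type_right, sum_eq_single k]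
    · simp
    · intro b _ hb; simp [hb]
    · simp
  obtain ⟨F, hF, hF'⟩ := exists_refined_labelling (fun e : E => e.1.1) u q hrow
  obtain ⟨G, hG, hG'⟩ := exists_refined_labelling (fun e : E => e.1.2) u r hcol
  obtain ⟨s, hs, hb⟩ := exists_common_transversal F G hu hF' hG'
  have hs1 : ∀ l, (s l).1.1 = l.1 := fun l => by rw [← hF, hs]
  refine ⟨fun j k => #{l | (s l).1 = (j, k)}, fun j k => ?_, fun j => ?_, fun k => ?_⟩
  · have hle : #{l | (s l).1 = (j, k)} ≤ #{e : E | e.1 = (j, k)} :=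
      card_le_card_of_injOn s (fun l hl => by simpa using hl)
        ((Function.LeftInverse.injective hs).injOn)
    rw [hE fun x => x = (j, k)] at hle
    simpa [filter_eq'] using hle
  · rw [← card_eq_sum_card_fiberwise (s := univ.filter fun l => (s l).1.1 = j)
      (f := fun l => (s l).1.2) (t := univ) (by simp) |>.trans (sum_congr rfl fun k _ => by
        rw [filter_filter]; congr 1; ext l; simp [Prod.ext_iff])]
    simp_rw [hs1]
    have : (univ.filter fun l : Σ j, Fin (q j) => l.1 = j) =
        ({j} : Finset J).sigma fun _ => univ := by ext l; simp
    rw [this, card_sigma]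
    simp
  · rw [← card_eq_sum_card_fiberwise (s := univ.filter fun l => (s l).1.2 = k)
      (f := fun l => (s l).1.1) (t := univ) (by simp) |>.trans (sum_congr rfl fun j _ => by
        rw [filter_filter]; congr 1; ext l; simp [Prod.ext_iff, and_comm])]
    have h1 : #{l | (s l).1.2 = k} = #{m : Σ k, Fin (r k) | m.1 = k} := by
      refine card_bijective _ hb fun l => ?_
      simp [← hG]
    have : (univ.filter fun l : Σ k, Fin (r k) => l.1 = k) =
        ({k} : Finset K).sigma fun _ => univ := by ext l; simp
    rw [h1, this, card_sigma]
    simp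

/-- A matrix whose line sums are divisible by the size of `T` is a sum, indexed by `T`, of
matrices with equal line sums. -/
theorem exists_sum_decomposition {S J K : Type*} [DecidableEq S] [Fintype J] [Fintype K]
    [DecidableEq J] [DecidableEq K] (q : J → ℕ) (r : K → ℕ) (T : Finset S) :
    ∀ M : J → K → ℕ, (∀ j, ∑ k, M j k = #T * q j) → (∀ k, ∑ j, M j k = #T * r k) →
      ∃ N : S → J → K → ℕ, (∀ j k, ∑ s ∈ T, N s j k = M j k) ∧
        (∀ s ∈ T, ∀ j, ∑ k, N s j k = q j) ∧ ∀ s ∈ T, ∀ k, ∑ j, N s j k = r k := by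
  induction T using Finset.induction_on with
  | empty =>
    intro M hq _
    refine ⟨fun _ _ _ => 0, fun j k => ?_, by simp, by simp⟩
    have := hq j
    simp only [card_empty, zero_mul, sum_eq_zero_iff, mem_univ, true_imp_iff] at this
    simp [this k]
  | insert a T ha ih =>
    intro M hq hr
    rw [card_insert_of_notMem ha] at hq hr
    obtain ⟨N₀, hle, h1, h2⟩ := exists_le_of_line_sums M (Nat.succ_pos _) q r hq hr
    obtain ⟨N, hN, hN1, hN2⟩ := ih (fun j k => M j k - N₀ j k)
      (fun j => by
        rw [sum_tsub_distrib _ fun k _ => hle j k, hq, h1, add_mul, one_mul, Nat.add_sub_cancel])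
      (fun k => by
        rw [sum_tsub_distrib _ fun j _ => hle j k, hr, h2, add_mul, one_mul, Nat.add_sub_cancel])
    have hne : ∀ s ∈ T, s ≠ a := fun s hs h => ha (h ▸ hs)
    refine ⟨Function.update N a N₀, fun j k => ?_, fun s hs => ?_, fun s hs => ?_⟩
    · rw [sum_insert ha, Function.update_self, sum_congr rfl fun s hs => by
        rw [Function.update_of_ne (hne s hs)], hN, Nat.add_sub_cancel' (hle j k)]
    · rcases mem_insert.1 hs with rfl | hs
      · simpa using h1
      · rw [Function.update_of_ne (hne s hs)]
        exact hN1 s hs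
    · rcases mem_insert.1 hs with rfl | hs
      · simpa using h2
      · rw [Function.update_of_ne (hne s hs)]
        exact hN2 s hs

/-- There is a three-dimensional array of natural numbers supported in `S` whose sums along lines
in the third, second and first direction are given by `P`, `Q` and `R`. -/
def HasArray {I J K : Type*} [Fintype I] [Fintype J] [Fintype K] (S : I → J → K → Prop)
    (P : I → J → ℕ) (Q : I → K → ℕ) (R : J → K → ℕ) : Prop :=
  ∃ x : I → J → K → ℕ, (∀ i j k, x i j k ≠ 0 → S i j k) ∧ (∀ i j, ∑ k, x i j k = P i j) ∧
    (∀ i k, ∑ j, x i j k = Q i k) ∧ ∀ j k, ∑ i, x i j k = R j k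

theorem HasArray.rotate {I J K : Type*} [Fintype I] [Fintype J] [Fintype K]
    {S : I → J → K → Prop} {P : I → J → ℕ} {Q : I → K → ℕ} {R : J → K → ℕ}
    (h : HasArray S P Q R) :
    HasArray (fun j k i => S i j k) R (fun j i => P i j) (fun k i => Q i k) := by
  obtain ⟨x, h0, h1, h2, h3⟩ := h
  exact ⟨fun j k i => x i j k, fun j k i => h0 i j k, h3, fun j i => h1 i j, fun k i => h2 i k⟩

/-- The size of the fibre of `f` over `i`. -/
def fibreCard {I' I : Type*} [Fintype I'] [DecidableEq I] (f : I' → I) (i : I) : ℕ :=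
  #{i' | f i' = i}

theorem HasArray.splitFirst {I I' J K : Type*} [Fintype I] [Fintype I'] [Fintype J] [Fintype K]
    [DecidableEq I] [DecidableEq I'] [DecidableEq J] [DecidableEq K] (f : I' → I)
    {S : I → J → K → Prop} {P : I → J → ℕ} {Q : I → K → ℕ} {R : J → K → ℕ}
    (h : HasArray S (fun i j => fibreCard f i * P i j) (fun i k => fibreCard f i * Q i k) R) :
    HasArray (fun i' => S (f i')) (fun i' => P (f i')) (fun i' => Q (f i')) R := by
  obtain ⟨x, h0, h1, h2, h3⟩ := h
  have key := fun i => exists_sum_decomposition (P i) (Q i) (univ.filter fun i' => f i' = i) (x i)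
    (h1 i) (h2 i)
  choose N hN hN1 hN2 using key
  refine ⟨fun i' => N (f i') i', fun i' j k hne => h0 _ _ _ fun hx => hne ?_,
    fun i' j => hN1 _ _ (by simp) _, fun i' k => hN2 _ _ (by simp) _, fun j k => ?_⟩
  · have := hN (f i') j k
    rw [hx, sum_eq_zero_iff] at this
    exact this i' (by simp)
  · rw [← h3, ← sum_fiberwise (s := univ) (g := f)]
    refine sum_congr rfl fun i _ => ?_
    rw [← hN]
    refine sum_congr rfl fun i' hmem => ?_
    simp only [(mem_filter.1 hmem).2]

/-- Splitting points: an array whose line sums are multiplied by the fibre sizes of `f` refines to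
an array with line sums pulled back along `f`. -/
theorem HasArray.split {I J : Type*} [Fintype I] [Fintype J] [DecidableEq I] [DecidableEq J]
    (f : J → I) {S : I → I → I → Prop} {p : I → I → ℕ}
    (h : HasArray S (fun i j => fibreCard f i * fibreCard f j * p i j)
      (fun i j => fibreCard f i * fibreCard f j * p i j)
      (fun i j => fibreCard f i * fibreCard f j * p i j)) :
    HasArray (fun i j k => S (f i) (f j) (f k)) (fun i j => p (f i) (f j))
      (fun i j => p (f i) (f j)) (fun i j => p (f i) (f j)) := by
  have h1 := HasArray.splitFirst (I := I) (J := I) (K := I) f (S := S)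
    (P := fun i j => fibreCard f j * p i j) (Q := fun i j => fibreCard f j * p i j)
    (R := fun i j => fibreCard f i * fibreCard f j * p i j) (by
      simpa only [mul_assoc] using h)
  have h2 := HasArray.splitFirst f (P := fun i j => fibreCard f j * p i j)
    (Q := fun j i' => p (f i') j) (by simpa only [mul_assoc] using h1.rotate)
  exact (HasArray.splitFirst f (P := fun k i' => p (f i') k)
    (Q := fun k j' => p (f j') k) h2.rotate).rotate

/-- An array with all three families of line sums given by `p`. -/
def HasOutline {I : Type*} [Fintype I] (p : I → I → ℕ) : Prop :=
  HasArray (fun _ _ _ => True) p p p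

theorem HasArray.add {I J K : Type*} [Fintype I] [Fintype J] [Fintype K]
    {S S' : I → J → K → Prop} {P P' : I → J → ℕ} {Q Q' : I → K → ℕ} {R R' : J → K → ℕ}
    (h : HasArray S P Q R) (h' : HasArray S' P' Q' R') :
    HasArray (fun i j k => S i j k ∨ S' i j k) (P + P') (Q + Q') (R + R') := by
  obtain ⟨x, h0, h1, h2, h3⟩ := h
  obtain ⟨y, g0, g1, g2, g3⟩ := h'
  refine ⟨fun i j k => x i j k + y i j k, fun i j k hne => ?_, fun i j => ?_, fun i j => ?_,
    fun i j => ?_⟩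
  · by_cases hx : x i j k = 0
    · exact Or.inr (g0 _ _ _ fun hy => hne (by simp [hx, hy]))
    · exact Or.inl (h0 _ _ _ hx)
  · simp [sum_add_distrib, h1, g1]
  · simp [sum_add_distrib, h2, g2]
  · simp [sum_add_distrib, h3, g3]

theorem HasArray.toOutline {I : Type*} [Fintype I] {S : I → I → I → Prop} {P Q R p : I → I → ℕ}
    (h : HasArray S P Q R) (hP : ∀ i j, P i j = p i j) (hQ : ∀ i j, Q i j = p i j)
    (hR : ∀ i j, R i j = p i j) : HasOutline p := by
  obtain ⟨x, -, h1, h2, h3⟩ := h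
  exact ⟨x, fun _ _ _ _ => trivial, fun i j => (h1 i j).trans (hP i j),
    fun i j => (h2 i j).trans (hQ i j), fun i j => (h3 i j).trans (hR i j)⟩

theorem HasOutline.congr {I : Type*} [Fintype I] {p q : I → I → ℕ} (h : HasOutline p)
    (hpq : ∀ i j, p i j = q i j) : HasOutline q :=
  h.toOutline hpq hpq hpq

theorem HasOutline.add {I : Type*} [Fintype I] {p q : I → I → ℕ} (h : HasOutline p)
    (h' : HasOutline q) : HasOutline (fun i j => p i j + q i j) :=
  (HasArray.add h h').toOutline (fun _ _ => rfl) (fun _ _ => rfl) (fun _ _ => rfl)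

theorem HasOutline.zero {I : Type*} [Fintype I] : HasOutline (fun _ _ : I => 0) :=
  ⟨fun _ _ _ => 0, by simp, by simp, by simp, by simp⟩

theorem HasOutline.mul {I : Type*} [Fintype I] {p : I → I → ℕ} (c : ℕ) (h : HasOutline p) :
    HasOutline (fun i j => c * p i j) := by
  obtain ⟨x, -, h1, h2, h3⟩ := h
  exact ⟨fun i j k => c * x i j k, fun _ _ _ _ => trivial, by simp [← mul_sum, h1],
    by simp [← mul_sum, h2], by simp [← mul_sum, h3]⟩

theorem HasOutline.split {I J : Type*} [Fintype I] [Fintype J] [DecidableEq I] [DecidableEq J]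
    (f : J → I) {p : I → I → ℕ}
    (h : HasOutline fun i j => fibreCard f i * fibreCard f j * p i j) :
    HasOutline fun i j => p (f i) (f j) :=
  HasArray.split f h

theorem fibreCard_equiv {I J : Type*} [Fintype J] [DecidableEq I] (e : J ≃ I) (i : I) :
    fibreCard e i = 1 := by
  classical
  rw [fibreCard, card_eq_one]
  exact ⟨e.symm i, by ext j; simp [Equiv.eq_symm_apply]⟩

theorem HasOutline.equiv {I J : Type*} [Fintype I] [Fintype J] [DecidableEq I] [DecidableEq J]
    (e : J ≃ I) {p : I → I → ℕ} (h : HasOutline p) : HasOutline fun i j => p (e i) (e j) :=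
  HasOutline.split e (h.congr fun i j => by simp [fibreCard_equiv])

/-- Extension by zero from the second summand. -/
theorem HasOutline.extend {I J : Type*} [Fintype I] [Fintype J] {p : J → J → ℕ}
    (h : HasOutline p) : HasOutline (I := I ⊕ J)
      (Sum.elim (fun _ _ => 0) fun i => Sum.elim (fun _ => 0) (p i)) := by
  obtain ⟨x, -, h1, h2, h3⟩ := h
  refine ⟨Sum.elim (fun _ _ _ => 0) fun i => Sum.elim (fun _ _ => 0) fun j =>
    Sum.elim (fun _ => 0) (x i j), fun _ _ _ _ => trivial, ?_, ?_, ?_⟩ <;>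
  · rintro (i | i) (j | j) <;> simp [h1, h2, h3]

theorem eq_of_sum_eq_one {J : Type*} [Fintype J] {y : J → ℕ} (h : ∑ j, y j = 1) {j j' : J}
    (hj : y j ≠ 0) (hj' : y j' ≠ 0) : j = j' := by
  classical
  by_contra hne
  have h1 := sum_le_sum_of_subset (f := y) (subset_univ {j, j'})
  rw [sum_pair hne, h] at h1
  omega

theorem HasArray.exists_latin {J : Type*} [Fintype J] {S : J → J → J → Prop}
    (h : HasArray S (fun _ _ => 1) (fun _ _ => 1) fun _ _ => 1) :
    ∃ ℓ : J → J → J, (∀ i, Function.Bijective (ℓ i)) ∧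
      (∀ j, Function.Bijective fun i => ℓ i j) ∧ ∀ i j, S i j (ℓ i j) := by
  obtain ⟨x, h0, h1, h2, h3⟩ := h
  have hex : ∀ i j, ∃ k, x i j k ≠ 0 := fun i j => by
    obtain ⟨k, -, hk⟩ := exists_ne_zero_of_sum_ne_zero ((h1 i j).trans_ne one_ne_zero)
    exact ⟨k, hk⟩
  choose ℓ hℓ using hex
  refine ⟨ℓ, fun i => Finite.injective_iff_bijective.1 fun j j' hj => ?_,
    fun j => Finite.injective_iff_bijective.1 fun i i' hi => ?_, fun i j => h0 _ _ _ (hℓ i j)⟩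
  · exact eq_of_sum_eq_one (h2 i (ℓ i j)) (hℓ i j) (by rw [hj]; exact hℓ i j')
  · exact eq_of_sum_eq_one (h3 j (ℓ i j)) (hℓ i j) (by rw [hi]; exact hℓ _ j)

/-- An array with line sums `h i * h j` off the diagonal yields a realization of `h`. -/
theorem HasOutline.hasRealization {k : ℕ} (h : Fin k → ℕ)
    (hp : HasOutline fun i j : Fin k => if i = j then 0 else h i * h j) : HasRealization h := by
  classical
  obtain ⟨x, -, h1, h2, h3⟩ := hp
  simp only at h1 h2 h3
  have z1 : ∀ i l, x i i l = 0 := fun i l => by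
    have := h1 i i
    rw [if_pos rfl, sum_eq_zero_iff] at this
    exact this l (mem_univ _)
  have hfib : ∀ i, fibreCard (Sigma.fst : (Σ i, Fin (h i)) → Fin k) i = h i := fun i => by
    have : (univ.filter fun l : Σ i, Fin (h i) => l.1 = i) =
        ({i} : Finset (Fin k)).sigma fun _ => univ := by ext l; simp
    rw [fibreCard, this, card_sigma]
    simp
  have hdiag : HasArray (fun i j l : Fin k => i = j → l = i) (fun i j => h i * h j * 1)
      (fun i j => h i * h j * 1) (fun i j => h i * h j * 1) := by
    refine ⟨fun i j l => x i j l + if i = j ∧ l = i then h i * h i else 0, ?_, ?_, ?_, ?_⟩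
    · rintro i j l hne rfl
      by_contra hl
      simp [z1, hl] at hne
    · intro i j
      rw [sum_add_distrib, h1]
      by_cases hij : i = j
      · subst hij; simp
      · simp [hij]
    · intro i j
      rw [sum_add_distrib, h2]
      by_cases hij : i = j
      · subst hij; simp
      · simp [hij, Ne.symm hij]
    · intro i j
      rw [sum_add_distrib, h3, sum_eq_single i]
      · by_cases hij : i = j
        · subst hij; simp
        · simp [hij, Ne.symm hij]
      · intro b _ hb; simp [hb]
      · simp
  obtain ⟨ℓ, hrow, hcol, hS⟩ := (HasArray.split (Sigma.fst : (Σ i, Fin (h i)) → Fin k)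
    (p := fun _ _ => 1) (by simpa only [hfib] using hdiag)).exists_latin
  let e : (Σ i, Fin (h i)) ≃ Fin (∑ i, h i) := finSigmaFinEquiv
  have hcard : ∀ i, #{a | (e.symm a).1 = i} = h i := fun i => by
    rw [← hfib i, fibreCard]
    exact card_bijective e.symm e.symm.bijective (by simp)
  have hdisj : ∀ i j, i ≠ j →
      Disjoint (univ.filter fun a => (e.symm a).1 = i) (univ.filter fun a => (e.symm a).1 = j) :=
    fun i j hij => disjoint_filter.2 fun a _ hi hj => hij (hi.symm.trans hj)
  refine ⟨fun a b => e (ℓ (e.symm a) (e.symm b)),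
    ⟨fun a => e.bijective.comp ((hrow _).comp e.symm.bijective),
      fun b => e.bijective.comp ((hcol _).comp e.symm.bijective)⟩,
    fun i => {a | (e.symm a).1 = i}, fun i => {a | (e.symm a).1 = i},
    fun i => {a | (e.symm a).1 = i}, hcard, hcard, hcard, hdisj, hdisj, hdisj, ?_⟩
  intro i a ha b hb
  simp only [mem_filter, mem_univ, true_and, Equiv.symm_apply_apply] at ha hb ⊢
  exact (hS _ _ (ha.trans hb.symm)).trans ha

/-- In a realization, two distinct parts `h i` and `h j > 0` satisfy `2 * h i + h j ≤ n`. -/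
theorem two_mul_add_le_of_hasRealization {k : ℕ} {h : Fin k → ℕ} (H : HasRealization h)
    {i j : Fin k} (hij : i ≠ j) (hj : 0 < h j) : h i + h i + h j ≤ ∑ l, h l := by
  classical
  obtain ⟨L, ⟨hrow, hcol⟩, R, C, S, hR, hC, hS, dR, dC, dS, hsub⟩ := H
  obtain ⟨x, hx⟩ : (R j).Nonempty := card_pos.1 (by rw [hR]; exact hj)
  have hinj : ∀ x, Function.Injective fun y => L x y := fun x => (hrow x).1
  have hrowS : (C j).image (L x) = S j :=
    eq_of_subset_of_card_le (image_subset_iff.2 fun y hy => hsub j x hx y hy)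
      (by rw [card_image_of_injective _ (hinj x), hC, hS])
  have hcolS : ∀ y ∈ C i, (R i).image (fun x => L x y) = S i := fun y hy =>
    eq_of_subset_of_card_le (image_subset_iff.2 fun x hx => hsub i x hx y hy)
      (by rw [card_image_of_injective _ (hcol y).1, hR, hS])
  have d1 : Disjoint ((C i).image (L x)) (S i) := by
    rw [disjoint_left]
    intro s hs hsi
    obtain ⟨y, hy, rfl⟩ := mem_image.1 hs
    rw [← hcolS y hy] at hsi
    obtain ⟨x', hx', he⟩ := mem_image.1 hsi
    exact disjoint_left.1 (dR i j hij) hx' ((hcol y).1 he ▸ hx)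
  have d2 : Disjoint ((C i).image (L x)) (S j) := by
    rw [disjoint_left]
    intro s hs hsj
    obtain ⟨y, hy, rfl⟩ := mem_image.1 hs
    rw [← hrowS] at hsj
    obtain ⟨y', hy', he⟩ := mem_image.1 hsj
    exact disjoint_left.1 (dC i j hij) hy ((hrow x).1 he ▸ hy')
  have := card_le_univ (((C i).image (L x)) ∪ S i ∪ S j)
  rwa [card_union_of_disjoint (disjoint_union_left.2 ⟨d2, dS i j hij⟩),
    card_union_of_disjoint d1, card_image_of_injective _ (hinj x), hC, hS, hS,
    Fintype.card_fin] at this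

/-- Line sums for two types of points: `s` between points of the first type, `r` between points of
the second type, and `t` between points of different types. -/
def profile {A B : Type*} [DecidableEq A] [DecidableEq B] (s t r : ℕ) : A ⊕ B → A ⊕ B → ℕ :=
  Sum.elim (fun a => Sum.elim (fun a' => if a = a' then 0 else s) fun _ => t)
    fun b => Sum.elim (fun _ => t) fun b' => if b = b' then 0 else r

/-- Existence of an array with the line sums of `profile s t r`. -/
def TwoType (A B : Type*) [Fintype A] [Fintype B] [DecidableEq A] [DecidableEq B]
    (s t r : ℕ) : Prop :=
  HasOutline (profile (A := A) (B := B) s t r)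

section TwoType

variable {A B A' B' : Type*} [Fintype A] [Fintype B] [DecidableEq A] [DecidableEq B]
  [Fintype A'] [Fintype B'] [DecidableEq A'] [DecidableEq B']

theorem TwoType.add {s t r s' t' r' : ℕ} (h : TwoType A B s t r) (h' : TwoType A B s' t' r') :
    TwoType A B (s + s') (t + t') (r + r') := by
  refine (HasOutline.add h h').congr ?_
  rintro (i | i) (j | j) <;> simp only [profile, Sum.elim_inl, Sum.elim_inr]
  all_goals split_ifs <;> rfl

theorem TwoType.mul {s t r : ℕ} (c : ℕ) (h : TwoType A B s t r) :
    TwoType A B (c * s) (c * t) (c * r) := by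
  refine (HasOutline.mul c h).congr ?_
  rintro (i | i) (j | j) <;> simp [profile]

theorem TwoType.symm {s t r : ℕ} (h : TwoType A B s t r) : TwoType B A r t s := by
  refine (HasOutline.equiv (Equiv.sumComm B A) h).congr ?_
  rintro (i | i) (j | j) <;> simp [profile]

theorem TwoType.equiv {s t r : ℕ} (e : A' ≃ A) (e' : B' ≃ B) (h : TwoType A B s t r) :
    TwoType A' B' s t r := by
  refine (HasOutline.equiv (Equiv.sumCongr e e') h).congr ?_
  rintro (i | i) (j | j) <;> simp [profile]

theorem TwoType.of_subsingleton_left [Subsingleton A] {s t r : ℕ} (s' : ℕ)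
    (h : TwoType A B s t r) : TwoType A B s' t r := by
  refine HasOutline.congr h ?_
  rintro (i | i) (j | j)
  · simp [profile, Subsingleton.elim i j]
  all_goals simp [profile]

end TwoType

/-- An idempotent latin square on `B`. -/
structure IsIdempotentLatin {B : Type*} (L : B → B → B) : Prop where
  idem : ∀ i, L i i = i
  row : ∀ i, Function.Injective (L i)
  col : ∀ j, Function.Injective fun i => L i j

section Latin

variable {B : Type*} [Fintype B] [DecidableEq B] {L : B → B → B}

theorem IsIdempotentLatin.sum_row (hL : IsIdempotentLatin L) (i l : B) :
    (∑ j, if L i j = l then (if i = j then 0 else 1) else 0) = if i = l then 0 else 1 := by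
  obtain ⟨j, rfl⟩ := (Finite.injective_iff_surjective.1 (hL.row i)) l
  rw [sum_eq_single j]
  · have : i = L i j ↔ i = j :=
      ⟨fun h => hL.row i ((hL.idem i).trans h), fun h => by rw [← h, hL.idem]⟩
    simp [this]
  · intro j' _ hj'
    rw [if_neg fun h => hj' (hL.row i h)]
  · simp

theorem IsIdempotentLatin.sum_col (hL : IsIdempotentLatin L) (j l : B) :
    (∑ i, if L i j = l then (if i = j then 0 else 1) else 0) = if j = l then 0 else 1 := by
  obtain ⟨i, rfl⟩ := (Finite.injective_iff_surjective.1 (hL.col j)) l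
  simp only
  rw [sum_eq_single i]
  · have : j = L i j ↔ i = j :=
      ⟨fun h => hL.col j (h.symm.trans (hL.idem j).symm), fun h => by rw [h, hL.idem]⟩
    simp [this]
  · intro i' _ hi'
    rw [if_neg fun h => hi' (hL.col j h)]
  · simp

/-- Replacing the cells of an idempotent latin square selected by `y` with triples through new
points. -/
theorem IsIdempotentLatin.hasArray {A : Type*} [Fintype A] [DecidableEq A]
    (hL : IsIdempotentLatin L) (y : A → B → B → ℕ) (z : B → B → ℕ)
    (hy : ∀ i j, z i j + ∑ a, y a i j = if i = j then 0 else 1) (σ τ : Equiv.Perm A) :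
    HasArray (I := A ⊕ B) (J := A ⊕ B) (K := A ⊕ B) (fun _ _ _ => True)
      (Sum.elim (fun a => Sum.elim (fun _ => 0) fun j => ∑ i, y (τ a) i j)
        fun i => Sum.elim (fun a => ∑ j, y (σ a) i j) fun j => if i = j then 0 else 1)
      (Sum.elim (fun a => Sum.elim (fun _ => 0)
          fun l => ∑ j, ∑ i, if L i j = l then y (τ a) i j else 0)
        fun i => Sum.elim (fun a => ∑ j, y a i j) fun l => if i = l then 0 else 1)
      (Sum.elim (fun a => Sum.elim (fun _ => 0)
          fun l => ∑ i, ∑ j, if L i j = l then y (σ a) i j else 0)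
        fun j => Sum.elim (fun a => ∑ i, y a i j) fun l => if j = l then 0 else 1) := by
  refine ⟨Sum.elim
      (fun a => Sum.elim (fun _ _ => 0) fun j => Sum.elim (fun _ => 0)
        fun l => ∑ i, if L i j = l then y (τ a) i j else 0)
      fun i => Sum.elim
        (fun a => Sum.elim (fun _ => 0) fun l => ∑ j, if L i j = l then y (σ a) i j else 0)
        fun j => Sum.elim (fun a => y a i j) fun l => if L i j = l then z i j else 0,
    fun _ _ _ _ => trivial, ?_, ?_, ?_⟩
  · rintro (i | i) (j | j)
    · simp
    · simp only [Fintype.sum_sum_type, Sum.elim_inl, Sum.elim_inr, sum_const_zero, zero_add]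
      rw [sum_comm]
      simp
    · simp only [Fintype.sum_sum_type, Sum.elim_inl, Sum.elim_inr, sum_const_zero, zero_add]
      rw [sum_comm]
      simp
    · simp only [Fintype.sum_sum_type, Sum.elim_inl, Sum.elim_inr]
      rw [← hy, add_comm]
      simp
  · rintro (i | i) (l | l)
    · simp
    · simp
    · simp
    · simp only [Fintype.sum_sum_type, Sum.elim_inl, Sum.elim_inr]
      rw [← hL.sum_row i l, Equiv.sum_comp σ fun a => ∑ j, if L i j = l then y a i j else 0,
        sum_comm, ← sum_add_distrib]
      refine sum_congr rfl fun j _ => ?_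
      rw [← hy, add_comm]
      split_ifs <;> simp
  · rintro (j | j) (l | l)
    · simp
    · simp
    · simp
    · simp only [Fintype.sum_sum_type, Sum.elim_inl, Sum.elim_inr]
      rw [← hL.sum_col j l, Equiv.sum_comp τ fun a => ∑ i, if L i j = l then y a i j else 0,
        sum_comm, ← sum_add_distrib]
      refine sum_congr rfl fun i _ => ?_
      rw [← hy, add_comm]
      split_ifs <;> simp

/-- A set of off-diagonal cells with all line sums equal to `q` yields a hole of size `q`. -/
theorem IsIdempotentLatin.twoType_unit (hL : IsIdempotentLatin L) (q : ℕ) (y z : B → B → ℕ)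
    (hy : ∀ i j, z i j + y i j = if i = j then 0 else 1)
    (hrow : ∀ i, ∑ j, y i j = q) (hcol : ∀ j, ∑ i, y i j = q)
    (hsym : ∀ l, (∑ i, ∑ j, if L i j = l then y i j else 0) = q) : TwoType Unit B 0 q 1 := by
  refine (hL.hasArray (A := Unit) (fun _ => y) z (by simpa using hy) 1 1).toOutline ?_ ?_ ?_
  · rintro (i | i) (j | j) <;> simp [profile, hrow, hcol]
  · rintro (i | i) (j | j) <;> simp only [profile, Sum.elim_inl, Sum.elim_inr, hrow]
    · simp
    · rw [sum_comm, hsym]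
  · rintro (i | i) (j | j) <;> simp [profile, hcol, hsym]

/-- Two sets of `N` off-diagonal cells with equal column degrees yield an array with two points of
the first type. -/
theorem IsIdempotentLatin.twoType_bool (hL : IsIdempotentLatin L) (y : Bool → B → B → ℕ)
    (z : B → B → ℕ) (c : B → ℕ) (N t ρ : ℕ)
    (hy : ∀ i j, z i j + ∑ a, y a i j = if i = j then 0 else 1)
    (hc : ∀ a j, ∑ i, y a i j = c j) (hct : ∀ j, c j ≤ t) (hN : ∑ j, c j = N)
    (hrow : ∀ a i, ∑ j, y a i j ≤ t)
    (hsym : ∀ a l, (∑ i, ∑ j, if L i j = l then y a i j else 0) ≤ t)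
    (hρ : ρ + N = Fintype.card B * t) : TwoType Bool B ρ t 1 := by
  have hsub : ∀ g : B → ℕ, (∀ i, g i ≤ t) → ∑ i, g i = N → ∑ i, (t - g i) = ρ := fun g hg hs => by
    rw [sum_tsub_distrib _ fun i _ => hg i, hs, sum_const, card_univ, smul_eq_mul, ← hρ,
      Nat.add_sub_cancel]
  have hrowN : ∀ a, ∑ i, ∑ j, y a i j = N := fun a => by
    rw [sum_comm, ← hN]
    exact sum_congr rfl fun j _ => hc a j
  have hsymN : ∀ a, (∑ l, ∑ i, ∑ j, if L i j = l then y a i j else 0) = N := fun a => by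
    rw [← hrowN a, sum_comm]
    refine sum_congr rfl fun i _ => ?_
    rw [sum_comm]
    simp
  have h1 := hL.hasArray y z hy (Equiv.boolNot) 1
  have h2 : HasArray (I := Bool ⊕ B) (J := Bool ⊕ B) (K := Bool ⊕ B) (fun _ _ _ => True)
      (Sum.elim (fun a => Sum.elim (fun a' => if a = a' then 0 else ρ) fun j => t - c j)
        fun i => Sum.elim (fun a => t - ∑ j, y (!a) i j) fun _ => 0)
      (Sum.elim (fun a => Sum.elim (fun a' => if a = a' then 0 else ρ)
          fun l => t - ∑ i, ∑ j, if L i j = l then y a i j else 0)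
        fun i => Sum.elim (fun a => t - ∑ j, y a i j) fun _ => 0)
      (Sum.elim (fun a => Sum.elim (fun a' => if a = a' then 0 else ρ)
          fun l => t - ∑ i, ∑ j, if L i j = l then y (!a) i j else 0)
        fun j => Sum.elim (fun _ => t - c j) fun _ => 0) := by
    refine ⟨Sum.elim
      (fun a => Sum.elim
        (fun a' => Sum.elim (fun _ => 0)
          fun l => if a = a' then 0 else t - ∑ i, ∑ j, if L i j = l then y a i j else 0)
        fun j => Sum.elim (fun a' => if a = a' then 0 else t - c j) fun _ => 0)
      fun i => Sum.elim
        (fun a => Sum.elim (fun a' => if a = a' then 0 else t - ∑ j, y a' i j) fun _ => 0)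
        fun j => fun _ => 0, fun _ _ _ _ => trivial, ?_, ?_, ?_⟩
    · rintro (a | i) (b | j)
      · by_cases hab : a = b
        · simp [hab]
        · simp only [Fintype.sum_sum_type, Sum.elim_inl, Sum.elim_inr, if_neg hab]
          simp [hsub _ (hsym a) (hsymN a)]
      · cases a <;> simp
      · cases b <;> simp
      · simp
    · rintro (a | i) (b | j)
      · by_cases hab : a = b
        · simp [hab]
        · simp only [Fintype.sum_sum_type, Sum.elim_inl, Sum.elim_inr, if_neg hab]
          simp [hsub _ hct hN]
      · cases a <;> simp
      · cases b <;> simp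
      · simp
    · rintro (a | i) (b | j)
      · by_cases hab : a = b
        · simp [hab]
        · simp only [Fintype.sum_sum_type, Sum.elim_inl, Sum.elim_inr, if_neg hab]
          simp [hsub _ (hrow b) (hrowN b)]
      · cases a <;> simp
      · cases b <;> simp
      · simp
  refine (h1.add h2).toOutline ?_ ?_ ?_
  · rintro (a | i) (b | j) <;>
      simp only [profile, Pi.add_apply, Sum.elim_inl, Sum.elim_inr, zero_add, add_zero]
    · rw [Equiv.Perm.one_apply, hc, Nat.add_sub_cancel' (hct j)]
    · exact Nat.add_sub_cancel' (hrow (!b) i)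
  · rintro (a | i) (b | j) <;>
      simp only [profile, Pi.add_apply, Sum.elim_inl, Sum.elim_inr, zero_add, add_zero]
    · rw [Equiv.Perm.one_apply, sum_comm, Nat.add_sub_cancel' (hsym a j)]
    · exact Nat.add_sub_cancel' (hrow b i)
  · rintro (a | i) (b | j) <;>
      simp only [profile, Pi.add_apply, Sum.elim_inl, Sum.elim_inr, zero_add, add_zero]
    · exact Nat.add_sub_cancel' (hsym (!a) j)
    · rw [hc, Nat.add_sub_cancel' (hct i)]

end Latin

/-- The maps `θ` and `id - θ` are injective and fix zero. -/
structure IsStarter {G : Type*} [AddCommGroup G] (θ : G → G) : Prop where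
  map_zero : θ 0 = 0
  inj : Function.Injective θ
  sub_inj : Function.Injective fun d => d - θ d

section Group

variable {G : Type*} [AddCommGroup G] {θ : G → G}

theorem IsStarter.isIdempotentLatin (hθ : IsStarter θ) :
    IsIdempotentLatin fun i j : G => i + θ (j - i) where
  idem i := by simp [hθ.map_zero]
  row i j j' h := by simpa using hθ.inj (add_left_cancel h)
  col j i i' h := by
    simp only at h
    have : (j - i) - θ (j - i) = (j - i') - θ (j - i') := by
      rw [sub_sub, sub_sub, h]
    simpa using hθ.sub_inj this

variable [Fintype G] [DecidableEq G]

theorem IsStarter.twoType_unit (hθ : IsStarter θ) (D : Finset G) (hD : 0 ∉ D) :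
    TwoType Unit G 0 #D 1 := by
  have hsum : (∑ d, if d ∈ D then 1 else 0) = #D := by simp
  refine hθ.isIdempotentLatin.twoType_unit #D (fun i j => if j - i ∈ D then 1 else 0)
    (fun i j => if i = j then 0 else if j - i ∈ D then 0 else 1) ?_ ?_ ?_ ?_
  · intro i j
    by_cases hij : i = j
    · simp [hij, hD]
    · by_cases h : j - i ∈ D <;> simp [hij, h]
  · intro i
    rw [← hsum]
    exact Equiv.sum_comp (Equiv.subRight i) fun d => if d ∈ D then 1 else 0
  · intro j
    rw [← hsum]
    exact Equiv.sum_comp (Equiv.subLeft j) fun d => if d ∈ D then 1 else 0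
  · intro l
    have h1 : ∀ i, (∑ j, if i + θ (j - i) = l then (if j - i ∈ D then 1 else 0) else 0) =
        ∑ d, if i = l - θ d then (if d ∈ D then 1 else 0) else 0 := fun i => by
      simp only [eq_sub_iff_add_eq]
      exact Equiv.sum_comp (Equiv.subRight i)
        fun d => if i + θ d = l then (if d ∈ D then 1 else 0) else 0
    simp only [h1]
    rw [sum_comm, ← hsum]
    simp

theorem IsStarter.twoType_unit_of_lt (hθ : IsStarter θ) {q : ℕ} (hq : q < Fintype.card G) :
    TwoType Unit G 0 q 1 := by
  obtain ⟨D, hD, rfl⟩ := exists_subset_card_eq (s := univ.erase (0 : G)) (n := q)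
    (by rw [card_erase_of_mem (mem_univ _), card_univ]; omega)
  exact hθ.twoType_unit D fun h => by simpa using hD h

end Group

theorem isStarter_half {v : ℕ} (hv : Odd v) :
    IsStarter fun d : ZMod v => d * (2 : ZMod v)⁻¹ := by
  have h2 : (2 : ZMod v) * 2⁻¹ = 1 := by
    have := ZMod.coe_mul_inv_eq_one (n := v) 2 (Nat.coprime_two_left.2 hv)
    exact_mod_cast this
  have hinj : Function.Injective fun d : ZMod v => d * (2 : ZMod v)⁻¹ := fun d d' h => by
    simp only at h
    linear_combination 2 * h - (d - d') * h2
  refine ⟨by simp, hinj, ?_⟩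
  convert hinj using 2 with d
  linear_combination (-d) * h2

theorem isStarter_four :
    IsStarter fun d : ZMod 2 × ZMod 2 => (d.2, d.1 + d.2) :=
  ⟨by decide, by decide, by decide⟩

theorem isStarter_eight :
    IsStarter fun d : ZMod 2 × ZMod 2 × ZMod 2 => (d.2.2, d.1 + d.2.2, d.2.1) :=
  ⟨by decide, by decide, by decide⟩

/-- The array with value `c` on all triples of points from three different classes. -/
theorem HasOutline.cross (A B C : Type*) [Fintype A] [Fintype B] [Fintype C] (c : ℕ) :
    HasOutline (I := A ⊕ (B ⊕ C))
      (Sum.elim (fun _ => Sum.elim (fun _ => 0)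
          (Sum.elim (fun _ => c * Fintype.card C) fun _ => c * Fintype.card B))
        (Sum.elim
          (fun _ => Sum.elim (fun _ => c * Fintype.card C)
            (Sum.elim (fun _ => 0) fun _ => c * Fintype.card A))
          fun _ => Sum.elim (fun _ => c * Fintype.card B)
            (Sum.elim (fun _ => c * Fintype.card A) fun _ => 0))) := by
  let col : A ⊕ (B ⊕ C) → Fin 3 := Sum.elim (fun _ => 0) (Sum.elim (fun _ => 1) fun _ => 2)
  refine ⟨fun i j k => if col i ≠ col j ∧ col i ≠ col k ∧ col j ≠ col k then c else 0,
    fun _ _ _ _ => trivial, ?_, ?_, ?_⟩ <;>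
  · rintro (i | i | i) (j | j | j) <;> simp [col, mul_comm c]

section Double

variable {W W' : Type*} [Fintype W] [Fintype W'] [DecidableEq W] [DecidableEq W']

theorem TwoType.extend_left {q r : ℕ} (h : TwoType Unit W' 0 q r) :
    HasOutline (I := Unit ⊕ (W ⊕ W'))
      (Sum.elim (fun _ => Sum.elim (fun _ => 0) (Sum.elim (fun _ => 0) fun _ => q))
        (Sum.elim (fun _ _ => 0)
          fun i => Sum.elim (fun _ => q)
            (Sum.elim (fun _ => 0) fun j => if i = j then 0 else r))) := by
  refine (HasOutline.equiv (((Equiv.sumCongr (Equiv.refl _) (Equiv.sumComm _ _)).trans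
    (Equiv.sumAssoc _ _ _).symm).trans (Equiv.sumComm _ _)) (HasOutline.extend (I := W) h)).congr ?_
  rintro (i | i | i) (j | j | j) <;> simp [profile]

theorem TwoType.extend_right {q r : ℕ} (h : TwoType Unit W 0 q r) :
    HasOutline (I := Unit ⊕ (W ⊕ W'))
      (Sum.elim (fun _ => Sum.elim (fun _ => 0) (Sum.elim (fun _ => q) fun _ => 0))
        (Sum.elim
          (fun i => Sum.elim (fun _ => q)
            (Sum.elim (fun j => if i = j then 0 else r) fun _ => 0))
          fun _ _ => 0)) := by
  refine (HasOutline.equiv (((Equiv.sumAssoc _ _ _).symm).trans (Equiv.sumComm _ _))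
    (HasOutline.extend (I := W') h)).congr ?_
  rintro (i | i | i) (j | j | j) <;> simp [profile]

theorem TwoType.double_large (hc : Fintype.card W = Fintype.card W') {q : ℕ}
    (h : TwoType Unit W 0 q 1) (h' : TwoType Unit W' 0 q 1) :
    TwoType Unit (W ⊕ W') 0 (Fintype.card W + q) 1 := by
  refine (((HasOutline.cross Unit W W' 1).add (h.extend_right (W' := W'))).add
    (h'.extend_left (W := W))).congr ?_
  rintro (i | i | i) (j | j | j) <;> simp [profile, hc]

theorem fibreCard_sum_map_inl {I J I' J' : Type*} [Fintype I'] [Fintype J'] [DecidableEq I]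
    [DecidableEq J] (f : I' → I) (g : J' → J) (i : I) :
    fibreCard (Sum.map f g) (Sum.inl i) = fibreCard f i := by
  simp only [fibreCard, card_filter, Fintype.sum_sum_type]
  simp

theorem fibreCard_sum_map_inr {I J I' J' : Type*} [Fintype I'] [Fintype J'] [DecidableEq I]
    [DecidableEq J] (f : I' → I) (g : J' → J) (j : J) :
    fibreCard (Sum.map f g) (Sum.inr j) = fibreCard g j := by
  simp only [fibreCard, card_filter, Fintype.sum_sum_type]
  simp

theorem fibreCard_id {I : Type*} [Fintype I] [DecidableEq I] (i : I) : fibreCard id i = 1 :=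
  fibreCard_equiv (Equiv.refl I) i

theorem fibreCard_const_unit {I : Type*} [Fintype I] (i : Unit) :
    fibreCard (fun _ : I => ()) i = Fintype.card I := by
  simp [fibreCard]

theorem TwoType.double_small (hc : Fintype.card W = Fintype.card W') {q q' : ℕ}
    (hq : q' + q = Fintype.card W) (h : TwoType Unit W 0 q' 1) (h' : TwoType Unit W' 0 0 1) :
    TwoType Unit (W ⊕ W') 0 q 1 := by
  have h1 := HasOutline.equiv (Equiv.sumCongr (Equiv.refl Unit) (Equiv.sumComm W Unit))
    (HasOutline.extend (I := Unit) h)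
  have h2 := h1.add (HasOutline.cross Unit W Unit q)
  have h3 := HasOutline.split
    (p := Sum.elim (fun _ => Sum.elim (fun _ => 0) fun _ => q)
      (Sum.elim
        (fun i => Sum.elim (fun _ => q) (Sum.elim (fun j => if i = j then 0 else 1) fun _ => 1))
        fun _ => Sum.elim (fun _ => q) (Sum.elim (fun _ => 1) fun _ => 0)))
    (Sum.map (id : Unit → Unit) (Sum.map (id : W → W) fun _ : W' => ())) (h2.congr (by
    rintro (i | i | i) (j | j | j) <;>
      simp [profile, fibreCard_sum_map_inl, fibreCard_sum_map_inr, fibreCard_id,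
        fibreCard_const_unit, ← hc, hq, mul_comm]))
  refine (h3.add (h'.extend_left (W := W))).congr ?_
  rintro (i | i | i) (j | j | j) <;> simp [profile]

end Double

/-- `v ≥ 3` points of the second type and a hole of any size `q < v`. -/
theorem twoType_unit_fin (v : ℕ) (hv : 3 ≤ v) :
    ∀ q < v, TwoType Unit (Fin v) 0 q 1 := by
  induction v using Nat.strong_induction_on with
  | _ v ih =>
    have of_odd : ∀ v, Odd v → ∀ q < v, TwoType Unit (Fin v) 0 q 1 := fun v hodd q hq => by
      have : NeZero v := ⟨by omega⟩
      exact ((isStarter_half hodd).twoType_unit_of_lt (by simpa using hq)).equiv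
        (Equiv.refl _) (Fintype.equivOfCardEq (by simp))
    intro q hq
    rcases Nat.even_or_odd v with heven | hodd
    swap
    · exact of_odd v hodd q hq
    obtain ⟨w, rfl⟩ := heven
    rcases eq_or_ne w 2 with rfl | hw2
    · exact (isStarter_four.twoType_unit_of_lt (by simpa using hq)).equiv
        (Equiv.refl _) (Fintype.equivOfCardEq (by simp))
    have ihw := ih w (by omega) (by omega)
    rcases Nat.eq_zero_or_pos q with rfl | hq0
    · have h := of_odd (w + w - 1) (Nat.Even.sub_odd (by omega) ⟨w, rfl⟩ odd_one) 1
        (by omega)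
      have e : Fin (w + w) ≃ Unit ⊕ Fin (w + w - 1) :=
        Fintype.equivOfCardEq (by simp; omega)
      refine (HasOutline.extend (I := Unit) (HasOutline.equiv e h)).congr ?_
      have key : ∀ x y : Unit ⊕ Fin (w + w - 1), profile 0 1 1 x y = if x = y then 0 else 1 := by
        rintro (i | i) (j | j) <;> simp [profile]
      simp only [key, e.injective.eq_iff]
      rintro (i | i) (j | j) <;> simp [profile]
    rcases lt_or_ge q w with hqw | hqw
    · exact (TwoType.double_small (W := Fin w) (W' := Fin w) rfl (q' := w - q) (by simp; omega)
        (ihw _ (by omega)) (ihw _ (by omega))).equiv (Equiv.refl _) finSumFinEquiv.symm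
    · have := (TwoType.double_large (W := Fin w) (W' := Fin w) rfl
        (ihw (q - w) (by omega)) (ihw _ (by omega))).equiv (Equiv.refl _) finSumFinEquiv.symm
      simpa [Nat.add_sub_cancel' hqw] using this

section Mix

variable {A B : Type*} [Fintype A] [Fintype B] [DecidableEq A] [DecidableEq B]

theorem twoType_unit_of_le (hB : 3 ≤ Fintype.card B) (r : ℕ) :
    ∀ q ≤ (Fintype.card B - 1) * r, TwoType Unit B 0 q r := by
  have hunit : ∀ q < Fintype.card B, TwoType Unit B 0 q 1 := fun q hq =>
    (twoType_unit_fin _ hB q hq).equiv (Equiv.refl _) (Fintype.equivFin B)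
  induction r with
  | zero =>
    intro q hq
    obtain rfl : q = 0 := by simpa using hq
    simpa using (hunit 0 (by omega)).mul 0
  | succ r ih =>
    intro q hq
    rw [Nat.mul_succ] at hq
    have := (ih (q - min q (Fintype.card B - 1)) (by omega)).add
      (hunit (min q (Fintype.card B - 1)) (by omega))
    rwa [Nat.sub_add_cancel (min_le_left _ _)] at this

/-- An array without triples containing two points of the first type. -/
theorem twoType_of_le (hB : 3 ≤ Fintype.card B) {t r : ℕ}
    (h : Fintype.card A * t ≤ (Fintype.card B - 1) * r) : TwoType A B 0 t r := by
  have h1 := HasOutline.split (p := profile 0 t r) (Sum.map (fun _ : A => ()) (id : B → B))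
    ((twoType_unit_of_le hB r _ h).congr (by
      rintro (i | i) (j | j) <;>
        simp [profile, fibreCard_sum_map_inl, fibreCard_sum_map_inr, fibreCard_id,
          fibreCard_const_unit]))
  refine h1.congr ?_
  rintro (i | i) (j | j) <;> simp [profile]

theorem twoType_one (h : 3 ≤ Fintype.card (A ⊕ B)) : TwoType A B 1 1 1 := by
  have h1 := HasOutline.split (p := profile 0 0 1) (Sum.inr : A ⊕ B → Unit ⊕ (A ⊕ B))
    ((twoType_unit_of_le (B := A ⊕ B) h 1 0 (by omega)).congr (by
      rintro (i | i) (j | j) <;> simp [profile, fibreCard, filter_eq']))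
  refine h1.congr ?_
  rintro (i | i) (j | j) <;> simp [profile]

theorem twoType_of_three_le (hA : 3 ≤ Fintype.card A) {a b : ℕ} (hab : b < a) (hb : 0 < b) :
    TwoType A B (a * a) (a * b) (b * b) := by
  obtain ⟨U, hU⟩ : ∃ U, Fintype.card A = U + 1 := ⟨Fintype.card A - 1, by omega⟩
  have hU2 : 2 ≤ U := by omega
  have key : ∀ s t, Fintype.card B * t ≤ U * s → TwoType A B s t 0 := fun s t h =>
    (twoType_of_le hA (by rwa [hU, Nat.add_sub_cancel])).symm
  by_cases h1 : Fintype.card B * b ≤ U * (a + b)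
  · obtain ⟨d, rfl⟩ := Nat.exists_eq_add_of_lt hab
    have h2 := ((twoType_one (A := A) (B := B) (by simp; omega)).mul (b * b)).add
      (key ((d + 1) * (b + d + 1 + b)) ((d + 1) * b)
        (by nlinarith [Nat.mul_le_mul_left (d + 1) h1]))
    convert h2 using 1 <;> ring
  obtain ⟨V, hV⟩ : ∃ V, Fintype.card B = V + 1 := ⟨Fintype.card B - 1, by
    rcases Nat.eq_zero_or_pos (Fintype.card B) with h | h
    · simp [h] at h1
    · omega⟩
  rw [hV] at h1 key
  have hV2 : 2 ≤ V := by
    by_contra hlt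
    exact h1 (by nlinarith)
  have key' : ∀ t r, (U + 1) * t ≤ V * r → TwoType A B 0 t r := fun t r h =>
    twoType_of_le (by omega) (by rwa [hU, hV, Nat.add_sub_cancel])
  by_cases h2 : (U + 1) * a ≤ V * b
  · simpa using (key (a * a) 0 (by simp)).add
      (key' (a * b) (b * b) (by nlinarith [Nat.mul_le_mul_right b h2]))
  push Not at h1 h2
  set t := V * (b * b) / (U + 1) with ht
  have ht1 : (U + 1) * t ≤ V * (b * b) := Nat.mul_div_le _ _
  have ht2 : V * (b * b) < (U + 1) * (t + 1) := Nat.lt_mul_div_succ _ (by omega)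
  have ht3 : t ≤ a * b := by
    by_contra hlt
    have h3 : (U + 1) * (a * b) ≤ (U + 1) * t := Nat.mul_le_mul_left _ (by omega)
    nlinarith [Nat.mul_lt_mul_of_pos_right h2 hb]
  obtain ⟨s, hs⟩ := Nat.exists_eq_add_of_le ht3
  have hs1 : (U + 1) * s ≤ a * b := by
    have e1 : (U + 1) * (a * b) = (U + 1) * t + (U + 1) * s := by rw [hs]; ring
    have e2 : U * (a * b) + U ≤ V * (b * b) := by
      have h3 : (U * (a + b) + 1) * b ≤ (V + 1) * b * b := Nat.mul_le_mul_right b h1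
      obtain ⟨W, rfl⟩ : ∃ W, U = W + 1 := ⟨U - 1, by omega⟩
      have h4 : W * 1 ≤ W * (b * b) := Nat.mul_le_mul_left _ (Nat.mul_pos hb hb)
      nlinarith
    nlinarith
  have hs2 : (V + 1) * s ≤ U * (a * a) := by
    refine Nat.le_of_mul_le_mul_left (c := U + 1) ?_ (by omega)
    have h3 : (V + 1) * ((U + 1) * s) ≤ (V + 1) * (a * b) := Nat.mul_le_mul_left _ hs1
    have h4 : (V + 1) * b * a ≤ ((U + 1) * a + b) * a := Nat.mul_le_mul_right _ (by nlinarith)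
    have h5 : b * a ≤ a * a := Nat.mul_le_mul_right _ hab.le
    have h6 : (U + 2) * (a * a) ≤ (U + 1) * U * (a * a) := Nat.mul_le_mul_right _ (by nlinarith)
    nlinarith
  have h3 := (key (a * a) s hs2).add (key' t (b * b) ht1)
  rwa [add_comm s, ← hs, add_zero, zero_add] at h3

end Mix

/-- The cells `(f s j, j)`, `j ∈ C`, for `s < n`, form `n` disjoint off-diagonal partial
transversals of the idempotent latin square `L`. -/
structure IsTransversalFamily {B : Type*} (L : B → B → B) (C : Finset B) (n : ℕ)
    (f : ℕ → B → B) : Prop where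
  latin : IsIdempotentLatin L
  inj : ∀ s < n, ∀ j ∈ C, ∀ j' ∈ C, f s j = f s j' → j = j'
  symbol_inj : ∀ s < n, ∀ j ∈ C, ∀ j' ∈ C, L (f s j) j = L (f s j') j' → j = j'
  ne : ∀ s < n, ∀ j ∈ C, f s j ≠ j
  disjoint : ∀ s < n, ∀ s' < n, ∀ j ∈ C, f s j = f s' j → s = s'

theorem sum_ite_le_one {α : Type*} (S : Finset α) (P : α → Prop) [DecidablePred P]
    (h : ∀ x ∈ S, ∀ y ∈ S, P x → P y → x = y) : (∑ x ∈ S, if P x then 1 else 0) ≤ 1 := by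
  rw [← card_filter, card_le_one]
  intro x hx y hy
  rw [mem_filter] at hx hy
  exact h x hx.1 y hy.1 hx.2 hy.2

theorem exists_bounded_sum {B : Type*} (C : Finset B) (t : ℕ) :
    ∀ N ≤ t * #C, ∃ c : B → ℕ, (∀ j, c j ≤ t) ∧ (∀ j ∉ C, c j = 0) ∧ ∑ j ∈ C, c j = N := by
  classical
  induction C using Finset.induction_on with
  | empty =>
    intro N hN
    exact ⟨fun _ => 0, by simp, by simp, by simpa [eq_comm] using hN⟩
  | insert x C hx ih =>
    intro N hN
    rw [card_insert_of_notMem hx, Nat.mul_succ] at hN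
    obtain ⟨c, hc, hc0, hcN⟩ := ih (N - min N t) (by omega)
    refine ⟨Function.update c x (min N t), fun j => ?_, fun j hj => ?_, ?_⟩
    · by_cases hj : j = x
      · simp [hj]
      · simpa [hj] using hc j
    · rw [mem_insert, not_or] at hj
      simpa [hj.1] using hc0 j hj.2
    · rw [sum_insert hx, Function.update_self,
        sum_congr rfl fun j hj => Function.update_of_ne (ne_of_mem_of_not_mem hj hx) _ _, hcN]
      omega

section Family

variable {B : Type*} [Fintype B] [DecidableEq B] {L : B → B → B} {C : Finset B} {n : ℕ}
  {f : ℕ → B → B}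

theorem IsTransversalFamily.twoType (hF : IsTransversalFamily L C n f) {t t' N ρ : ℕ}
    (hn : t' + t' ≤ n) (ht : t' ≤ t) (hN : N ≤ t' * #C) (hρ : ρ + N = Fintype.card B * t) :
    TwoType Bool B ρ t 1 := by
  obtain ⟨c, hc, hc0, hcN⟩ := exists_bounded_sum C t' N hN
  have hmem : ∀ {s j}, s < c j → j ∈ C := fun {s j} h => by
    by_contra hj
    simp [hc0 j hj] at h
  let g : Bool → ℕ → ℕ := fun β s => s + if β then t' else 0
  have hg : ∀ β s, s < t' → g β s < n := fun β s hs => by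
    cases β <;> simp [g] <;> omega
  let y : Bool → B → B → ℕ := fun β i j =>
    ∑ s ∈ range t', if s < c j ∧ f (g β s) j = i then 1 else 0
  have hy : ∀ i j, ∑ β, y β i j ≤ if i = j then 0 else 1 := fun i j => by
    split_ifs with hij
    · subst hij
      refine (sum_eq_zero fun β _ => sum_eq_zero fun s hs => if_neg ?_).le
      rintro ⟨h1, h2⟩
      exact hF.ne _ (hg β s (mem_range.1 hs)) i (hmem h1) h2
    · rw [← sum_product' univ (range t')
        fun β s => if s < c j ∧ f (g β s) j = i then 1 else 0]
      refine sum_ite_le_one _ _ ?_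
      rintro ⟨β, s⟩ hs ⟨β', s'⟩ hs' ⟨h1, h2⟩ ⟨-, h3⟩
      simp only [mem_product, mem_univ, mem_range, true_and] at hs hs' h2 h3
      have := hF.disjoint _ (hg β s hs) _ (hg β' s' hs') j (hmem h1) (h2.trans h3.symm)
      cases β <;> cases β' <;> simp [g] at this ⊢ <;> omega
  refine hF.latin.twoType_bool y (fun i j => (if i = j then 0 else 1) - ∑ β, y β i j) c N t ρ
    (fun i j => Nat.sub_add_cancel (hy i j)) ?_ (fun j => (hc j).trans ht) ?_ ?_ ?_ hρ
  · intro β j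
    simp only [y]
    rw [sum_comm]
    have : ∀ s, (∑ i, if s < c j ∧ f (g β s) j = i then 1 else 0) = if s < c j then 1 else 0 :=
      fun s => by by_cases h : s < c j <;> simp [h]
    simp only [this]
    rw [← card_filter]
    have h2 : (range t').filter (fun s => s < c j) = range (c j) := by
      ext s
      have := hc j
      simp only [mem_filter, mem_range]
      omega
    rw [h2, card_range]
  · rw [← hcN]
    exact (sum_subset (subset_univ C) fun j _ hj => hc0 j hj).symm
  · intro β i
    simp only [y]
    rw [sum_comm]
    refine (sum_le_sum (g := fun _ => 1) fun s hs => sum_ite_le_one _ _ ?_).trans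
      (by simpa using ht)
    rintro j - j' - ⟨h1, h2⟩ ⟨h3, h4⟩
    exact hF.inj _ (hg β s (mem_range.1 hs)) j (hmem h1) j' (hmem h3) (h2.trans h4.symm)
  · intro β l
    have h1 : ∀ j, (∑ i, if L i j = l then y β i j else 0) =
        ∑ s ∈ range t', if s < c j ∧ L (f (g β s) j) j = l then 1 else 0 := fun j => by
      have : ∀ i, (if L i j = l then y β i j else 0) =
          ∑ s ∈ range t', if f (g β s) j = i then
            (if s < c j ∧ L (f (g β s) j) j = l then 1 else 0) else 0 := fun i => by
        simp only [y]
        by_cases hl : L i j = l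
        · rw [if_pos hl]
          refine sum_congr rfl fun s _ => ?_
          by_cases hi : f (g β s) j = i
          · simp [hi, hl]
          · simp [hi]
        · rw [if_neg hl]
          refine (sum_eq_zero fun s _ => ?_).symm
          by_cases hi : f (g β s) j = i
          · simp [hi, hl]
          · simp [hi]
      simp only [this]
      rw [sum_comm]
      simp
    rw [sum_comm]
    simp only [h1]
    rw [sum_comm]
    refine (sum_le_sum (g := fun _ => 1) fun s hs => sum_ite_le_one _ _ ?_).trans
      (by simpa using ht)
    rintro j - j' - ⟨h1, h2⟩ ⟨h3, h4⟩
    exact hF.symbol_inj _ (hg β s (mem_range.1 hs)) j (hmem h1) j' (hmem h3) (h2.trans h4.symm)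

end Family

theorem exists_enumeration {G : Type*} [Zero G] (D : Finset G) :
    ∃ d : ℕ → G, (∀ s < #D, d s ∈ D) ∧ ∀ s < #D, ∀ s' < #D, d s = d s' → s = s' := by
  refine ⟨fun s => if h : s < #D then (D.equivFin.symm ⟨s, h⟩ : G) else 0, fun s hs => ?_,
    fun s hs s' hs' h => ?_⟩
  · simp only [dif_pos hs]
    exact Subtype.prop _
  · simp only [dif_pos hs, dif_pos hs'] at h
    simpa using D.equivFin.symm.injective (Subtype.ext h)

section Group

variable {G : Type*} [AddCommGroup G] [DecidableEq G] {θ : G → G}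

/-- The prolongation of the square of a starter along the diagonal of difference `δ`. -/
def prolong (θ : G → G) (δ : G) : Option G → Option G → Option G
  | some i, some j => if j - i = δ then none else some (i + θ (j - i))
  | some i, none => some (i + θ δ)
  | none, some j => some (j - δ + θ δ)
  | none, none => none

theorem IsStarter.prolong_isIdempotentLatin (hθ : IsStarter θ) {δ : G} (hδ : δ ≠ 0) :
    IsIdempotentLatin (prolong θ δ) where
  idem i := by
    cases i <;> simp [prolong, hδ.symm, hθ.map_zero]
  row i j j' h := by
    rcases i with _ | i <;> rcases j with _ | j <;> rcases j' with _ | j' <;>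
      simp only [prolong] at h
    · rfl
    · simp at h
    · simp at h
    · simpa using h
    · rfl
    · split_ifs at h with h1
      simp only [Option.some.injEq] at h
      exact absurd (hθ.inj (add_left_cancel h)).symm h1
    · split_ifs at h with h1
      simp only [Option.some.injEq] at h
      exact absurd (hθ.inj (add_left_cancel h)) h1
    · split_ifs at h with h1 h2
      · rw [← h2] at h1
        simpa using h1
      · simp only [Option.some.injEq] at h
        simpa using hθ.inj (add_left_cancel h)
  col j i i' h := by
    have key : ∀ i i' : G, ∀ d d' : G, i = j.getD 0 - d → i' = j.getD 0 - d' →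
        i + θ d = i' + θ d' → d = d' := fun i i' d d' hi hi' h => by
      refine hθ.sub_inj ?_
      have e : ∀ d, d - θ d = j.getD 0 - (j.getD 0 - d + θ d) := fun d => by abel
      simp only
      rw [e d, e d', ← hi, ← hi', h]
    rcases j with _ | j <;> rcases i with _ | i <;> rcases i' with _ | i' <;>
      simp only [prolong] at h
    · rfl
    · simp at h
    · simp at h
    · simpa using h
    · rfl
    · split_ifs at h with h1
      simp only [Option.some.injEq] at h
      exact absurd (key _ _ δ (j - i') (by simp) (by simp) h).symm h1
    · split_ifs at h with h1
      simp only [Option.some.injEq] at h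
      exact absurd (key _ _ (j - i) δ (by simp) (by simp) h) h1
    · split_ifs at h with h1 h2
      · rw [← h2] at h1
        simpa using h1
      · simp only [Option.some.injEq] at h
        simpa using key _ _ (j - i) (j - i') (by simp) (by simp) h

variable [Fintype G]

theorem IsStarter.exists_family (hθ : IsStarter θ) {n : ℕ} (hn : n < Fintype.card G) :
    ∃ f, IsTransversalFamily (fun i j : G => i + θ (j - i)) univ n f := by
  obtain ⟨d, hd, hdi⟩ := exists_enumeration (univ.erase (0 : G))
  have hcard : n ≤ #(univ.erase (0 : G)) := by
    rw [card_erase_of_mem (mem_univ _), card_univ]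
    omega
  refine ⟨fun s j => j - d s, hθ.isIdempotentLatin, ?_, ?_, ?_, ?_⟩
  · intro s _ j _ j' _ h
    simpa using h
  · intro s _ j _ j' _ h
    simpa using h
  · intro s hs j _ h
    have := hd s (hs.trans_le hcard)
    simp_all
  · intro s hs s' hs' j _ h
    exact hdi s (hs.trans_le hcard) s' (hs'.trans_le hcard) (by simpa using h)

theorem IsStarter.exists_family_prolong (hθ : IsStarter θ) {δ : G} (hδ : δ ≠ 0) {n : ℕ}
    (hn : n + 2 ≤ Fintype.card G) :
    ∃ f, IsTransversalFamily (prolong θ δ) (univ.erase none) n f := by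
  obtain ⟨d, hd, hdi⟩ := exists_enumeration ((univ.erase (0 : G)).erase δ)
  have hcard : n ≤ #((univ.erase (0 : G)).erase δ) := by
    rw [card_erase_of_mem (by simpa using hδ), card_erase_of_mem (mem_univ _), card_univ]
    omega
  have hd' : ∀ s < n, d s ≠ δ ∧ d s ≠ 0 := fun s hs => by
    simpa using hd s (hs.trans_le hcard)
  refine ⟨fun s => Option.map fun j => j - d s, hθ.prolong_isIdempotentLatin hδ, ?_, ?_, ?_, ?_⟩
  · rintro s - (_ | j) hj (_ | j') hj' h
    · simp at hj
    · simp at hj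
    · simp at hj'
    · simpa using h
  · rintro s hs (_ | j) hj (_ | j') hj' h
    · simp at hj
    · simp at hj
    · simp at hj'
    · simpa [prolong, (hd' s hs).1] using h
  · rintro s hs (_ | j) hj h
    · simp at hj
    · exact (hd' s hs).2 (by simpa using h)
  · rintro s hs s' hs' (_ | j) hj h
    · simp at hj
    · exact hdi s (hs.trans_le hcard) s' (hs'.trans_le hcard) (by simpa using h)

end Group

/-- An idempotent latin square of order six with four disjoint partial transversals. -/
theorem isTransversalFamily_six : IsTransversalFamily (B := Fin 6)
    (fun i j => (![![0, 3, 4, 5, 2, 1], ![4, 1, 0, 2, 5, 3], ![3, 5, 2, 0, 1, 4],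
      ![1, 4, 5, 3, 0, 2], ![5, 2, 3, 1, 4, 0], ![2, 0, 1, 4, 3, 5]] : Fin 6 → Fin 6 → Fin 6) i j)
    (univ.erase 5) 4
    (fun s j => (![![1, 4, 3, 2, 5, 0], ![2, 5, 0, 4, 1, 0], ![3, 2, 1, 5, 0, 0],
      ![4, 0, 5, 1, 3, 0]] : Fin 4 → Fin 6 → Fin 6) (Fin.ofNat 4 s) j) :=
  ⟨⟨by decide, by decide, by decide⟩, by decide, by decide, by decide, by decide⟩

theorem exists_isTransversalFamily (v : ℕ) (hv : 3 ≤ v) :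
    ∃ (B : Type) (_ : Fintype B) (_ : DecidableEq B) (L : B → B → B) (C : Finset B) (h : ℕ)
      (f : ℕ → B → B), Fintype.card B = v ∧ 1 ≤ h ∧ v ≤ #C + 1 ∧ v * v ≤ 4 * (h * #C) ∧
        IsTransversalFamily L C (h + h) f := by
  rcases Nat.even_or_odd v with heven | hodd
  swap
  · obtain ⟨h, rfl⟩ := id hodd
    obtain ⟨f, hf⟩ := (isStarter_half hodd).exists_family (n := h + h) (by simp; omega)
    exact ⟨_, inferInstance, inferInstance, _, _, h, f, by simp, by omega, by simp,
      by simp; nlinarith, hf⟩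
  obtain ⟨w, rfl⟩ := heven
  rcases eq_or_ne w 2 with rfl | h2
  · obtain ⟨f, hf⟩ := isStarter_four.exists_family (n := 1 + 1) (by simp)
    exact ⟨_, inferInstance, inferInstance, _, _, 1, f, by simp, by simp, by simp, by simp, hf⟩
  rcases eq_or_ne w 3 with rfl | h3
  · exact ⟨_, inferInstance, inferInstance, _, _, 2, _, by simp, by simp, by simp, by simp,
      isTransversalFamily_six⟩
  rcases eq_or_ne w 4 with rfl | h4
  · obtain ⟨f, hf⟩ := isStarter_eight.exists_family (n := 3 + 3) (by simp)
    exact ⟨_, inferInstance, inferInstance, _, _, 3, f, by simp, by simp, by simp, by simp, hf⟩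
  obtain ⟨m, rfl⟩ : ∃ m, w = m + 5 := ⟨w - 5, by omega⟩
  have : Fact (1 < 2 * (m + 4) + 1) := ⟨by omega⟩
  obtain ⟨f, hf⟩ := (isStarter_half (v := 2 * (m + 4) + 1) ⟨_, rfl⟩).exists_family_prolong
    (δ := 1) one_ne_zero (n := (m + 3) + (m + 3)) (by simp; omega)
  exact ⟨_, inferInstance, inferInstance, _, _, m + 3, f, by simp; omega, by omega,
    by simp [card_erase_of_mem]; omega, by simp [card_erase_of_mem]; nlinarith, hf⟩

section Two

variable {B : Type*} [Fintype B] [DecidableEq B]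

theorem twoType_bool_card : TwoType Bool B (Fintype.card B) 1 0 := by
  refine (HasOutline.equiv ((Equiv.sumCongr Equiv.boolEquivPUnitSumPUnit (Equiv.refl B)).trans
    (Equiv.sumAssoc _ _ _)) (HasOutline.cross Unit Unit B 1)).congr ?_
  rintro (i | i) (j | j)
  · cases i <;> cases j <;> simp [profile, Equiv.boolEquivPUnitSumPUnit]
  · cases i <;> simp [profile, Equiv.boolEquivPUnitSumPUnit]
  · cases j <;> simp [profile, Equiv.boolEquivPUnitSumPUnit]
  · simp [profile]

theorem twoType_bool_one (hB : 3 ≤ Fintype.card B) {a : ℕ} (ha : a ≤ Fintype.card B) :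
    TwoType Bool B (a * a) a 1 := by
  obtain ⟨B', _, _, L, C, h, f, hcard, h1, hC, hh, hF⟩ := exists_isTransversalFamily _ hB
  refine TwoType.equiv (Equiv.refl _) (Fintype.equivOfCardEq hcard.symm) ?_
  obtain ⟨d, hd⟩ := Nat.exists_eq_add_of_le ha
  refine hF.twoType (t' := min a h) (N := a * d) (by omega) (by omega) ?_
    (by rw [hcard, hd]; ring)
  rcases le_total a h with hah | hah
  · rw [min_eq_left hah]
    rcases Nat.eq_zero_or_pos a with rfl | ha0
    · simp
    · exact Nat.mul_le_mul_left _ (by omega)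
  · rw [min_eq_right hah]
    rw [hd] at hh
    nlinarith [sq_nonneg ((a : ℤ) - d), two_mul_le_add_sq a d]

theorem twoType_bool_residue (hB : 3 ≤ Fintype.card B) {ρ : ℕ} (h0 : 0 < ρ)
    (hρ : ρ ≤ Fintype.card B) : TwoType Bool B ρ 1 1 := by
  obtain ⟨B', _, _, L, C, h, f, hcard, h1, hC, -, hF⟩ := exists_isTransversalFamily _ hB
  refine TwoType.equiv (Equiv.refl _) (Fintype.equivOfCardEq hcard.symm) ?_
  exact hF.twoType (t' := 1) (N := Fintype.card B - ρ) (by omega) le_rfl (by omega) (by omega)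

theorem twoType_bool_of_le (hB : 3 ≤ Fintype.card B) {a b : ℕ} (hb : 0 < b)
    (hab : a ≤ Fintype.card B * b) : TwoType Bool B (a * a) (a * b) (b * b) := by
  rcases eq_or_ne b 1 with rfl | hb1
  · simpa using twoType_bool_one hB (a := a) (by simpa using hab)
  have hb2 : 2 ≤ b := by omega
  obtain ⟨V, hV⟩ : ∃ V, Fintype.card B = V + 1 := ⟨Fintype.card B - 1, by omega⟩
  have hV2 : 2 ≤ V := by omega
  have key : ∀ t r, 2 * t ≤ V * r → TwoType Bool B 0 t r := fun t r h =>
    twoType_of_le hB (by rwa [Fintype.card_bool, hV, Nat.add_sub_cancel])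
  set Q := a * a / (V + 1) with hQ
  set ρ := a * a % (V + 1) with hρ
  have hdiv : Q * (V + 1) + ρ = a * a := Nat.div_add_mod' _ _
  have hlt : ρ < V + 1 := Nat.mod_lt _ (by omega)
  have hmul := (twoType_bool_card (B := B)).mul Q
  rw [hV] at hmul hab
  have hsq : 4 * ((V + 1) * (a * b)) ≤ 4 * (a * a) + (V + 1) * ((V + 1) * (b * b)) := by
    nlinarith [two_mul_le_add_sq (2 * a) ((V + 1) * b)]
  have haab : a * a ≤ (V + 1) * (a * b) := by
    nlinarith [Nat.mul_le_mul_left a hab]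
  rcases Nat.eq_zero_or_pos ρ with h0 | h0
  · rw [h0, add_zero] at hdiv
    have hQab : Q ≤ a * b := Nat.le_of_mul_le_mul_left (c := V + 1) (by nlinarith) (by omega)
    obtain ⟨t, ht⟩ := Nat.exists_eq_add_of_le hQab
    have h4 : 4 * t ≤ (V + 1) * (b * b) :=
      Nat.le_of_mul_le_mul_left (c := V + 1) (by rw [ht] at hsq; nlinarith) (by omega)
    have := hmul.add (key t (b * b) (by nlinarith [Nat.mul_le_mul_right (b * b) hV2]))
    rwa [hdiv, mul_one, ← ht, mul_zero, zero_add, add_zero] at this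
  · have hQab : Q < a * b := Nat.lt_of_mul_lt_mul_left (a := V + 1) (by nlinarith)
    obtain ⟨t, ht⟩ := Nat.exists_eq_add_of_lt hQab
    obtain ⟨c, hc⟩ := Nat.exists_eq_add_of_le' (show 4 ≤ b * b by nlinarith)
    have h4 : 4 * t < (V + 1) * (b * b) :=
      Nat.lt_of_mul_lt_mul_left (a := V + 1) (by rw [ht] at hsq; nlinarith)
    have := (hmul.add (twoType_bool_residue hB h0 (by omega))).add
      (key t (c + 3) (by rw [hc] at h4; nlinarith [Nat.mul_le_mul_right c hV2]))
    rw [hdiv] at this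
    convert this using 1 <;> omega

end Two

theorem TwoType.hasRealization {u v a b : ℕ}
    (h : TwoType (Fin u) (Fin v) (a * a) (a * b) (b * b)) :
    HasRealization fun i : Fin (u + v) => if (i : ℕ) < u then a else b := by
  refine HasOutline.hasRealization _ ((HasOutline.equiv finSumFinEquiv.symm h).congr ?_)
  intro i j
  obtain ⟨i, rfl⟩ := finSumFinEquiv.surjective i
  obtain ⟨j, rfl⟩ := finSumFinEquiv.surjective j
  simp only [Equiv.symm_apply_apply, finSumFinEquiv.injective.eq_iff]
  rcases i with i | i <;> rcases j with j | j <;> simp [profile, mul_comm]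

theorem hasRealization_iff {u v a b : ℕ} (hab : b < a) (hb : 0 < b) (hk : 4 < u + v)
    (hu : 1 ≤ u) :
    HasRealization (fun i : Fin (u + v) => if (i : ℕ) < u then a else b) ↔
      (3 ≤ u ∨ (0 < u ∧ u < 3 ∧ a ≤ (u + v - 2) * b)) := by
  constructor
  · intro H
    by_contra! hcon
    have hu3 : u < 3 := by omega
    have hlt := hcon.2 hu hu3
    have hsum : (∑ i : Fin (u + v), if (i : ℕ) < u then a else b) = u * a + v * b := by
      simp [Fin.sum_univ_add]
    have := two_mul_add_le_of_hasRealization H (i := ⟨0, by omega⟩) (j := ⟨1, by omega⟩)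
      (by simp) (by simp only; split_ifs <;> omega)
    rw [hsum] at this
    obtain rfl | rfl : u = 1 ∨ u = 2 := by omega
    · obtain ⟨w, rfl⟩ : ∃ w, v = w + 1 := ⟨v - 1, by omega⟩
      simp [show 1 + (w + 1) - 2 = w by omega] at this hlt
      nlinarith
    · simp at this hlt
      nlinarith
  · rintro (hu3 | ⟨-, hu3, h⟩)
    · exact (twoType_of_three_le (by simpa using hu3) hab hb).hasRealization
    · obtain rfl | rfl : u = 1 ∨ u = 2 := by omega
      · obtain ⟨w, rfl⟩ : ∃ w, v = w + 1 := ⟨v - 1, by omega⟩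
        rw [show 1 + (w + 1) - 2 = w by omega] at h
        exact ((twoType_of_le (A := Fin 1) (by simp; omega)
          (by simp; nlinarith)).of_subsingleton_left (a * a)).hasRealization
      · rw [Nat.add_sub_cancel_left] at h
        exact ((twoType_bool_of_le (by simp; omega) hb
          (by simpa using h)).equiv finTwoEquiv (Equiv.refl _)).hasRealization

end OutlineArray

/-- for `a > b > 0`, `k > 4` and `1 ≤ u ≤ k`, a realization
`LS(a^u b^{k−u})` exists if and only if `u ≥ 3`, or `0 < u < 3` and
`a ≤ (k−2) b`. -/
theorem statement10 (a b k u : ℕ) (hab : b < a) (hb : 0 < b) (hk : 4 < k)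
    (hu1 : 1 ≤ u) (hu2 : u ≤ k) :
    HasRealization (fun i : Fin k => if (i : ℕ) < u then a else b) ↔
      (3 ≤ u ∨ (0 < u ∧ u < 3 ∧ a ≤ (k - 2) * b)) := by
  obtain ⟨v, rfl⟩ := Nat.exists_eq_add_of_le hu2
  exact OutlineArray.hasRealization_iff hab hb hk hu1
end
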